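/- Let A be a finite set and ρ = ⊗_{i∈ℤ} ρ_i a product probability measure on A^ℤ that is nonsingular for the left shift S, satisfies the Doeblin condition, and has a limiting marginal measure p. Then for every ε > 0 there exist a finite set B, a probability measure q on B with H(q) > H(p) − ε, and a finitary factor map φ: A^ℤ → B^ℤ, i.e. a measurable map with φ∘S = S∘φ ρ-almost everywhere, with ρ∘φ^{-1} equivalent to the iid product measure q^ℤ, and such that for every b∈B the set {x : φ(x)_0 = b} coincides, up to a ρ-null set, with a countable union of cylinder sets of A^ℤ. -/

import Mathlib

open MeasureTheory Filter Set Topology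

/-- The cylinder set of points agreeing with `y` on the finite coordinate set `s`. -/
def cylinder {A : Type*} (s : Finset ℤ) (y : ℤ → A) : Set (ℤ → A) :=
  {x | ∀ i ∈ s, x i = y i}

/-- `μ` is the product measure on `A^ℤ` with marginals `ρ i`. -/
def IsProductMeasure {A : Type*} [MeasurableSpace A]
    (μ : Measure (ℤ → A)) (ρ : ℤ → A → ℝ) : Prop :=
  ∀ (s : Finset ℤ) (y : ℤ → A), μ (cylinder s y) = ∏ i ∈ s, ENNReal.ofReal (ρ i (y i))

/-- The left shift on `A^ℤ`. -/
def shift {A : Type*} : (ℤ → A) → (ℤ → A) := fun x i => x (i + 1)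

/-- Two measures are equivalent if they have the same null sets. -/
def MeasEquiv {X : Type*} [MeasurableSpace X] (μ ν : Measure X) : Prop :=
  μ ≪ ν ∧ ν ≪ μ

/-- `p` is a probability vector. -/
def IsProbVec {A : Type*} [Fintype A] (p : A → ℝ) : Prop :=
  (∀ a, 0 ≤ p a) ∧ ∑ a, p a = 1

/-- Shannon entropy (in bits) of a probability vector. -/
noncomputable def entropy {A : Type*} [Fintype A] (p : A → ℝ) : ℝ :=
  -∑ a, p a * Real.logb 2 (p a)

/-- `φ` is finitary: for every symbol `b`, the set `{x : φ(x)₀ = b}` agrees, up to a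
`μ`-null set, with a countable union of cylinder sets. -/
def IsFinitary {A B : Type*} [MeasurableSpace A] (μ : Measure (ℤ → A))
    (φ : (ℤ → A) → (ℤ → B)) : Prop :=
  ∀ b : B, ∃ (s : ℕ → Finset ℤ) (y : ℕ → ℤ → A),
    μ (symmDiff {x | φ x 0 = b} (⋃ n, cylinder (s n) (y n))) = 0


namespace NF

section basics
variable {A : Type*}

/-- agreement on the window `[-m, m]`. -/
def Ag (m : ℕ) (x x' : ℤ → A) : Prop := ∀ i : ℤ, -(m : ℤ) ≤ i → i ≤ m → x' i = x i

noncomputable def win (m : ℕ) : Finset ℤ := Finset.Icc (-(m : ℤ)) m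

lemma mem_win {m : ℕ} {i : ℤ} : i ∈ win m ↔ -(m : ℤ) ≤ i ∧ i ≤ m := by
  simp [win]

lemma ag_iff {m : ℕ} {x x' : ℤ → A} : Ag m x x' ↔ x' ∈ _root_.cylinder (win m) x := by
  simp only [Ag, _root_.cylinder, mem_ofPred_eq, mem_win]
  exact ⟨fun h i hi => h i hi.1 hi.2, fun h i h1 h2 => h i ⟨h1, h2⟩⟩

lemma Ag.refl (m : ℕ) (x : ℤ → A) : Ag m x x := fun _ _ _ => rfl

lemma Ag.symm {m : ℕ} {x x' : ℤ → A} (h : Ag m x x') : Ag m x' x := fun i h1 h2 => (h i h1 h2).symm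

lemma Ag.mono {m m' : ℕ} (hm : m ≤ m') {x x' : ℤ → A} (h : Ag m' x x') : Ag m x x' :=
  fun i h1 h2 => h i (by omega) (by omega)

/-- `U` depends only on the coordinates in `[-m, m]`. -/
def Loc (m : ℕ) (U : Set (ℤ → A)) : Prop := ∀ x x', Ag m x x' → x ∈ U → x' ∈ U

lemma Loc.mono {m m' : ℕ} (hm : m ≤ m') {U : Set (ℤ → A)} (h : Loc m U) : Loc m' U :=
  fun x x' hx => h x x' (hx.mono hm)

lemma Loc.compl {m : ℕ} {U : Set (ℤ → A)} (h : Loc m U) : Loc m Uᶜ :=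
  fun x x' hx hU hx' => hU (h x' x hx.symm hx')

lemma Loc.union {m : ℕ} {U V : Set (ℤ → A)} (h : Loc m U) (h' : Loc m V) : Loc m (U ∪ V) :=
  fun x x' hx hU => hU.imp (h x x' hx) (h' x x' hx)

lemma Loc.inter {m : ℕ} {U V : Set (ℤ → A)} (h : Loc m U) (h' : Loc m V) : Loc m (U ∩ V) :=
  fun x x' hx hU => ⟨h x x' hx hU.1, h' x x' hx hU.2⟩

lemma Loc.preimage_restrict {m : ℕ} {U : Set (ℤ → A)} (h : Loc m U) :
    U = (win m).restrict ⁻¹' ((win m).restrict '' U) := by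
  apply Subset.antisymm (subset_preimage_image _ _)
  rintro x ⟨y, hy, hxy⟩
  refine h y x (fun i h1 h2 => ?_) hy
  have := congrFun hxy ⟨i, mem_win.2 ⟨h1, h2⟩⟩
  simpa using this.symm

lemma loc_cylinder (s : Finset ℤ) (y : ℤ → A) : ∃ m, Loc m (_root_.cylinder s y) := by
  refine ⟨s.sup Int.natAbs, fun x x' hx hxs i hi => ?_⟩
  have : i.natAbs ≤ s.sup Int.natAbs := Finset.le_sup (f := Int.natAbs) hi
  rw [hx i (by omega) (by omega)]
  exact hxs i hi

lemma isSetRing_loc : IsSetRing {U : Set (ℤ → A) | ∃ m, Loc m U} where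
  empty_mem := ⟨0, fun _ _ _ h => h⟩
  union_mem := by
    rintro s t ⟨m, hm⟩ ⟨m', hm'⟩
    exact ⟨max m m', (hm.mono (le_max_left _ _)).union (hm'.mono (le_max_right _ _))⟩
  sdiff_mem := by
    rintro s t ⟨m, hm⟩ ⟨m', hm'⟩
    exact ⟨max m m', (hm.mono (le_max_left _ _)).inter (hm'.mono (le_max_right _ _)).compl⟩

end basics

section meas
variable {A : Type*} [Fintype A] [MeasurableSpace A] [MeasurableSingletonClass A]

lemma Loc.measurableSet {m : ℕ} {U : Set (ℤ → A)} (h : Loc m U) : MeasurableSet U := by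
  rw [h.preimage_restrict]
  exact (Finset.measurable_restrict _) (MeasurableSet.of_discrete)

lemma measurable_cylinder (s : Finset ℤ) (y : ℤ → A) : MeasurableSet (_root_.cylinder s y) := by
  obtain ⟨m, hm⟩ := loc_cylinder s y
  exact hm.measurableSet

lemma generateFrom_loc :
    (inferInstance : MeasurableSpace (ℤ → A)) =
      MeasurableSpace.generateFrom {U : Set (ℤ → A) | ∃ m, Loc m U} := by
  apply le_antisymm
  · refine iSup_le fun i => ?_
    rintro _ ⟨s, hs, rfl⟩
    apply MeasurableSpace.measurableSet_generateFrom
    refine ⟨i.natAbs, fun x x' hx hxs => ?_⟩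
    have := hx i (by omega) (by omega)
    simp only [mem_preimage] at *
    rwa [this]
  · apply MeasurableSpace.generateFrom_le
    rintro U ⟨m, hm⟩
    exact hm.measurableSet

lemma ext_of_loc {μ ν : Measure (ℤ → A)} [IsFiniteMeasure μ]
    (h : ∀ m U, Loc m U → μ U = ν U) : μ = ν := by
  refine ext_of_generate_finite _ generateFrom_loc isSetRing_loc.isSetSemiring.isPiSystem ?_ ?_
  · rintro U ⟨m, hm⟩; exact h m U hm
  · exact h 0 univ (fun _ _ _ _ => trivial)

lemma loc_eq_of_cylinder [Nonempty A] {μ ν : Measure (ℤ → A)} {m : ℕ}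
    (h : ∀ y, μ (_root_.cylinder (win m) y) = ν (_root_.cylinder (win m) y)) {U} (hU : Loc m U) :
    μ U = ν U := by
  have : μ.map (win m).restrict = ν.map (win m).restrict := by
    apply Measure.ext_of_singleton
    intro w
    obtain ⟨y, rfl⟩ : ∃ y : ℤ → A, (win m).restrict y = w := by
      classical
      refine ⟨fun i => if hi : i ∈ win m then w ⟨i, hi⟩ else Classical.arbitrary A, ?_⟩
      ext i; simp
    rw [Measure.map_apply (Finset.measurable_restrict _) (measurableSet_singleton _),
      Measure.map_apply (Finset.measurable_restrict _) (measurableSet_singleton _)]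
    have e : (win m).restrict (π := fun _ => A) ⁻¹' {(win m).restrict y} = _root_.cylinder (win m) y := by
      ext x
      simp only [mem_preimage, mem_singleton_iff, _root_.cylinder, mem_ofPred_eq]
      constructor
      · intro hx i hi; simpa using congrFun hx ⟨i, hi⟩
      · intro hx; ext i; simpa using hx i.1 i.2
    rw [e]; exact h y
  rw [hU.preimage_restrict, ← Measure.map_apply (Finset.measurable_restrict _) MeasurableSet.of_discrete,
    ← Measure.map_apply (Finset.measurable_restrict _) MeasurableSet.of_discrete, this]

lemma ext_of_cylinder [Nonempty A] {μ ν : Measure (ℤ → A)} [IsFiniteMeasure μ] (m₀ : ℕ)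
    (h : ∀ m ≥ m₀, ∀ y, μ (_root_.cylinder (win m) y) = ν (_root_.cylinder (win m) y)) :
    μ = ν :=
  ext_of_loc fun m _ hU =>
    loc_eq_of_cylinder (h (max m m₀) (le_max_right _ _)) (hU.mono (le_max_left _ _))

lemma isProb_of_product {μ : Measure (ℤ → A)} {ρ : ℤ → A → ℝ} (h : IsProductMeasure μ ρ)
    [Nonempty A] : IsProbabilityMeasure μ := by
  constructor
  have := h ∅ (fun _ => Classical.arbitrary A)
  simpa [_root_.cylinder] using this

/-- the marginal measure. -/
noncomputable def marg (p : A → ℝ) : Measure A := ∑ a, ENNReal.ofReal (p a) • Measure.dirac a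

lemma marg_singleton (p : A → ℝ) (a : A) : marg p {a} = ENNReal.ofReal (p a) := by
  classical
  simp [marg, Measure.finsetSum_apply, Set.indicator_apply]

lemma marg_prob {p : A → ℝ} (hp : IsProbVec p) : IsProbabilityMeasure (marg p) := by
  constructor
  simp [marg, Measure.finsetSum_apply]
  rw [← ENNReal.ofReal_sum_of_nonneg (fun a _ => hp.1 a), hp.2, ENNReal.ofReal_one]

lemma infinitePi_isProduct {ρ : ℤ → A → ℝ} (hρ : ∀ i, IsProbVec (ρ i)) :
    IsProductMeasure (Measure.infinitePi (fun i => marg (ρ i))) ρ := by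
  haveI : ∀ i, IsProbabilityMeasure (marg (ρ i)) := fun i => marg_prob (hρ i)
  intro s y
  have : _root_.cylinder s y = Set.pi s (fun i => {y i}) := by
    ext x; simp [_root_.cylinder, Set.pi]
  rw [this, Measure.infinitePi_pi]
  · simp [marg_singleton]
  · intro i _; exact measurableSet_singleton _

lemma IsProbVec.nonempty {p : A → ℝ} (hp : IsProbVec p) : Nonempty A := by
  by_contra h
  have := hp.2
  rw [not_nonempty_iff] at h
  simp at this

lemma product_eq_infinitePi {μ : Measure (ℤ → A)} {ρ : ℤ → A → ℝ} (hρ : ∀ i, IsProbVec (ρ i))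
    (h : IsProductMeasure μ ρ) : μ = Measure.infinitePi (fun i => marg (ρ i)) := by
  haveI := IsProbVec.nonempty (hρ 0)
  haveI := isProb_of_product h
  haveI : ∀ i, IsProbabilityMeasure (marg (ρ i)) := fun i => marg_prob (hρ i)
  exact ext_of_cylinder 0 fun m _ y => by rw [h, infinitePi_isProduct hρ]

lemma loc_ne_top_approx {μ ν : Measure (ℤ → A)} [IsFiniteMeasure μ] [IsFiniteMeasure ν] {K : ENNReal}
    (hK : K ≠ ⊤)
    (h : ∀ (t : NNReal), 0 < t → ∀ m U, Loc m U → ν U ≤ t * μ U + K / t) : ν ≪ μ := by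
  refine Measure.AbsolutelyContinuous.mk fun s hs h0 => ?_
  have key : ∀ (t : NNReal), 0 < t → ν s ≤ K / t := by
    intro t ht
    apply ENNReal.le_of_forall_pos_le_add
    intro ε hε _
    have hε' : (0 : ENNReal) < ε / (1 + t) := by
      apply ENNReal.div_pos
      · exact_mod_cast hε.ne'
      · exact ENNReal.add_ne_top.2 ⟨by simp, by simp⟩
    obtain ⟨U, ⟨m, hU⟩, hlt⟩ := exists_measure_symmDiff_lt_of_generateFrom_isSetRing
      (μ := μ + ν) isSetRing_loc
      ⟨{univ}, by simp, by
        rintro _ rfl; exact ⟨0, fun _ _ _ _ => trivial⟩, by simp⟩ generateFrom_loc hs hε'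
    simp only [Measure.coe_add, Pi.add_apply] at hlt
    have h1 : ν s ≤ ν U + ν (symmDiff U s) := by
      refine (measure_mono ?_).trans (measure_union_le _ _)
      intro x hx
      by_cases hxU : x ∈ U
      · exact Or.inl hxU
      · exact Or.inr (Or.inr ⟨hx, hxU⟩)
    have h2 : μ U ≤ μ (symmDiff U s) := by
      calc μ U ≤ μ (s ∪ symmDiff U s) := measure_mono (by
            intro x hx
            by_cases hxs : x ∈ s
            · exact Or.inl hxs
            · exact Or.inr (Or.inl ⟨hx, hxs⟩))
        _ ≤ _ := (measure_union_le _ _).trans (by simp [h0])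
    calc ν s ≤ (t * μ U + K / t) + ν (symmDiff U s) := h1.trans (by gcongr; exact h t ht m U hU)
      _ ≤ (t * μ (symmDiff U s) + K / t) + ν (symmDiff U s) := by gcongr
      _ = K / t + (t * μ (symmDiff U s) + ν (symmDiff U s)) := by ring
      _ ≤ K / t + ((1 + t) * (μ (symmDiff U s) + ν (symmDiff U s))) := by
          gcongr
          rw [show (1 + (t : ENNReal)) * (μ (symmDiff U s) + ν (symmDiff U s)) =
            (t * μ (symmDiff U s) + ν (symmDiff U s)) +
              (μ (symmDiff U s) + t * ν (symmDiff U s)) by ring]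
          exact le_self_add
      _ ≤ K / t + ε := by
          gcongr
          calc _ ≤ (1 + (t : ENNReal)) * (ε / (1 + t)) := by gcongr
            _ = ε := ENNReal.mul_div_cancel (by simp) (ENNReal.add_ne_top.2 ⟨by simp, by simp⟩)
  by_contra hne
  have hpos : 0 < ν s := pos_iff_ne_zero.2 hne
  have hlim : Tendsto (fun n : ℕ => K / ((n + 1 : ℕ) : ENNReal)) atTop (𝓝 0) := by
    have := ENNReal.Tendsto.const_div (a := K) (ENNReal.tendsto_nat_nhds_top.comp (tendsto_add_atTop_nat 1)) (Or.inr hK)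
    simpa using this
  have : ν s ≤ 0 := ge_of_tendsto' hlim fun n => by
    have := key ((n + 1 : ℕ) : NNReal) (by positivity)
    simpa using this
  exact hne (le_antisymm this bot_le)

end meas
end NF


namespace NF

section kak
variable {A : Type*} [Fintype A] [MeasurableSpace A] [MeasurableSingletonClass A]

lemma measure_restrict {μ : Measure (ℤ → A)} {ρ : ℤ → A → ℝ} (hρ : ∀ i, IsProbVec (ρ i))
    (h : IsProductMeasure μ ρ) (I : Finset ℤ) (V : Set (I → A)) [DecidablePred (· ∈ V)] :
    μ (I.restrict ⁻¹' V) = ENNReal.ofReal (∑ w : I → A, if w ∈ V then ∏ i : I, ρ i (w i) else 0) := by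
  classical
  haveI := IsProbVec.nonempty (hρ 0)
  have e : I.restrict ⁻¹' V = ⋃ w ∈ (Finset.univ.filter (· ∈ V) : Finset (I → A)),
      _root_.cylinder I (fun i => if hi : i ∈ I then w ⟨i, hi⟩ else Classical.arbitrary A) := by
    ext x
    simp only [mem_preimage, Finset.mem_filter, Finset.mem_univ, true_and, mem_iUnion,
      _root_.cylinder, mem_ofPred_eq, exists_prop]
    constructor
    · intro hx
      exact ⟨_, hx, fun i hi => by simp [hi]⟩
    · rintro ⟨w, hw, hx⟩
      convert hw
      ext i
      simpa using hx i i.2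
  rw [e, measure_biUnion_finset]
  · rw [ENNReal.ofReal_sum_of_nonneg, Finset.sum_filter]
    · refine Finset.sum_congr rfl fun w _ => ?_
      split_ifs with hw
      · rw [h, ENNReal.ofReal_prod_of_nonneg (fun (i : I) _ => (hρ i.1).1 _), ← Finset.prod_attach]
        refine Finset.prod_congr rfl fun i _ => ?_
        simp
      · simp
    · intro w _
      split_ifs
      · exact Finset.prod_nonneg fun i _ => (hρ i).1 _
      · exact le_rfl
  · intro w _ w' _ hne
    rw [Function.onFun, Set.disjoint_left]
    intro x hx hx'
    apply hne
    ext i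
    have h1 := hx i i.2
    have h2 := hx' i i.2
    simp at h1 h2
    rw [← h1, ← h2]
  · intro w _
    exact measurable_cylinder _ _

lemma aff_bound {μ : Measure (ℤ → A)} {ρ ρ' : ℤ → A → ℝ} (hρ : ∀ i, IsProbVec (ρ i))
    (hρ' : ∀ i, IsProbVec (ρ' i)) (h : IsProductMeasure μ ρ) (I : Finset ℤ) :
    μ (I.restrict ⁻¹' {w : I → A | ∏ i : I, ρ i (w i) ≤ ∏ i : I, ρ' i (w i)}) ≤
      ENNReal.ofReal (∏ i ∈ I, ∑ a, Real.sqrt (ρ i a * ρ' i a)) := by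
  classical
  rw [measure_restrict hρ h]
  apply ENNReal.ofReal_le_ofReal
  rw [← Finset.prod_attach, ← Finset.univ_eq_attach, Finset.prod_univ_sum]
  simp only [Fintype.piFinset_univ]
  refine Finset.sum_le_sum fun w _ => ?_
  have h0 : 0 ≤ ∏ i : I, ρ i (w i) := Finset.prod_nonneg fun i _ => (hρ i).1 _
  split_ifs with hw
  · simp only [mem_ofPred_eq] at hw
    rw [← Real.sqrt_prod _ (fun (i : I) _ => mul_nonneg ((hρ i.1).1 _) ((hρ' i.1).1 _)), Finset.prod_mul_distrib]
    apply Real.le_sqrt_of_sq_le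
    rw [sq]
    gcongr
  · exact Finset.prod_nonneg fun i _ => Real.sqrt_nonneg _

lemma aff_le {p q : A → ℝ} (hp : IsProbVec p) (hq : IsProbVec q) :
    ∑ a, Real.sqrt (p a * q a) ≤ Real.exp (-(∑ a, (p a - q a)^2) / 8) := by
  have hle1 : ∀ {p : A → ℝ}, IsProbVec p → ∀ a, p a ≤ 1 := fun {p} hp a => by
    rw [← hp.2]; exact Finset.single_le_sum (fun a _ => hp.1 a) (Finset.mem_univ a)
  have key : ∀ a, Real.sqrt (p a * q a) ≤ (p a + q a) / 2 - (p a - q a)^2 / 8 := by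
    intro a
    rw [Real.sqrt_mul (hp.1 a)]
    have h1 := Real.sq_sqrt (hp.1 a)
    have h2 := Real.sq_sqrt (hq.1 a)
    have h3 : Real.sqrt (p a) ≤ 1 := Real.sqrt_le_one.2 (hle1 hp a)
    have h4 : Real.sqrt (q a) ≤ 1 := Real.sqrt_le_one.2 (hle1 hq a)
    have h5 := Real.sqrt_nonneg (p a)
    have h6 := Real.sqrt_nonneg (q a)
    set u := Real.sqrt (p a)
    set v := Real.sqrt (q a)
    rw [← h1, ← h2]
    have h7 : (u + v)^2 ≤ 4 := by nlinarith
    have h8 : (u^2 - v^2)^2 = (u - v)^2 * (u+v)^2 := by ring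
    rw [h8]
    nlinarith [mul_le_mul_of_nonneg_left h7 (sq_nonneg (u - v))]
  calc _ ≤ ∑ a, ((p a + q a) / 2 - (p a - q a)^2 / 8) := Finset.sum_le_sum fun a _ => key a
    _ = 1 - (∑ a, (p a - q a)^2) / 8 := by
        rw [Finset.sum_sub_distrib, ← Finset.sum_div, ← Finset.sum_div, Finset.sum_add_distrib, hp.2, hq.2]
        norm_num
    _ ≤ _ := by
        have := Real.add_one_le_exp (-(∑ a, (p a - q a)^2) / 8)
        linarith

lemma kakutani {P Q : Measure (ℤ → A)} {ρ ρ' : ℤ → A → ℝ} (hρ : ∀ i, IsProbVec (ρ i))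
    (hρ' : ∀ i, IsProbVec (ρ' i)) (hQ : IsProductMeasure Q ρ) (hP : IsProductMeasure P ρ')
    (hPQ : P ≪ Q) : Summable (fun i : ℤ => ∑ a, (ρ i a - ρ' i a)^2) := by
  classical
  haveI := IsProbVec.nonempty (hρ 0)
  haveI := isProb_of_product hP
  by_contra hns
  set g : ℤ → ℝ := fun i => ∑ a, (ρ i a - ρ' i a)^2 with hg
  have hg0 : ∀ i, 0 ≤ g i := fun i => Finset.sum_nonneg fun a _ => sq_nonneg _
  have hbig : ∀ k : ℕ, ∃ I : Finset ℤ, 8 * (k : ℝ) < ∑ i ∈ I, g i := by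
    intro k
    by_contra hcon
    push Not at hcon
    exact hns (summable_of_sum_le hg0 hcon)
  choose I hI using hbig
  have haff : ∀ k, ∏ i ∈ I k, ∑ a, Real.sqrt (ρ i a * ρ' i a) ≤ Real.exp (-1) ^ k := by
    intro k
    calc _ ≤ ∏ i ∈ I k, Real.exp (- g i / 8) :=
          Finset.prod_le_prod (fun i _ => Finset.sum_nonneg fun a _ => Real.sqrt_nonneg _)
            (fun i _ => aff_le (hρ i) (hρ' i))
      _ = Real.exp (∑ i ∈ I k, - g i / 8) := (Real.exp_sum _ _).symm
      _ ≤ Real.exp (-k) := by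
          apply Real.exp_le_exp.2
          rw [← Finset.sum_div, Finset.sum_neg_distrib]
          linarith [hI k]
      _ = _ := by rw [← Real.exp_nat_mul]; congr 1; ring
  let E : ℕ → Set (ℤ → A) := fun k =>
    (I k).restrict ⁻¹' {w : I k → A | ∏ i : I k, ρ i (w i) ≤ ∏ i : I k, ρ' i (w i)}
  let F : ℕ → Set (ℤ → A) := fun k =>
    (I k).restrict ⁻¹' {w : I k → A | ∏ i : I k, ρ' i (w i) ≤ ∏ i : I k, ρ i (w i)}
  have hsum : ∑' k : ℕ, ENNReal.ofReal (Real.exp (-1) ^ k) ≠ ⊤ := by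
    rw [← ENNReal.ofReal_tsum_of_nonneg (fun k => by positivity)]
    · exact ENNReal.ofReal_ne_top
    · exact summable_geometric_of_lt_one (by positivity) (by
        rw [Real.exp_lt_one_iff]; norm_num)
  have hE : ∀ k, Q (E k) ≤ ENNReal.ofReal (Real.exp (-1) ^ k) := fun k =>
    (aff_bound hρ hρ' hQ (I k)).trans (ENNReal.ofReal_le_ofReal (haff k))
  have hF : ∀ k, P (F k) ≤ ENNReal.ofReal (Real.exp (-1) ^ k) := fun k =>
    (aff_bound hρ' hρ hP (I k)).trans (ENNReal.ofReal_le_ofReal (by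
      simpa only [mul_comm] using haff k))
  have h1 : Q (limsup E atTop) = 0 :=
    measure_limsup_atTop_eq_zero (ne_top_of_le_ne_top hsum (ENNReal.tsum_le_tsum hE))
  have h2 : P (limsup F atTop) = 0 :=
    measure_limsup_atTop_eq_zero (ne_top_of_le_ne_top hsum (ENNReal.tsum_le_tsum hF))
  have h3 := hPQ h1
  have h4 : (univ : Set (ℤ → A)) ⊆ limsup E atTop ∪ limsup F atTop := by
    intro x _
    simp only [mem_union, mem_limsup_iff_frequently_mem]
    rw [← Filter.frequently_or_distrib]
    apply Filter.Eventually.frequently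
    filter_upwards with k
    exact le_total (∏ i : I k, ρ i (x i)) (∏ i : I k, ρ' i (x i))
  have h5 : P univ ≤ 0 := (measure_mono h4).trans ((measure_union_le _ _).trans (by simp [h3, h2]))
  simp at h5

lemma measurable_shift : Measurable (shift : (ℤ → A) → (ℤ → A)) :=
  measurable_pi_lambda _ fun i => measurable_pi_apply (i + 1)

lemma map_shift_product {μ : Measure (ℤ → A)} {ρ : ℤ → A → ℝ} (h : IsProductMeasure μ ρ) :
    IsProductMeasure (μ.map shift) (fun i => ρ (i + 1)) := by
  classical
  intro s y
  rw [Measure.map_apply measurable_shift (measurable_cylinder _ _)]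
  have : shift ⁻¹' (_root_.cylinder s y) =
      _root_.cylinder (s.map (addRightEmbedding (1 : ℤ))) (fun i => y (i - 1)) := by
    ext x
    simp [_root_.cylinder, shift]
  rw [this, h, Finset.prod_map]
  simp

lemma summable_diff {μ : Measure (ℤ → A)} {ρ : ℤ → A → ℝ} (hρ : ∀ i, IsProbVec (ρ i))
    (h : IsProductMeasure μ ρ) (hns : MeasEquiv (μ.map shift) μ) :
    Summable (fun i : ℤ => ∑ a, (ρ i a - ρ (i + 1) a)^2) :=
  kakutani hρ (fun i => hρ (i + 1)) h (map_shift_product h) hns.1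

end kak
end NF


namespace NF

section blocks

/-- `s` is the start of a complete block of length `n` (after the last marker). -/
def BS (Z : Set ℤ) (n : ℕ) (s : ℤ) : Prop :=
  ∃ k : ℕ, s - k * n ∈ Z ∧ ∀ u, s - k * n < u → u < s + n → u ∉ Z

lemma BS.disj {Z : Set ℤ} {n : ℕ} {s s' : ℤ} (h : BS Z n s) (h' : BS Z n s') (hlt : s < s') :
    s + n ≤ s' := by
  obtain ⟨k, hk, hk2⟩ := h
  obtain ⟨k', hk', hk2'⟩ := h'
  rcases lt_trichotomy (s - k * n) (s' - k' * n) with h1 | h1 | h1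
  · by_contra hcon
    have h0 : (0 : ℤ) ≤ k' * n := by positivity
    exact hk2 _ h1 (by omega) hk'
  · have h2 : s' - s = (k' - k : ℤ) * n := by linarith
    have h3 : 0 < ((k' : ℤ) - k) * n := by linarith
    have h4 : 0 < ((k' : ℤ) - k) := by
      by_contra hcon
      have : ((k' : ℤ) - k) * n ≤ 0 := mul_nonpos_of_nonpos_of_nonneg (by omega) (by positivity)
      omega
    have : (1 : ℤ) * n ≤ ((k' : ℤ) - k) * n := mul_le_mul_of_nonneg_right (by omega) (by positivity)
    linarith
  · exfalso
    have h0 : (0 : ℤ) ≤ k * n := by positivity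
    exact hk2' _ h1 (by omega) hk

lemma BS.eq_of {Z : Set ℤ} {n : ℕ} {s s' i : ℤ} (h : BS Z n s) (h' : BS Z n s')
    (h1 : s ≤ i) (h2 : i < s + n) (h3 : s' ≤ i) (h4 : i < s' + n) : s = s' := by
  rcases lt_trichotomy s s' with hl | hl | hl
  · have := h.disj h' hl; omega
  · exact hl
  · have := h'.disj h hl; omega

lemma BS.localize {Z Z' : Set ℤ} {n : ℕ} {z s Y : ℤ} (hz : z ∈ Z)
    (hZ : ∀ u, z ≤ u → u ≤ Y → (u ∈ Z' ↔ u ∈ Z)) (h1 : z ≤ s) (hY : s + n ≤ Y)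
    (h : BS Z n s) : BS Z' n s := by
  obtain ⟨k, hk, hk2⟩ := h
  have h0 : (0 : ℤ) ≤ k * n := by positivity
  by_cases h5 : n = 0
  · subst h5
    simp only [Nat.cast_zero, mul_zero, sub_zero, add_zero] at *
    exact ⟨0, by simpa using (hZ s h1 hY).2 hk, fun u h3 h4 => by simp at *; omega⟩
  have h3 : z ≤ s - k * n := by
    by_contra hcon
    exact hk2 z (by omega) (by omega) hz
  refine ⟨k, (hZ _ h3 (by omega)).2 hk, fun u hu1 hu2 hu => ?_⟩
  exact hk2 u hu1 hu2 ((hZ u (by omega) (by omega)).1 hu)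

lemma exists_BS {Z : Set ℤ} {n : ℕ} (hn : 0 < n) {z i : ℤ} (hz : z ∈ Z) (hzi : z ≤ i)
    (hu : ∀ u, i < u → u < i + n → u ∉ Z) : ∃ t < n, BS Z n (i - (t : ℕ)) := by
  classical
  -- the last marker
  obtain ⟨z1, ⟨h1, h2⟩, h3⟩ := Int.exists_greatest_of_bdd (P := fun z => z ∈ Z ∧ z ≤ i)
    ⟨i, fun z h => h.2⟩ ⟨z, hz, hzi⟩
  obtain ⟨d, hd⟩ : ∃ d : ℕ, i = z1 + d := ⟨(i - z1).toNat, by omega⟩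
  have h4 := Nat.mod_add_div d n
  have h5 := Nat.mod_lt d hn
  refine ⟨d % n, h5, d / n, ?_, ?_⟩
  · have : (i - (d % n : ℕ) - (d / n : ℕ) * n : ℤ) = z1 := by
      rw [hd]
      have : (d : ℤ) = (d % n : ℕ) + n * (d / n : ℕ) := by exact_mod_cast h4.symm
      linarith
    rw [this]; exact h1
  · intro u hu1 hu2 huZ
    have e : (i - (d % n : ℕ) - (d / n : ℕ) * n : ℤ) = z1 := by
      rw [hd]
      have : (d : ℤ) = (d % n : ℕ) + n * (d / n : ℕ) := by exact_mod_cast h4.symm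
      linarith
    rw [e] at hu1
    by_cases hui : u ≤ i
    · have := h3 u ⟨huZ, hui⟩; omega
    · exact hu u (by omega) (by omega) huZ

/-- start of the `N`-block containing `i` (or `i` itself). -/
noncomputable def st (Z : Set ℤ) (N : ℕ) (i : ℤ) : ℤ :=
  i - (sInf {t : ℕ | t < N ∧ BS Z N (i - t)} : ℕ)

lemma st_spec (Z : Set ℤ) {N : ℕ} (hN : 0 < N) (i : ℤ) :
    ∃ t : ℕ, t < N ∧ st Z N i = i - t ∧
      ((∃ t < N, BS Z N (i - (t : ℕ))) → BS Z N (i - t)) ∧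
      ((¬ ∃ t < N, BS Z N (i - (t : ℕ))) → t = 0) := by
  by_cases h : ∃ t < N, BS Z N (i - (t : ℕ))
  · have := Nat.sInf_mem (s := {t : ℕ | t < N ∧ BS Z N (i - t)}) h
    exact ⟨_, this.1, rfl, fun _ => this.2, fun h' => absurd h h'⟩
  · refine ⟨0, hN, ?_, fun h' => absurd h' h, fun _ => rfl⟩
    have : {t : ℕ | t < N ∧ BS Z N (i - t)} = ∅ := by
      ext t; simp only [mem_ofPred_eq, mem_empty_iff_false, iff_false]
      exact fun h' => h ⟨t, h'⟩
    simp [st, this]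

lemma st_st (Z : Set ℤ) {N : ℕ} (hN : 0 < N) (i : ℤ) : st Z N (st Z N i) = st Z N i := by
  obtain ⟨t, ht, h1, h2, h3⟩ := st_spec Z hN i
  by_cases h : ∃ t < N, BS Z N (i - (t : ℕ))
  · have hb := h2 h
    rw [h1]
    have : (sInf {u : ℕ | u < N ∧ BS Z N (i - t - u)} : ℕ) = 0 := by
      apply Nat.sInf_eq_zero.2
      left
      exact ⟨hN, by simpa using hb⟩
    simp [st, this]
  · have := h3 h
    subst this
    simp at h1
    rw [h1, h1]

lemma st_congr {Z Z' : Set ℤ} {N : ℕ} {i : ℤ}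
    (h : ∀ t : ℕ, t < N → (BS Z' N (i - t) ↔ BS Z N (i - t))) : st Z' N i = st Z N i := by
  have : {t : ℕ | t < N ∧ BS Z' N (i - t)} = {t : ℕ | t < N ∧ BS Z N (i - t)} := by
    ext t
    simp only [mem_ofPred_eq]
    exact and_congr_right (h t)
  simp [st, this]

/-- shift of a set of integers -/
def sh (Z : Set ℤ) : Set ℤ := {i | i + 1 ∈ Z}

lemma BS_sh (Z : Set ℤ) (n : ℕ) (s : ℤ) : BS (sh Z) n s ↔ BS Z n (s + 1) := by
  unfold BS sh
  apply exists_congr; intro k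
  simp only [mem_ofPred_eq]
  rw [show s - k * n + 1 = s + 1 - k * n by ring]
  apply and_congr_right; intro _
  constructor
  · intro h u h1 h2
    have := h (u - 1) (by omega) (by omega)
    simpa using this
  · intro h u h1 h2
    exact h (u + 1) (by omega) (by omega)

lemma st_sh (Z : Set ℤ) (N : ℕ) (i : ℤ) : st (sh Z) N i = st Z N (i + 1) - 1 := by
  have : {t : ℕ | t < N ∧ BS (sh Z) N (i - t)} = {t : ℕ | t < N ∧ BS Z N (i + 1 - t)} := by
    ext t
    simp only [mem_ofPred_eq, BS_sh]
    rw [show i - (t : ℤ) + 1 = i + 1 - t by ring]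
  simp only [st, this]
  ring

/-- demand sites -/
def Dm (Z : Set ℤ) (N : ℕ) : Set ℤ := {i | st Z N i = i}

lemma Dm_sh (Z : Set ℤ) (N : ℕ) : Dm (sh Z) N = sh (Dm Z N) := by
  ext i
  simp only [Dm, sh, mem_ofPred_eq]
  have := st_sh Z N i
  unfold sh at this
  rw [this]
  constructor <;> intro h <;> omega

end blocks

section matching
open Classical in
/-- the height function -/
noncomputable def hh (J : ℕ) (D S : Set ℤ) (i : ℤ) (j : ℕ) : ℤ :=
  ∑ u ∈ Finset.range (j + 1), ((if i + u ∈ D then (J : ℤ) else 0) - (if i + u ∈ S then 1 else 0))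

/-- existence of a match -/
def Mex (J : ℕ) (D S : Set ℤ) (i : ℤ) : Prop := ∃ j, hh J D S i j ≤ 0

noncomputable def mt (J : ℕ) (D S : Set ℤ) (i : ℤ) (t : ℕ) : ℤ :=
  i + (sInf {j : ℕ | hh J D S i j ≤ (J : ℤ) - 1 - t} : ℕ)

lemma hh_succ (J : ℕ) (D S : Set ℤ) (i : ℤ) (j : ℕ) [DecidablePred (· ∈ D)] [DecidablePred (· ∈ S)] :
    hh J D S i (j + 1) = hh J D S i j +
      ((if i + (j + 1 : ℕ) ∈ D then (J : ℤ) else 0) - (if i + (j + 1 : ℕ) ∈ S then 1 else 0)) := by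
  unfold hh
  rw [Finset.sum_range_succ]
  congr!

lemma hh_zero (J : ℕ) (D S : Set ℤ) (i : ℤ) [DecidablePred (· ∈ D)] [DecidablePred (· ∈ S)] :
    hh J D S i 0 = ((if i ∈ D then (J : ℤ) else 0) - (if i ∈ S then 1 else 0)) := by
  unfold hh
  rw [zero_add, Finset.sum_range_one]
  simp only [Nat.cast_zero, add_zero]

lemma hh_add (J : ℕ) (D S : Set ℤ) (i : ℤ) (k j : ℕ) :
    hh J D S i (k + 1 + j) = hh J D S i k + hh J D S (i + (k + 1 : ℕ)) j := by
  classical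
  induction j with
  | zero =>
    rw [add_zero, hh_succ, hh_zero]
  | succ j ih =>
    rw [← add_assoc, hh_succ, ih, hh_succ]
    have : i + ((k + 1 + j + 1 : ℕ) : ℤ) = i + ((k + 1 : ℕ) : ℤ) + ((j + 1 : ℕ) : ℤ) := by
      push_cast; ring
    rw [this]; ring

lemma mt_spec {J : ℕ} {D S : Set ℤ} {i : ℤ} (hi : i ∈ D) (hex : Mex J D S i) {t : ℕ} (ht : t < J) :
    ∃ j : ℕ, mt J D S i t = i + j ∧ hh J D S i j = (J : ℤ) - 1 - t ∧ i + j ∈ S ∧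
      ∀ k < j, (J : ℤ) - 1 - t < hh J D S i k := by
  classical
  have hne : {j : ℕ | hh J D S i j ≤ (J : ℤ) - 1 - t}.Nonempty := by
    obtain ⟨j, hj⟩ := hex
    exact ⟨j, by simp only [mem_ofPred_eq]; omega⟩
  have h1 := Nat.sInf_mem hne
  have h2 : ∀ k < sInf {j : ℕ | hh J D S i j ≤ (J : ℤ) - 1 - t}, (J : ℤ) - 1 - t < hh J D S i k := by
    intro k hk
    have := Nat.notMem_of_lt_sInf hk
    simpa using this
  set j := sInf {j : ℕ | hh J D S i j ≤ (J : ℤ) - 1 - t} with hj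
  refine ⟨j, rfl, ?_⟩
  simp only [mem_ofPred_eq] at h1
  rcases Nat.eq_zero_or_pos j with h0 | hpos
  · have : hh J D S i j = J - (if i + (j : ℕ) ∈ S then 1 else 0) := by
      rw [h0, hh_zero]; simp [hi]
    rw [this] at h1 ⊢
    split_ifs at h1 ⊢ with hS
    · exact ⟨by omega, hS, h2⟩
    · omega
  · obtain ⟨k, hk⟩ : ∃ k, j = k + 1 := ⟨j - 1, by omega⟩
    have h3 := h2 k (by omega)
    have h4 := hh_succ J D S i k
    rw [← hk] at h4
    rw [h4] at h1 ⊢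
    split_ifs at h1 ⊢ with hD hS hS
    · omega
    · omega
    · exact ⟨by omega, hS, h2⟩
    · omega

lemma mt_inj {J : ℕ} {D S : Set ℤ} {i i' : ℤ} (hi : i ∈ D) (hi' : i' ∈ D)
    (hex : Mex J D S i) (hex' : Mex J D S i') {t t' : ℕ} (ht : t < J) (ht' : t' < J)
    (h : mt J D S i t = mt J D S i' t') : i = i' ∧ t = t' := by
  have key : ∀ {i i' : ℤ} (hi : i ∈ D) (hi' : i' ∈ D)
    (hex : Mex J D S i) (hex' : Mex J D S i') {t t' : ℕ} (ht : t < J) (ht' : t' < J)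
    (h : mt J D S i t = mt J D S i' t'), ¬ i < i' := by
    intro i i' hi hi' hex hex' t t' ht ht' h hlt
    obtain ⟨j, h1, h2, h3, h4⟩ := mt_spec hi hex ht
    obtain ⟨j', h1', h2', h3', h4'⟩ := mt_spec hi' hex' ht'
    rw [h1, h1'] at h
    obtain ⟨k, hk⟩ : ∃ k : ℕ, i' = i + (k + 1 : ℕ) := ⟨(i' - i - 1).toNat, by omega⟩
    have hj : j = k + 1 + j' := by omega
    have := hh_add J D S i k j'
    rw [← hj, ← hk, h2, h2'] at this
    have := h4 k (by omega)
    omega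
  rcases lt_trichotomy i i' with hl | hl | hl
  · exact absurd hl (key hi hi' hex hex' ht ht' h)
  · subst hl
    refine ⟨rfl, ?_⟩
    obtain ⟨j, h1, h2, h3, h4⟩ := mt_spec hi hex ht
    obtain ⟨j', h1', h2', h3', h4'⟩ := mt_spec hi hex ht'
    have : j = j' := by omega
    subst this
    omega
  · exact absurd hl (key hi' hi hex' hex ht' ht h.symm)

lemma hh_congr {J : ℕ} {D S D' S' : Set ℤ} {i : ℤ} {j : ℕ}
    (hD : ∀ u ≤ j, (i + (u : ℕ) ∈ D' ↔ i + (u : ℕ) ∈ D))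
    (hS : ∀ u ≤ j, (i + (u : ℕ) ∈ S' ↔ i + (u : ℕ) ∈ S)) :
    hh J D' S' i j = hh J D S i j := by
  classical
  unfold hh
  refine Finset.sum_congr rfl fun u hu => ?_
  have hu' : u ≤ j := by simpa [Nat.lt_succ_iff] using hu
  simp only [hD u hu', hS u hu']

lemma mt_congr {J : ℕ} {D S D' S' : Set ℤ} {i : ℤ} {j : ℕ} (hj : hh J D S i j ≤ 0)
    (hD : ∀ u ≤ j, (i + (u : ℕ) ∈ D' ↔ i + (u : ℕ) ∈ D))
    (hS : ∀ u ≤ j, (i + (u : ℕ) ∈ S' ↔ i + (u : ℕ) ∈ S)) {t : ℕ} (ht : t < J) :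
    mt J D' S' i t = mt J D S i t := by
  have h1 : ∀ u ≤ j, hh J D' S' i u = hh J D S i u := fun u hu =>
    hh_congr (fun v hv => hD v (by omega)) (fun v hv => hS v (by omega))
  unfold mt
  congr 2
  have hm : j ∈ {j : ℕ | hh J D S i j ≤ (J : ℤ) - 1 - t} := by simp only [mem_ofPred_eq]; omega
  have hm' : j ∈ {j : ℕ | hh J D' S' i j ≤ (J : ℤ) - 1 - t} := by
    simp only [mem_ofPred_eq]; rw [h1 j le_rfl]; omega
  have e1 := Nat.sInf_mem ⟨j, hm⟩
  have e2 := Nat.sInf_mem ⟨j, hm'⟩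
  have l1 := Nat.sInf_le hm
  have l2 := Nat.sInf_le hm'
  apply le_antisymm
  · apply Nat.sInf_le
    simp only [mem_ofPred_eq] at e1 ⊢
    rw [h1 _ l1]; exact e1
  · apply Nat.sInf_le
    simp only [mem_ofPred_eq] at e2 ⊢
    rw [← h1 _ l2]; exact e2

lemma hh_sh (J : ℕ) (D S : Set ℤ) (i : ℤ) (j : ℕ) :
    hh J (sh D) (sh S) i j = hh J D S (i + 1) j := by
  classical
  unfold hh sh
  refine Finset.sum_congr rfl fun u hu => ?_
  have e : i + (u : ℤ) + 1 = i + 1 + u := by ring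
  simp only [mem_ofPred_eq, e]

lemma mt_sh (J : ℕ) (D S : Set ℤ) (i : ℤ) (t : ℕ) :
    mt J (sh D) (sh S) i t = mt J D S (i + 1) t - 1 := by
  unfold mt
  simp only [hh_sh]
  ring

end matching

section out
variable {C1 C2 B : Type*} {N J : ℕ}

/-- bad sites -/
def Bd (S : Set ℤ) (good : C1 → Prop) (σ : ℤ → C1 × C2) : Set ℤ := {s | s ∈ S ∧ ¬ good (σ s).1}

/-- the output -/
noncomputable def out (hN : 0 < N) (good : C1 → Prop) (G : C1 → (Fin J → C2) → (Fin N → B))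
    (Z S : Set ℤ) (σ : ℤ → C1 × C2) (i : ℤ) : B :=
  G (σ (mt 1 (Dm Z N) S (st Z N i) 0)).1
    (fun t => (σ (mt J (Bd S good σ) S (mt 1 (Dm Z N) S (st Z N i) 0) t)).2)
    ⟨(i - st Z N i).toNat % N, Nat.mod_lt _ hN⟩

lemma out_sh (hN : 0 < N) (good : C1 → Prop) (G : C1 → (Fin J → C2) → (Fin N → B))
    (Z S : Set ℤ) (σ : ℤ → C1 × C2) (i : ℤ) :
    out hN good G (sh Z) (sh S) (fun s => σ (s + 1)) i = out hN good G Z S σ (i + 1) := by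
  unfold out
  have hB : Bd (sh S) good (fun s => σ (s + 1)) = sh (Bd S good σ) := rfl
  have e1 : mt 1 (Dm (sh Z) N) (sh S) (st (sh Z) N i) 0 =
      mt 1 (Dm Z N) S (st Z N (i+1)) 0 - 1 := by
    rw [Dm_sh, mt_sh, st_sh, sub_add_cancel]
  rw [hB, e1]
  simp only [mt_sh, sub_add_cancel]
  congr 3
  rw [st_sh]; congr 1; ring

end out

end NF


namespace NF

section counting

open Classical in
/-- indicator of a set of integers -/
noncomputable def ii (D : Set ℤ) (k : ℤ) : ℝ := if k ∈ D then 1 else 0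

lemma ii_nonneg (D : Set ℤ) (k : ℤ) : 0 ≤ ii D k := by unfold ii; split_ifs <;> norm_num
lemma ii_le_one (D : Set ℤ) (k : ℤ) : ii D k ≤ 1 := by unfold ii; split_ifs <;> norm_num
lemma ii_of_mem {D : Set ℤ} {k : ℤ} (h : k ∈ D) : ii D k = 1 := by simp [ii, h]
lemma ii_of_notMem {D : Set ℤ} {k : ℤ} (h : k ∉ D) : ii D k = 0 := by simp [ii, h]

lemma hh_cast (J : ℕ) (D S : Set ℤ) (i : ℤ) (j : ℕ) :
    (hh J D S i j : ℝ) = J * ∑ u ∈ Finset.range (j + 1), ii D (i + u) -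
      ∑ u ∈ Finset.range (j + 1), ii S (i + u) := by
  classical
  unfold hh
  push_cast
  rw [Finset.sum_sub_distrib, Finset.mul_sum]
  congr 1
  · refine Finset.sum_congr rfl fun u _ => ?_
    unfold ii; split_ifs <;> simp

/-- markers close to the right -/
noncomputable def near (Z : Set ℤ) (N : ℕ) (k : ℤ) : ℝ := ∑ u ∈ Finset.range N, ii Z (k + 1 + u)

lemma near_nonneg (Z : Set ℤ) (N : ℕ) (k : ℤ) : 0 ≤ near Z N k :=
  Finset.sum_nonneg fun _ _ => ii_nonneg _ _

lemma near_ge {Z : Set ℤ} {N : ℕ} {k u : ℤ} (h1 : k < u) (h2 : u < k + N) (hu : u ∈ Z) :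
    1 ≤ near Z N k := by
  obtain ⟨v, hv⟩ : ∃ v : ℕ, u = k + 1 + v := ⟨(u - k - 1).toNat, by omega⟩
  calc (1 : ℝ) = ii Z (k + 1 + v) := by rw [← hv, ii_of_mem hu]
    _ ≤ _ := Finset.single_le_sum (f := fun v : ℕ => ii Z (k + 1 + v)) (fun _ _ => ii_nonneg _ _)
      (Finset.mem_range.2 (by omega))

lemma near_mono {Z : Set ℤ} {n N : ℕ} (h : n ≤ N) (k : ℤ) : near Z n k ≤ near Z N k :=
  Finset.sum_le_sum_of_subset_of_nonneg (Finset.range_mono h) fun _ _ _ => ii_nonneg _ _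

lemma covered {Z : Set ℤ} {n : ℕ} (hn : 0 < n) {z i : ℤ} (hz : z ∈ Z) (hzi : z ≤ i) :
    1 ≤ near Z n i + ∑ t ∈ Finset.range n, ii {s | BS Z n s} (i - t) := by
  by_cases hu : ∀ u, i < u → u < i + n → u ∉ Z
  · obtain ⟨t, ht, hb⟩ := exists_BS hn hz hzi hu
    have : (1 : ℝ) ≤ ∑ t ∈ Finset.range n, ii {s | BS Z n s} (i - t) := by
      calc (1 : ℝ) = ii {s | BS Z n s} (i - t) := (ii_of_mem hb).symm
        _ ≤ _ := Finset.single_le_sum (f := fun v : ℕ => ii {s | BS Z n s} (i - v))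
          (fun _ _ => ii_nonneg _ _) (Finset.mem_range.2 ht)
    linarith [near_nonneg Z n i]
  · push Not at hu
    obtain ⟨u, h1, h2, h3⟩ := hu
    have := near_ge h1 h2 h3
    have h0 : 0 ≤ ∑ t ∈ Finset.range n, ii {s | BS Z n s} (i - t) :=
      Finset.sum_nonneg fun _ _ => ii_nonneg _ _
    linarith

lemma sum_shift_le (D : Set ℤ) (i : ℤ) (L t : ℕ) :
    ∑ u ∈ Finset.range L, ii D (i + u - t) ≤ ∑ u ∈ Finset.range L, ii D (i + u) + t := by
  induction t with
  | zero => simp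
  | succ t ih =>
    have : ∑ u ∈ Finset.range L, ii D (i + u - (t + 1 : ℕ)) ≤
        ∑ u ∈ Finset.range L, ii D (i + u - t) + 1 := by
      have e1 : ∀ u : ℕ, ii D (i + u - (t + 1 : ℕ)) = (fun u : ℕ => ii D (i + u - (t + 1 : ℕ))) u :=
        fun _ => rfl
      have h2 := Finset.sum_range_succ' (fun u : ℕ => ii D (i + u - (t + 1 : ℕ))) L
      have h3 := Finset.sum_range_succ (fun u : ℕ => ii D (i + u - (t + 1 : ℕ))) L
      have h4 : ∀ u : ℕ, ii D (i + ((u + 1 : ℕ) : ℤ) - (t + 1 : ℕ)) = ii D (i + u - t) := by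
        intro u; congr 1; push_cast; ring
      simp only [h4] at h2
      have h5 := ii_le_one D (i + ((0 : ℕ) : ℤ) - (t + 1 : ℕ))
      have h6 := ii_nonneg D (i + (L : ℤ) - (t + 1 : ℕ))
      linarith
    push_cast at this ih ⊢
    linarith

lemma count_BS_ge {Z : Set ℤ} {n : ℕ} (hn : 0 < n) {z i : ℤ} (hz : z ∈ Z) (hzi : z ≤ i) (L : ℕ) :
    (L : ℝ) ≤ ∑ u ∈ Finset.range L, near Z n (i + u) +
      n * (∑ u ∈ Finset.range L, ii {s | BS Z n s} (i + u) + n) := by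
  have h1 : ∑ u ∈ Finset.range L, (1 : ℝ) ≤ ∑ u ∈ Finset.range L, (near Z n (i + u) +
      ∑ t ∈ Finset.range n, ii {s | BS Z n s} (i + u - t)) :=
    Finset.sum_le_sum fun u _ => covered hn hz (by omega)
  rw [Finset.sum_add_distrib, Finset.sum_comm (s := Finset.range L) (t := Finset.range n)] at h1
  have h2 : ∑ t ∈ Finset.range n, ∑ u ∈ Finset.range L, ii {s | BS Z n s} (i + u - t) ≤
      ∑ t ∈ Finset.range n, (∑ u ∈ Finset.range L, ii {s | BS Z n s} (i + u) + n) := by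
    refine Finset.sum_le_sum fun t ht => (sum_shift_le _ i L t).trans ?_
    have : (t : ℝ) ≤ n := by exact_mod_cast (Finset.mem_range.1 ht).le
    linarith
  simp at h1 h2
  linarith

lemma one_block {Z : Set ℤ} {N : ℕ} (k : ℤ) :
    ∑ t ∈ Finset.range N, ii {s | BS Z N s} (k - t) ≤ 1 := by
  by_cases h : ∃ t < N, BS Z N (k - (t : ℕ))
  · obtain ⟨t, ht, hb⟩ := h
    rw [Finset.sum_eq_single t]
    · exact ii_le_one _ _
    · intro t' ht' hne
      apply ii_of_notMem
      intro hb'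
      have ht'' := Finset.mem_range.1 ht'
      have := BS.eq_of (i := k) hb hb' (by omega) (by omega) (by omega) (by omega)
      omega
    · intro h; exact absurd (Finset.mem_range.2 ht) h
  · rw [Finset.sum_eq_zero]
    · norm_num
    · intro t ht
      exact ii_of_notMem fun hb => h ⟨t, Finset.mem_range.1 ht, hb⟩

lemma count_BS_le {Z : Set ℤ} {N : ℕ} (i : ℤ) (L : ℕ) :
    (N : ℝ) * ∑ u ∈ Finset.range L, ii {s | BS Z N s} (i + u) ≤ L + N := by
  have h1 : ∑ u ∈ Finset.range (L + N), ∑ t ∈ Finset.range N, ii {s | BS Z N s} (i + u - t) ≤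
      ∑ u ∈ Finset.range (L + N), (1 : ℝ) := Finset.sum_le_sum fun u _ => one_block _
  rw [Finset.sum_comm] at h1
  have h2 : ∑ t ∈ Finset.range N, ∑ u ∈ Finset.range L, ii {s | BS Z N s} (i + u) ≤
      ∑ t ∈ Finset.range N, ∑ u ∈ Finset.range (L + N), ii {s | BS Z N s} (i + u - t) := by
    refine Finset.sum_le_sum fun t ht => ?_
    have ht' := Finset.mem_range.1 ht
    obtain ⟨d, hd⟩ : ∃ d, L + N = t + (L + d) := ⟨N - t, by omega⟩
    rw [hd, Finset.sum_range_add, Finset.sum_range_add]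
    have h3 : ∀ u : ℕ, ii {s | BS Z N s} (i + ((t + u : ℕ) : ℤ) - t) = ii {s | BS Z N s} (i + u) := by
      intro u; congr 1; push_cast; ring
    simp only [h3]
    have h4 : 0 ≤ ∑ u ∈ Finset.range t, ii {s | BS Z N s} (i + u - t) :=
      Finset.sum_nonneg fun _ _ => ii_nonneg _ _
    have h5 : 0 ≤ ∑ u ∈ Finset.range d, ii {s | BS Z N s} (i + ((L + u : ℕ) : ℤ)) :=
      Finset.sum_nonneg fun _ _ => ii_nonneg _ _
    linarith
  simp at h1 h2
  linarith

lemma Dm_le {Z : Set ℤ} {N : ℕ} (hN : 0 < N) {z i : ℤ} (hz : z ∈ Z) (hzi : z ≤ i) :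
    ii (Dm Z N) i ≤ ii {s | BS Z N s} i + near Z N i := by
  by_cases h : i ∈ Dm Z N
  · rw [ii_of_mem h]
    by_cases hb : BS Z N i
    · rw [ii_of_mem (D := {s | BS Z N s}) hb]; linarith [near_nonneg Z N i]
    · rw [ii_of_notMem (D := {s | BS Z N s}) hb, zero_add]
      by_cases hu : ∀ u, i < u → u < i + N → u ∉ Z
      · exfalso
        obtain ⟨t, ht, h1, h2, h3⟩ := st_spec Z hN i
        have := h2 (exists_BS hN hz hzi hu)
        unfold Dm at h
        simp only [mem_ofPred_eq] at h
        have : t = 0 := by omega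
        subst this
        simp at this
        simp_all
      · push Not at hu
        obtain ⟨u, h1, h2, h3⟩ := hu
        exact near_ge h1 h2 h3
  · rw [ii_of_notMem h]
    have := ii_nonneg {s | BS Z N s} i
    linarith [near_nonneg Z N i]

lemma height_bound {Z : Set ℤ} {n N J : ℕ} (hn : 0 < n) (hnN : n ≤ N) {z i : ℤ} (hz : z ∈ Z)
    (hzi : z ≤ i) (Ina Ba S B' : Set ℤ) (hS : S = {s | BS Z n s ∧ s ∉ Ina}) (hB : B' ⊆ Ba) (j : ℕ)
    (h : ∑ u ∈ Finset.range (j + 1), (J * ii Ba (i + u) + ii Ina (i + u) + 2 * near Z N (i + u)) ≤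
      (1 / (n : ℝ) - 1 / N) * (j + 1 : ℕ) - (n + 1)) :
    hh 1 (Dm Z N) S i j ≤ 0 ∧ hh J B' S i j ≤ 0 := by
  set L := j + 1 with hL
  have hN : 0 < N := by omega
  have hn' : (0 : ℝ) < n := by exact_mod_cast hn
  have hn1 : (1 : ℝ) ≤ n := by exact_mod_cast hn
  have hN' : (0 : ℝ) < N := by exact_mod_cast hN
  rw [Finset.sum_add_distrib, Finset.sum_add_distrib, ← Finset.mul_sum, ← Finset.mul_sum] at h
  have c1 := count_BS_ge hn hz hzi L
  have c2 := count_BS_le (Z := Z) (N := N) i L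
  have c3 : ∑ u ∈ Finset.range L, ii (Dm Z N) (i + u) ≤
      ∑ u ∈ Finset.range L, ii {s | BS Z N s} (i + u) + ∑ u ∈ Finset.range L, near Z N (i + u) := by
    rw [← Finset.sum_add_distrib]
    exact Finset.sum_le_sum fun u _ => Dm_le hN hz (by omega)
  have c4 : ∑ u ∈ Finset.range L, ii {s | BS Z n s} (i + u) ≤
      ∑ u ∈ Finset.range L, ii S (i + u) + ∑ u ∈ Finset.range L, ii Ina (i + u) := by
    rw [← Finset.sum_add_distrib]
    refine Finset.sum_le_sum fun u _ => ?_
    by_cases hb : BS Z n (i + u)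
    · by_cases hI : i + (u : ℤ) ∈ Ina
      · rw [ii_of_mem hI]
        linarith [ii_nonneg S (i + u), ii_le_one {s | BS Z n s} (i + u)]
      · have : i + (u : ℤ) ∈ S := by rw [hS]; exact ⟨hb, hI⟩
        rw [ii_of_mem this]
        linarith [ii_nonneg Ina (i + u), ii_le_one {s | BS Z n s} (i + u)]
    · rw [ii_of_notMem (D := {s | BS Z n s}) hb]
      linarith [ii_nonneg Ina (i + u), ii_nonneg S (i + u)]
  have c5 : ∑ u ∈ Finset.range L, near Z n (i + u) ≤ ∑ u ∈ Finset.range L, near Z N (i + u) :=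
    Finset.sum_le_sum fun u _ => near_mono hnN _
  have c6 : ∑ u ∈ Finset.range L, ii B' (i + u) ≤ ∑ u ∈ Finset.range L, ii Ba (i + u) := by
    refine Finset.sum_le_sum fun u _ => ?_
    by_cases hb : i + (u : ℤ) ∈ B'
    · rw [ii_of_mem hb, ii_of_mem (hB hb)]
    · rw [ii_of_notMem hb]; exact ii_nonneg _ _
  have p1 : 0 ≤ ∑ u ∈ Finset.range L, near Z N (i + u) :=
    Finset.sum_nonneg fun _ _ => near_nonneg _ _ _
  have p2 : 0 ≤ ∑ u ∈ Finset.range L, ii Ina (i + u) :=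
    Finset.sum_nonneg fun _ _ => ii_nonneg _ _
  have p3 : 0 ≤ (J : ℝ) * ∑ u ∈ Finset.range L, ii Ba (i + u) :=
    mul_nonneg (by positivity) (Finset.sum_nonneg fun _ _ => ii_nonneg _ _)
  have c7 : (J : ℝ) * ∑ u ∈ Finset.range L, ii B' (i + u) ≤ J * ∑ u ∈ Finset.range L, ii Ba (i + u) :=
    mul_le_mul_of_nonneg_left c6 (by positivity)
  have k1 := hh_cast 1 (Dm Z N) S i j
  have k2 := hh_cast J B' S i j
  rw [← hL] at k1 k2
  set nr := ∑ u ∈ Finset.range L, near Z N (i + u)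
  set nr' := ∑ u ∈ Finset.range L, near Z n (i + u)
  set bn := ∑ u ∈ Finset.range L, ii {s | BS Z n s} (i + u)
  set bN := ∑ u ∈ Finset.range L, ii {s | BS Z N s} (i + u)
  set ss := ∑ u ∈ Finset.range L, ii S (i + u)
  set ia := ∑ u ∈ Finset.range L, ii Ina (i + u)
  set dm := ∑ u ∈ Finset.range L, ii (Dm Z N) (i + u)
  have q1 : (L : ℝ) / n ≤ nr / n + bn + n := by
    rw [div_add' _ _ _ hn'.ne', div_add' _ _ _ hn'.ne', div_le_div_iff_of_pos_right hn']
    linarith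
  have q2 : bN ≤ L / N + 1 := by
    rw [div_add' _ _ _ hN'.ne', le_div_iff₀ hN']
    linarith
  have q3 : nr / n ≤ nr := div_le_self p1 hn1
  have q4 : (0 : ℝ) ≤ L / N := by positivity
  have q5 : (1 / (n : ℝ) - 1 / N) * L = L / n - L / N := by ring
  rw [q5] at h
  constructor
  · have : (hh 1 (Dm Z N) S i j : ℝ) ≤ 0 := by rw [k1]; push_cast; linarith
    exact_mod_cast this
  · have : (hh J B' S i j : ℝ) ≤ 0 := by rw [k2]; linarith
    exact_mod_cast this

end counting
end NF


namespace NF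

section code
variable {A : Type*}

/-- Source code on words of length `n`, with alphabet `C`. -/
structure Code (A : Type*) (α β : A) (n r : ℕ) (C : Type*) where
  act : (Fin n → A) → Prop
  rep : (Fin n → A) → C → (Fin n → A)
  sym : (Fin n → A) → C
  act_rep : ∀ w c, act w → act (rep w c)
  sym_rep : ∀ w c, act w → sym (rep w c) = c
  rep_sym : ∀ w, act w → rep w (sym w) = w
  rep_rep : ∀ w c c', act w → rep (rep w c) c' = rep w c'
  avoid : ∀ w, act w → ∀ (e : ℕ) (h : e + r < n), w ⟨e + r, h⟩ = β →
    ¬ ∀ u (hu : u < r), w ⟨e + u, by omega⟩ = α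
  bdry : ∀ w c, act w → ∀ i : Fin n, (i.1 < r ∨ n ≤ i.1 + r) → rep w c i = w i
  cnt : ∀ w c, act w → ∀ f : A → ℝ, ∏ i, f (rep w c i) = ∏ i, f (w i)

/-- the set of marker ends -/
def Zs (α β : A) (r : ℕ) (x : ℤ → A) : Set ℤ :=
  {e | x (e - 1) = β ∧ ∀ u : ℕ, u < r → x (e - 1 - r + u) = α}

def word (n : ℕ) (x : ℤ → A) (s : ℤ) : Fin n → A := fun t => x (s + t)

/-- overwrite the block at `s` by `w` -/
def ov {n : ℕ} (s : ℤ) (w : Fin n → A) (x : ℤ → A) : ℤ → A := fun i =>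
  if h : s ≤ i ∧ i < s + n then w ⟨(i - s).toNat, by omega⟩ else x i

lemma ov_of {n : ℕ} {s : ℤ} {w : Fin n → A} {x : ℤ → A} (t : Fin n) : ov s w x (s + t) = w t := by
  have h : s ≤ s + (t : ℤ) ∧ s + (t : ℤ) < s + n := ⟨by omega, by have := t.2; omega⟩
  unfold ov
  rw [dif_pos h]
  congr 1
  ext
  simp

lemma ov_out {n : ℕ} {s : ℤ} {w : Fin n → A} {x : ℤ → A} {i : ℤ} (h : ¬ (s ≤ i ∧ i < s + n)) :
    ov s w x i = x i := by
  unfold ov; rw [dif_neg h]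

lemma in_block {n : ℕ} {s i : ℤ} (h : s ≤ i ∧ i < s + n) : ∃ t : Fin n, i = s + t :=
  ⟨⟨(i - s).toNat, by omega⟩, by simp; omega⟩

lemma word_ov {n : ℕ} (s : ℤ) (w : Fin n → A) (x : ℤ → A) : word n (ov s w x) s = w := by
  ext t; exact ov_of t

lemma ov_ov {n : ℕ} (s : ℤ) (w w' : Fin n → A) (x : ℤ → A) : ov s w' (ov s w x) = ov s w' x := by
  ext i
  by_cases h : s ≤ i ∧ i < s + n
  · obtain ⟨t, rfl⟩ := in_block h
    rw [ov_of, ov_of]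
  · rw [ov_out h, ov_out h, ov_out h]

lemma ov_word {n : ℕ} (s : ℤ) (x : ℤ → A) : ov s (word n x s) x = x := by
  ext i
  by_cases h : s ≤ i ∧ i < s + n
  · obtain ⟨t, rfl⟩ := in_block h
    rw [ov_of]; rfl
  · rw [ov_out h]

lemma word_ov_ne {n : ℕ} {s s' : ℤ} (w : Fin n → A) (x : ℤ → A)
    (h : s + n ≤ s' ∨ s' + n ≤ s) : word n (ov s w x) s' = word n x s' := by
  ext t
  have := t.2
  exact ov_out (by omega)

variable {α β : A} {n r : ℕ} {C : Type*}

lemma Zs_ov_sub (K : Code A α β n r C) {w : Fin n → A} {s : ℤ} {x : ℤ → A} (hw : K.act w)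
    (hb : ∀ i : Fin n, (i.1 < r ∨ n ≤ i.1 + r) → w i = word n x s i) :
    Zs α β r (ov s w x) ⊆ Zs α β r x := by
  rintro e ⟨h1, h2⟩
  by_cases hin : s ≤ e - 1 - r ∧ e - 1 < s + n
  · exfalso
    obtain ⟨k, hk⟩ : ∃ k : ℕ, e = s + k + r + 1 := ⟨(e - 1 - r - s).toNat, by omega⟩
    have hkr : k + r < n := by omega
    apply K.avoid w hw k hkr
    · rw [← h1, ← ov_of (s := s) (w := w) (x := x)]
      congr 1; simp; omega
    · intro u hu
      rw [← h2 u hu, ← ov_of (s := s) (w := w) (x := x)]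
      congr 1; simp; omega
  · have key : ∀ i, e - 1 - r ≤ i → i ≤ e - 1 → ov s w x i = x i := by
      intro i hi1 hi2
      by_cases h : s ≤ i ∧ i < s + n
      · obtain ⟨t, rfl⟩ := in_block h
        rw [ov_of, hb t (by omega)]; rfl
      · exact ov_out h
    refine ⟨by rw [← h1, key _ (by omega) (by omega)], fun u hu => ?_⟩
    rw [← h2 u hu, key _ (by omega) (by omega)]

/-- active block starts -/
def Ac (K : Code A α β n r C) (x : ℤ → A) : Set ℤ := {s | BS (Zs α β r x) n s ∧ K.act (word n x s)}

/-- symbols -/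
def sg (K : Code A α β n r C) (x : ℤ → A) (s : ℤ) : C := K.sym (word n x s)

open Classical in
/-- replacement -/
noncomputable def rp (K : Code A α β n r C) (s : ℤ) (c : C) (x : ℤ → A) : ℤ → A :=
  if s ∈ Ac K x then ov s (K.rep (word n x s) c) x else x

lemma Zs_rp (K : Code A α β n r C) (s : ℤ) (c : C) (x : ℤ → A) :
    Zs α β r (rp K s c x) = Zs α β r x := by
  unfold rp
  split_ifs with h
  · have ha := h.2
    apply Subset.antisymm
    · exact Zs_ov_sub K (K.act_rep _ _ ha) (K.bdry _ _ ha)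
    · have := Zs_ov_sub K (w := word n x s) (s := s) (x := ov s (K.rep (word n x s) c) x) ha
        (fun i hi => by rw [word_ov, K.bdry _ _ ha i hi])
      rwa [ov_ov, ov_word] at this
  · rfl

lemma word_rp_ne (K : Code A α β n r C) {s s' : ℤ} (c : C) (x : ℤ → A)
    (hb : BS (Zs α β r x) n s') (hne : s' ≠ s) : word n (rp K s c x) s' = word n x s' := by
  unfold rp
  split_ifs with h
  · apply word_ov_ne
    rcases lt_or_gt_of_ne hne with hl | hl
    · right; exact hb.disj h.1 hl
    · left; exact h.1.disj hb hl
  · rfl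

lemma word_rp_self (K : Code A α β n r C) {s : ℤ} (c : C) (x : ℤ → A) (h : s ∈ Ac K x) :
    word n (rp K s c x) s = K.rep (word n x s) c := by
  unfold rp
  rw [if_pos h, word_ov]

lemma Ac_rp (K : Code A α β n r C) (s : ℤ) (c : C) (x : ℤ → A) :
    Ac K (rp K s c x) = Ac K x := by
  by_cases h : s ∈ Ac K x
  · ext s'
    unfold Ac
    simp only [mem_ofPred_eq, Zs_rp]
    apply and_congr_right
    intro hb
    by_cases hs : s' = s
    · subst hs
      rw [word_rp_self K c x h]
      exact ⟨fun _ => h.2, fun ha => K.act_rep _ _ ha⟩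
    · rw [word_rp_ne K c x hb hs]
  · unfold rp; rw [if_neg h]

lemma sg_rp_self (K : Code A α β n r C) {s : ℤ} (c : C) (x : ℤ → A) (h : s ∈ Ac K x) :
    sg K (rp K s c x) s = c := by
  unfold sg; rw [word_rp_self K c x h, K.sym_rep _ _ h.2]

/-- iterated replacement -/
noncomputable def PS (K : Code A α β n r C) : (M : ℕ) → (Fin M → ℤ) → (Fin M → C) → (ℤ → A) → (ℤ → A)
  | 0, _, _, x => x
  | M + 1, s, c, x => PS K M (Fin.tail s) (Fin.tail c) (rp K (s 0) (c 0) x)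

lemma Zs_PS (K : Code A α β n r C) (M : ℕ) (s : Fin M → ℤ) (c : Fin M → C) (x : ℤ → A) :
    Zs α β r (PS K M s c x) = Zs α β r x := by
  induction M generalizing x with
  | zero => rfl
  | succ M ih => rw [PS, ih, Zs_rp]

lemma Ac_PS (K : Code A α β n r C) (M : ℕ) (s : Fin M → ℤ) (c : Fin M → C) (x : ℤ → A) :
    Ac K (PS K M s c x) = Ac K x := by
  induction M generalizing x with
  | zero => rfl
  | succ M ih => rw [PS, ih, Ac_rp]

lemma word_PS_ne (K : Code A α β n r C) (M : ℕ) (s : Fin M → ℤ) (c : Fin M → C) (x : ℤ → A) {s' : ℤ}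
    (h : s' ∈ Ac K x) (hne : ∀ j, s' ≠ s j) : word n (PS K M s c x) s' = word n x s' := by
  induction M generalizing x with
  | zero => rfl
  | succ M ih =>
    rw [PS, ih (Fin.tail s) (Fin.tail c) _ (by rwa [Ac_rp]) (fun j => hne j.succ), word_rp_ne K _ _ h.1 (hne 0)]

lemma sg_PS (K : Code A α β n r C) (M : ℕ) (s : Fin M → ℤ) (hs : Function.Injective s)
    (c : Fin M → C) (x : ℤ → A) (j : Fin M) (h : s j ∈ Ac K x) :
    sg K (PS K M s c x) (s j) = c j := by
  induction M generalizing x with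
  | zero => exact j.elim0
  | succ M ih =>
    rw [PS]
    rcases Fin.eq_zero_or_eq_succ j with rfl | ⟨j, rfl⟩
    · unfold sg
      rw [word_PS_ne K M _ _ _ (by rwa [Ac_rp])]
      · exact sg_rp_self K _ _ h
      · intro j hj
        exact (Fin.succ_ne_zero j) (hs hj).symm
    · exact ih (Fin.tail s) (fun a b hab => Fin.succ_injective _ (hs hab)) (Fin.tail c) _ j
        (by rw [Ac_rp]; exact h)

/-- the raw map -/
noncomputable def ph {C1 C2 B : Type*} {N J : ℕ} (hN : 0 < N) (good : C1 → Prop)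
    (G : C1 → (Fin J → C2) → (Fin N → B)) (K : Code A α β n r (C1 × C2)) (x : ℤ → A) : ℤ → B :=
  out hN good G (Zs α β r x) (Ac K x) (sg K x)

lemma word_shift (x : ℤ → A) (s : ℤ) : word n (shift x) s = word n x (s + 1) := by
  ext t; unfold word shift; congr 1; ring

lemma Zs_shift (x : ℤ → A) : Zs α β r (shift x) = sh (Zs α β r x) := by
  ext e
  unfold Zs shift sh
  simp only [mem_ofPred_eq]
  rw [show e - 1 + 1 = e + 1 - 1 by ring]
  apply and_congr_right; intro _
  apply forall_congr'; intro u
  rw [show e - 1 - (r : ℤ) + u + 1 = e + 1 - 1 - r + u by ring]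

lemma Ac_shift (K : Code A α β n r C) (x : ℤ → A) : Ac K (shift x) = sh (Ac K x) := by
  ext s
  unfold Ac
  simp only [mem_ofPred_eq, Zs_shift, BS_sh, word_shift]
  rfl

lemma ph_shift {C1 C2 B : Type*} {N J : ℕ} (hN : 0 < N) (good : C1 → Prop)
    (G : C1 → (Fin J → C2) → (Fin N → B)) (K : Code A α β n r (C1 × C2)) (x : ℤ → A) :
    ph hN good G K (shift x) = shift (ph hN good G K x) := by
  ext i
  have : sg K (shift x) = fun s => sg K x (s + 1) := by
    ext s : 1; unfold sg; rw [word_shift]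
  unfold ph
  rw [Zs_shift, Ac_shift, this, out_sh]
  rfl

end code
end NF


namespace NF

section av

/-- average over a finite type -/
noncomputable def av {X : Type*} [Fintype X] (F : X → ℝ) : ℝ := (∑ x, F x) / Fintype.card X

variable {X Y K : Type*} [Fintype X] [Fintype Y] [Fintype K]

lemma av_mono {F F' : X → ℝ} (h : ∀ x, F x ≤ F' x) : av F ≤ av F' := by
  unfold av
  exact div_le_div_of_nonneg_right (Finset.sum_le_sum fun x _ => h x) (by positivity)

lemma av_const [Nonempty X] (a : ℝ) : av (fun _ : X => a) = a := by
  unfold av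
  have : (Fintype.card X : ℝ) ≠ 0 := by exact_mod_cast Fintype.card_ne_zero
  simp

lemma av_nonneg {F : X → ℝ} (h : ∀ x, 0 ≤ F x) : 0 ≤ av F :=
  div_nonneg (Finset.sum_nonneg fun x _ => h x) (by positivity)

lemma av_mul_left (a : ℝ) (F : X → ℝ) : av (fun x => a * F x) = a * av F := by
  unfold av; rw [← Finset.mul_sum, mul_div_assoc]

lemma av_equiv (e : X ≃ Y) (F : Y → ℝ) : av (fun x => F (e x)) = av F := by
  unfold av
  rw [Fintype.card_congr e, e.sum_comp]

lemma av_prod (F : X × Y → ℝ) : av F = av (fun x => av (fun y => F (x, y))) := by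
  unfold av
  rw [Fintype.sum_prod_type, Fintype.card_prod, ← Finset.sum_div, div_div]
  push_cast
  rw [mul_comm]

lemma av_comp [DecidableEq X] [DecidableEq K] [Nonempty Y] {ι : K → X} (hι : Function.Injective ι)
    (F : (K → Y) → ℝ) : av (fun c : X → Y => F (fun k => c (ι k))) = av F := by
  classical
  let E : K ⊕ ↥(range ι)ᶜ ≃ X :=
    (Equiv.sumCongr (Equiv.ofInjective ι hι) (Equiv.refl _)).trans (Equiv.Set.sumCompl _)
  let E' : (X → Y) ≃ (K → Y) × (↥(range ι)ᶜ → Y) :=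
    (E.symm.arrowCongr (Equiv.refl Y)).trans (Equiv.sumArrowEquivProdArrow _ _ _)
  have h1 : ∀ c : X → Y, (E' c).1 = fun k => c (ι k) := by
    intro c
    ext k
    simp [E', E]
  have := av_equiv E' (fun p => F p.1)
  simp only [h1] at this
  rw [this, av_prod]
  simp only [av_const]

lemma av_pi {I : Type*} [Fintype I] [DecidableEq I] (F : I → Y → ℝ) :
    av (fun e : I → Y => ∏ i, F i (e i)) = ∏ i, av (F i) := by
  unfold av
  rw [Finset.prod_div_distrib, Finset.prod_univ_sum, Fintype.piFinset_univ]
  simp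

lemma av_blocks [DecidableEq X] [Nonempty Y] {I : Type*} [Fintype I] [DecidableEq I] {J : ℕ}
    {ι : I × Fin J → X} (hι : Function.Injective ι) (F : I → (Fin J → Y) → ℝ) :
    av (fun c : X → Y => ∏ i, F i (fun t => c (ι (i, t)))) = ∏ i, av (F i) := by
  rw [av_comp hι (fun e => ∏ i, F i (fun t => e (i, t))), ← av_pi,
    ← av_equiv (Equiv.curry I (Fin J) Y)]
  rfl

end av

section law
variable {C1 C2 B : Type*} [Fintype C1] [Fintype C2] [Fintype B] [Nonempty C1] [Nonempty C2]
  {N J : ℕ}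

lemma sum_V [DecidableEq B] {q : B → ℝ} (hq : IsProbVec q) (T : Finset ℤ) (o : ℤ → Fin N)
    (ho : ∀ j ∈ T, ∀ j' ∈ T, o j = o j' → j = j') (b : ℤ → B) :
    ∑ w : Fin N → B, (if ∀ j ∈ T, w (o j) = b j then ∏ t, q (w t) else 0) = ∏ j ∈ T, q (b j) := by
  classical
  have h1 : ∀ w : Fin N → B, (if ∀ j ∈ T, w (o j) = b j then ∏ t, q (w t) else 0) =
      ∏ t, (if ∀ j ∈ T, o j = t → w t = b j then q (w t) else 0) := by
    intro w
    split_ifs with h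
    · refine Finset.prod_congr rfl fun t _ => ?_
      rw [if_pos]
      rintro j hj rfl
      exact h j hj
    · push Not at h
      obtain ⟨j, hj, hne⟩ := h
      symm
      apply Finset.prod_eq_zero (Finset.mem_univ (o j))
      rw [if_neg]
      intro h
      exact hne (h j hj rfl)
  simp only [h1]
  have h2 := (Finset.prod_univ_sum (fun _ : Fin N => (Finset.univ : Finset B))
    (fun t a => if ∀ j ∈ T, o j = t → a = b j then q a else 0)).symm
  rw [Fintype.piFinset_univ] at h2
  rw [h2, ← Finset.prod_fiberwise T o]
  refine Finset.prod_congr rfl fun t _ => ?_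
  by_cases h : ∃ j ∈ T, o j = t
  · obtain ⟨j, hj, rfl⟩ := h
    have e1 : T.filter (fun j' => o j' = o j) = {j} := by
      ext j'
      simp only [Finset.mem_filter, Finset.mem_singleton]
      exact ⟨fun h => ho _ h.1 _ hj h.2, fun h => by subst h; exact ⟨hj, rfl⟩⟩
    rw [e1, Finset.prod_singleton, Finset.sum_eq_single (b j)]
    · rw [if_pos]
      intro j' hj' h
      rw [ho _ hj' _ hj h]
    · intro a _ ha
      rw [if_neg]
      intro h; exact ha (h j hj rfl)
    · simp
  · push Not at h
    have e1 : T.filter (fun j' => o j' = t) = ∅ := by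
      ext j'
      simp only [Finset.mem_filter, Finset.notMem_empty, iff_false, not_and]
      exact h j'
    rw [e1, Finset.prod_empty, ← hq.2]
    refine Finset.sum_congr rfl fun a _ => ?_
    rw [if_pos]
    intro j hj h'
    exact absurd h' (h j hj)

/-- the determination condition -/
def Det (J N : ℕ) (good : C1 → Prop) (Z S : Set ℤ) (σ : ℤ → C1 × C2) (R : Set ℤ) (I : Finset ℤ) : Prop :=
  ∀ i ∈ I, Mex 1 (Dm Z N) S (st Z N i) ∧ mt 1 (Dm Z N) S (st Z N i) 0 ∈ R ∧
    (¬ good (σ (mt 1 (Dm Z N) S (st Z N i) 0)).1 →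
      Mex J (Bd S good σ) S (mt 1 (Dm Z N) S (st Z N i) 0) ∧
      ∀ t : Fin J, mt J (Bd S good σ) S (mt 1 (Dm Z N) S (st Z N i) 0) t ∈ R)

open Classical in
lemma law (hN : 0 < N) (good : C1 → Prop) (G : C1 → (Fin J → C2) → (Fin N → B))
    {q : B → ℝ} (hq : IsProbVec q)
    (hG : ∀ w, av (fun p : C1 × (Fin J → C2) => if G p.1 p.2 = w then (1 : ℝ) else 0) = ∏ t, q (w t))
    (hgood : ∀ c, good c → ∀ e e', G c e = G c e')
    (Z S : Set ℤ) {M : ℕ} (s : Fin M → ℤ)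
    (σ : (Fin M → C1 × C2) → ℤ → C1 × C2) (hσ : ∀ c j, s j ∈ S → σ c (s j) = c j)
    (hσ' : ∀ c c' y, y ∈ S → y ∉ range s → σ c y = σ c' y) (I : Finset ℤ) (b : ℤ → B) :
    av (fun c => if Det J N good Z S (σ c) (range s) I ∧ ∀ i ∈ I, out hN good G Z S (σ c) i = b i
      then (1 : ℝ) else 0) ≤ ∏ i ∈ I, q (b i) := by
  by_cases hlev : ∀ i ∈ I, Mex 1 (Dm Z N) S (st Z N i) ∧ mt 1 (Dm Z N) S (st Z N i) 0 ∈ range s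
  swap
  · have h0 : ∀ c, (if Det J N good Z S (σ c) (range s) I ∧
        ∀ i ∈ I, out hN good G Z S (σ c) i = b i then (1 : ℝ) else 0) = 0 := by
      intro c
      rw [if_neg]
      rintro ⟨h, -⟩
      exact hlev fun i hi => ⟨(h i hi).1, (h i hi).2.1⟩
    simp only [h0]
    rw [av_const]
    exact Finset.prod_nonneg fun i _ => hq.1 _
  -- demand sites
  let I' := I.image (st Z N)
  have hI' : ∀ i : I', i.1 ∈ Dm Z N ∧ Mex 1 (Dm Z N) S i ∧ mt 1 (Dm Z N) S i 0 ∈ range s := by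
    rintro ⟨i, hi⟩
    obtain ⟨k, hk, rfl⟩ := Finset.mem_image.1 hi
    exact ⟨st_st Z hN k, hlev k hk⟩
  choose j1 hj1 using fun i : I' => (hI' i).2.2
  have hj1S : ∀ i, s (j1 i) ∈ S := by
    intro i
    obtain ⟨j, h1, h2, h3, h4⟩ := mt_spec (hI' i).1 (hI' i).2.1 (t := 0) zero_lt_one
    rw [hj1, h1]; exact h3
  have hj1inj : Function.Injective j1 := by
    intro i i' h
    have : mt 1 (Dm Z N) S i 0 = mt 1 (Dm Z N) S i' 0 := by rw [← hj1, ← hj1, h]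
    exact Subtype.ext (mt_inj (hI' i).1 (hI' i').1 (hI' i).2.1 (hI' i').2.1 zero_lt_one zero_lt_one this).1
  let o : ℤ → Fin N := fun i => ⟨(i - st Z N i).toNat % N, Nat.mod_lt _ hN⟩
  let V : ℤ → (Fin N → B) → Prop := fun i w => ∀ j ∈ I.filter (fun j => st Z N j = i), w (o j) = b j
  let fr : I' → C1 → ℝ := fun i a => av (fun e : Fin J → C2 => if V i (G a e) then (1 : ℝ) else 0)
  -- averages over first coordinates of the symbols
  have hfr : ∀ i : I', av (fr i) = ∏ j ∈ I.filter (fun j => st Z N j = i), q (b j) := by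
    intro i
    have h1 : av (fr i) = av (fun p : C1 × (Fin J → C2) => if V i (G p.1 p.2) then (1 : ℝ) else 0) := by
      rw [av_prod]
    have h2 : ∀ p : C1 × (Fin J → C2), (if V i (G p.1 p.2) then (1 : ℝ) else 0) =
        ∑ w, if V i w then (if G p.1 p.2 = w then (1 : ℝ) else 0) else 0 := by
      intro p
      rw [Finset.sum_eq_single (G p.1 p.2)]
      · simp
      · intro w _ hw; simp [hw.symm]
      · simp
    rw [h1]
    unfold av
    simp only [h2]
    rw [Finset.sum_comm, Finset.sum_div, ← sum_V hq _ o]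
    · refine Finset.sum_congr rfl fun w _ => ?_
      by_cases hV : V i w
      · rw [if_pos hV]
        simp only [if_pos hV]
        exact hG w
      · rw [if_neg hV]
        simp [if_neg hV]
    · intro j hj j' hj' h
      simp only [Finset.mem_filter] at hj hj'
      obtain ⟨t, ht, h1, -⟩ := st_spec Z hN j
      obtain ⟨t', ht', h1', -⟩ := st_spec Z hN j'
      have h2 : (j - st Z N j).toNat % N = (j' - st Z N j').toNat % N := congrArg Fin.val h
      rw [h1, h1'] at h2
      simp only [sub_sub_cancel, Int.toNat_natCast, Nat.mod_eq_of_lt ht, Nat.mod_eq_of_lt ht'] at h2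
      omega
  have hfr0 : ∀ i a, 0 ≤ fr i a := fun i a => av_nonneg fun e => by split_ifs <;> norm_num
  -- inner estimate
  have inner : ∀ c1 : Fin M → C1, av (fun c2 : Fin M → C2 =>
      if Det J N good Z S (σ fun j => (c1 j, c2 j)) (range s) I ∧
        ∀ i ∈ I, out hN good G Z S (σ fun j => (c1 j, c2 j)) i = b i then (1 : ℝ) else 0) ≤
      ∏ i, fr i (c1 (j1 i)) := by
    intro c1
    by_cases hex : ∃ c2 : Fin M → C2, Det J N good Z S (σ fun j => (c1 j, c2 j)) (range s) I
    swap
    · have h0 : ∀ c2 : Fin M → C2, (if Det J N good Z S (σ fun j => (c1 j, c2 j)) (range s) I ∧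
        ∀ i ∈ I, out hN good G Z S (σ fun j => (c1 j, c2 j)) i = b i then (1 : ℝ) else 0) = 0 := by
        intro c
        rw [if_neg]
        rintro ⟨h, -⟩
        exact hex ⟨c, h⟩
      simp only [h0]
      rw [av_const]
      exact Finset.prod_nonneg fun i _ => hfr0 _ _
    obtain ⟨c20, hdet⟩ := hex
    set Bd0 := Bd S good (σ fun j => (c1 j, c20 j)) with hBd0
    have hBd : ∀ c2 : Fin M → C2, Bd S good (σ fun j => (c1 j, c2 j)) = Bd0 := by
      intro c2
      ext y
      unfold Bd0 Bd
      simp only [mem_ofPred_eq]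
      apply and_congr_right
      intro hy
      by_cases hr : y ∈ range s
      · obtain ⟨j, rfl⟩ := hr
        rw [hσ _ _ hy, hσ _ _ hy]
      · rw [hσ' _ (fun j => (c1 j, c20 j)) y hy hr]
    let P : I' → Prop := fun i => good (c1 (j1 i))
    have hb : ∀ i : {i : I' // ¬ P i}, s (j1 i) ∈ Bd0 ∧ Mex J Bd0 S (s (j1 i)) ∧
        ∀ t : Fin J, mt J Bd0 S (s (j1 i)) t ∈ range s := by
      rintro ⟨⟨i, hi⟩, hP⟩
      obtain ⟨k, hk, rfl⟩ := Finset.mem_image.1 hi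
      have h1 := (hdet k hk).2.2
      have h2 : s (j1 ⟨st Z N k, hi⟩) = mt 1 (Dm Z N) S (st Z N k) 0 := hj1 _
      rw [← h2] at h1
      rw [hσ _ _ (hj1S _)] at h1
      refine ⟨⟨hj1S _, ?_⟩, h1 hP⟩
      rw [hσ _ _ (hj1S _)]
      exact hP
    choose j2 hj2 using fun (i : {i : I' // ¬ P i}) (t : Fin J) => (hb i).2.2 t
    have hj2S : ∀ i t, s (j2 i t) ∈ S := by
      intro i t
      obtain ⟨j, h1, h2, h3, h4⟩ := mt_spec (hb i).1 (hb i).2.1 t.2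
      rw [hj2, h1]; exact h3
    have hsj1 : ∀ i i' : I', s (j1 i) = s (j1 i') → i = i' := by
      intro i i' h
      have : mt 1 (Dm Z N) S i 0 = mt 1 (Dm Z N) S i' 0 := by rw [← hj1, ← hj1, h]
      exact Subtype.ext (mt_inj (hI' i).1 (hI' i').1 (hI' i).2.1 (hI' i').2.1 zero_lt_one zero_lt_one this).1
    have hj2inj : Function.Injective (fun p : {i : I' // ¬ P i} × Fin J => j2 p.1 p.2) := by
      rintro ⟨i, t⟩ ⟨i', t'⟩ h
      simp only at h
      have h1 : mt J Bd0 S (s (j1 i)) t = mt J Bd0 S (s (j1 i')) t' := by rw [← hj2, ← hj2, h]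
      have h2 := mt_inj (hb i).1 (hb i').1 (hb i).2.1 (hb i').2.1 t.2 t'.2 h1
      have h3 : i = i' := Subtype.ext (hsj1 _ _ h2.1)
      have h4 : t = t' := Fin.ext h2.2
      rw [h3, h4]
    -- pointwise bound
    have hpt : ∀ c2 : Fin M → C2, (if Det J N good Z S (σ fun j => (c1 j, c2 j)) (range s) I ∧
        ∀ i ∈ I, out hN good G Z S (σ fun j => (c1 j, c2 j)) i = b i then (1 : ℝ) else 0) ≤
        (∏ i : {i : I' // P i}, fr i (c1 (j1 i))) * ∏ i : {i : I' // ¬ P i},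
          (fun e : Fin J → C2 => if V i (G (c1 (j1 i)) e) then (1 : ℝ) else 0)
            (fun t => c2 (j2 i t)) := by
      intro c2
      split_ifs with h
      swap
      · exact mul_nonneg (Finset.prod_nonneg fun i _ => hfr0 _ _)
          (Finset.prod_nonneg fun i _ => by dsimp only; split_ifs <;> norm_num)
      have hV : ∀ i : I', V i (G (c1 (j1 i))
          (fun t => (σ (fun j => (c1 j, c2 j)) (mt J Bd0 S (s (j1 i)) t)).2)) := by
        intro i k hk
        simp only [Finset.mem_filter] at hk
        have h1 := h.2 k hk.1
        unfold out at h1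
        have e0 : mt 1 (Dm Z N) S (st Z N k) 0 = s (j1 i) := by rw [hk.2, hj1]
        rw [e0, hσ _ _ (hj1S i), hBd] at h1
        exact h1
      have e1 : ∏ i : {i : I' // P i}, fr i (c1 (j1 i)) = 1 := by
        apply Finset.prod_eq_one
        rintro ⟨i, hi⟩ _
        have : ∀ e : Fin J → C2, (if V i (G (c1 (j1 i)) e) then (1 : ℝ) else 0) = 1 := by
          intro e
          rw [if_pos]
          rw [hgood _ hi e _]
          exact hV i
        show av _ = 1
        simp only [this]
        exact av_const 1
      have e2 : ∏ i : {i : I' // ¬ P i}, (fun e : Fin J → C2 => if V i (G (c1 (j1 i)) e)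
          then (1 : ℝ) else 0) (fun t => c2 (j2 i t)) = 1 := by
        apply Finset.prod_eq_one
        intro i _
        dsimp only
        rw [if_pos]
        have := hV i
        convert this using 4 with t
        rw [← hj2, hσ _ _ (hj2S i t)]
      rw [e1, e2, one_mul]
    refine (av_mono hpt).trans ?_
    rw [av_mul_left, av_blocks hj2inj (fun (i : {i : I' // ¬ P i}) (e : Fin J → C2) =>
      if V i (G (c1 (j1 i)) e) then (1 : ℝ) else 0),
      ← Fintype.prod_subtype_mul_prod_subtype P (fun i => fr i (c1 (j1 i)))]
  -- conclude
  let E : (Fin M → C1) × (Fin M → C2) ≃ (Fin M → C1 × C2) :=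
    (Equiv.arrowProdEquivProdArrow (Fin M) (fun _ => C1) (fun _ => C2)).symm
  rw [← av_equiv E, av_prod]
  refine (av_mono fun c1 => inner c1).trans ?_
  rw [av_comp hj1inj (fun e : I' → C1 => ∏ i, fr i (e i)), av_pi]
  simp only [hfr]
  rw [← Finset.prod_fiberwise_of_maps_to (s := I) (t := I') (g := st Z N)
    (fun i hi => Finset.mem_image_of_mem _ hi), ← Finset.prod_coe_sort I']

end law
end NF


namespace NF

section dens
variable {A : Type*} [Fintype A] [MeasurableSpace A] [MeasurableSingletonClass A]
  {α β : A} {n r : ℕ} {C : Type*} [Fintype C]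

/-- weight of a word at position `s` -/
noncomputable def pw (ρ : ℤ → A → ℝ) (s : ℤ) (w : Fin n → A) : ℝ := ∏ t : Fin n, ρ (s + t) (w t)

lemma Loc_Zs (e : ℤ) : ∃ m, Loc m {x : ℤ → A | e ∈ Zs α β r x} := by
  refine ⟨e.natAbs + r + 1, fun x x' hx h => ⟨?_, fun u hu => ?_⟩⟩
  · rw [hx _ (by omega) (by omega)]; exact h.1
  · rw [hx _ (by omega) (by omega)]; exact h.2 u hu

lemma measurableSet_Zs (e : ℤ) : MeasurableSet {x : ℤ → A | e ∈ Zs α β r x} := by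
  obtain ⟨m, hm⟩ := Loc_Zs (A := A) (α := α) (β := β) (r := r) e
  exact hm.measurableSet

lemma measurable_word (s : ℤ) : Measurable (fun x : ℤ → A => word n x s) :=
  measurable_pi_lambda _ fun t => measurable_pi_apply _

lemma measurableSet_Ac (K : Code A α β n r C) (s : ℤ) : MeasurableSet {x : ℤ → A | s ∈ Ac K x} := by
  have h1 : MeasurableSet {x : ℤ → A | BS (Zs α β r x) n s} := by
    have : {x : ℤ → A | BS (Zs α β r x) n s} = ⋃ k : ℕ, ({x | s - k * n ∈ Zs α β r x} ∩
        ⋂ u : ℤ, ⋂ _ : s - k * n < u, ⋂ _ : u < s + n, {x | u ∈ Zs α β r x}ᶜ) := by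
      ext x
      simp [BS]
    rw [this]
    refine MeasurableSet.iUnion fun k => (measurableSet_Zs _).inter (MeasurableSet.iInter fun u =>
      MeasurableSet.iInter fun _ => MeasurableSet.iInter fun _ => (measurableSet_Zs _).compl)
  exact h1.inter (measurable_word s (MeasurableSet.of_discrete (s := {w | K.act w})))

lemma measurable_ov (s : ℤ) (w : Fin n → A) : Measurable (ov s w : (ℤ → A) → (ℤ → A)) := by
  refine measurable_pi_lambda _ fun i => ?_
  by_cases h : s ≤ i ∧ i < s + n
  · obtain ⟨t, rfl⟩ := in_block h
    simp only [ov_of]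
    exact measurable_const
  · simp only [ov_out h]
    exact measurable_pi_apply i

lemma measurable_rp (K : Code A α β n r C) (s : ℤ) (c : C) : Measurable (rp K s c) := by
  classical
  have : rp K s c = fun x => if s ∈ Ac K x then ov s (K.rep (word n x s) c) x else x := rfl
  rw [this]
  refine Measurable.ite (measurableSet_Ac K s) ?_ measurable_id
  refine measurable_pi_lambda _ fun i => ?_
  by_cases h : s ≤ i ∧ i < s + n
  · obtain ⟨t, rfl⟩ := in_block h
    simp only [ov_of]
    exact (measurable_of_finite (fun w => K.rep w c t)).comp (measurable_word s)
  · simp only [ov_out h]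
    exact measurable_pi_apply i

lemma measurable_PS (K : Code A α β n r C) (M : ℕ) (s : Fin M → ℤ) (c : Fin M → C) :
    Measurable (PS K M s c) := by
  induction M with
  | zero => exact measurable_id
  | succ M ih => exact (ih _ _).comp (measurable_rp K _ _)

lemma cyl_prod {ρ : ℤ → A → ℝ} (hρ : ∀ i, IsProbVec (ρ i)) {m : ℕ} {s : ℤ}
    (hm : s.natAbs + n ≤ m) (w : Fin n → A) (y : ℤ → A) :
    ∃ P : ENNReal, ∀ w : Fin n → A, ∏ i ∈ win m, ENNReal.ofReal (ρ i (ov s w y i)) =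
      P * ENNReal.ofReal (pw ρ s w) := by
  classical
  let em : Fin n ↪ ℤ := ⟨fun t => s + t, fun a b h => by simp at h; exact Fin.ext (by omega)⟩
  let bl : Finset ℤ := Finset.univ.map em
  have hbl : bl ⊆ win m := by
    intro i hi
    obtain ⟨t, -, ht⟩ := Finset.mem_map.1 hi
    have ht' : s + (t : ℤ) = i := ht
    have := t.2
    rw [mem_win]; omega
  refine ⟨∏ i ∈ win m \ bl, ENNReal.ofReal (ρ i (y i)), fun w => ?_⟩
  rw [← Finset.prod_sdiff hbl]
  congr 1
  · refine Finset.prod_congr rfl fun i hi => ?_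
    rw [ov_out]
    intro h
    obtain ⟨t, rfl⟩ := in_block h
    exact (Finset.mem_sdiff.1 hi).2 (Finset.mem_map.2 ⟨t, Finset.mem_univ _, rfl⟩)
  · rw [Finset.prod_map, pw, ENNReal.ofReal_prod_of_nonneg fun t _ => (hρ _).1 _]
    refine Finset.prod_congr rfl fun t _ => ?_
    show ENNReal.ofReal (ρ (s + t) (ov s w y (s + t))) = _
    rw [ov_of]

lemma swap_measure {μ : Measure (ℤ → A)} {ρ : ℤ → A → ℝ} (hρ : ∀ i, IsProbVec (ρ i))
    (h : IsProductMeasure μ ρ) (s : ℤ) (w w' : Fin n → A) :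
    ENNReal.ofReal (pw ρ s w') • (μ.restrict {x | word n x s = w}).map (ov s w') =
      ENNReal.ofReal (pw ρ s w) • μ.restrict {x | word n x s = w'} := by
  haveI := IsProbVec.nonempty (hρ 0)
  haveI := isProb_of_product h
  have mw : ∀ w : Fin n → A, MeasurableSet {x : ℤ → A | word n x s = w} := fun w =>
    measurable_word s (measurableSet_singleton w)
  haveI : IsFiniteMeasure (ENNReal.ofReal (pw ρ s w') • (μ.restrict {x | word n x s = w}).map (ov s w')) :=
    Measure.smul_finite _ ENNReal.ofReal_ne_top
  refine ext_of_cylinder (s.natAbs + n) fun m hm y => ?_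
  simp only [Measure.smul_apply, smul_eq_mul]
  rw [Measure.map_apply (measurable_ov s w') (measurable_cylinder _ _),
    Measure.restrict_apply (measurable_ov s w' (measurable_cylinder _ _)),
    Measure.restrict_apply (measurable_cylinder _ _)]
  have hin : ∀ t : Fin n, s + (t : ℤ) ∈ win m := by
    intro t; have := t.2; rw [mem_win]; omega
  by_cases hy : word n y s = w'
  · have e1 : ov s w' ⁻¹' _root_.cylinder (win m) y ∩ {x | word n x s = w} =
        _root_.cylinder (win m) (ov s w y) := by
      ext x
      simp only [mem_inter_iff, mem_preimage, _root_.cylinder, mem_ofPred_eq]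
      constructor
      · rintro ⟨h1, h2⟩ i hi
        by_cases hb : s ≤ i ∧ i < s + n
        · obtain ⟨t, rfl⟩ := in_block hb
          rw [ov_of, ← h2]; rfl
        · rw [ov_out hb, ← h1 i hi, ov_out hb]
      · intro h1
        constructor
        · intro i hi
          by_cases hb : s ≤ i ∧ i < s + n
          · obtain ⟨t, rfl⟩ := in_block hb
            rw [ov_of, ← hy]; rfl
          · rw [ov_out hb, h1 i hi, ov_out hb]
        · ext t
          show x (s + t) = w t
          rw [h1 _ (hin t), ov_of]
    have e2 : _root_.cylinder (win m) y ∩ {x | word n x s = w'} = _root_.cylinder (win m) y := by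
      apply inter_eq_left.2
      intro x hx
      simp only [mem_ofPred_eq, ← hy]
      ext t
      exact hx _ (hin t)
    obtain ⟨P, hP⟩ := cyl_prod hρ hm w y
    have e3 : ∏ i ∈ win m, ENNReal.ofReal (ρ i (y i)) = P * ENNReal.ofReal (pw ρ s w') := by
      rw [← hP w', ← hy, ov_word]
    rw [e1, e2, h, h, hP, e3]
    ring
  · have e1 : ov s w' ⁻¹' _root_.cylinder (win m) y ∩ {x | word n x s = w} = ∅ := by
      ext x
      simp only [mem_inter_iff, mem_preimage, _root_.cylinder, mem_ofPred_eq, mem_empty_iff_false,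
        iff_false, not_and]
      intro h1 _
      apply hy
      ext t
      show y (s + t) = w' t
      rw [← h1 _ (hin t), ov_of]
    have e2 : _root_.cylinder (win m) y ∩ {x | word n x s = w'} = ∅ := by
      ext x
      simp only [mem_inter_iff, _root_.cylinder, mem_ofPred_eq, mem_empty_iff_false, iff_false, not_and]
      intro h1 h2
      apply hy
      rw [← h2]
      ext t
      exact (h1 _ (hin t)).symm
    rw [e1, e2]; simp

lemma swap_lintegral {μ : Measure (ℤ → A)} {ρ : ℤ → A → ℝ} (hρ : ∀ i, IsProbVec (ρ i))
    (h : IsProductMeasure μ ρ) (s : ℤ) {w w' : Fin n → A} (hw' : 0 < pw ρ s w') (hw : 0 ≤ pw ρ s w)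
    {g : (ℤ → A) → ENNReal} (hg : Measurable g) :
    ∫⁻ x in {x | word n x s = w}, g (ov s w' x) ∂μ =
      ENNReal.ofReal (pw ρ s w / pw ρ s w') * ∫⁻ x in {x | word n x s = w'}, g x ∂μ := by
  have h1 := congrArg (fun ν => ∫⁻ x, g x ∂ν) (swap_measure hρ h s w w')
  simp only [lintegral_smul_measure, smul_eq_mul] at h1
  rw [lintegral_map hg (measurable_ov s w')] at h1
  rw [ENNReal.ofReal_div_of_pos hw', ENNReal.mul_div_right_comm.symm, ← h1,
    mul_comm, ENNReal.mul_div_cancel_right]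
  · simpa using hw'
  · exact ENNReal.ofReal_ne_top

open Classical in
lemma Code.sum_swap {M : Type*} [AddCommMonoid M] (K : Code A α β n r C)
    (F : (Fin n → A) → (Fin n → A) → M) :
    ∑ w with K.act w, ∑ c, F w (K.rep w c) = ∑ w with K.act w, ∑ c, F (K.rep w c) w := by
  rw [← Finset.sum_product', ← Finset.sum_product']
  refine Finset.sum_nbij' (fun p => (K.rep p.1 p.2, K.sym p.1)) (fun p => (K.rep p.1 p.2, K.sym p.1))
    ?_ ?_ ?_ ?_ ?_
  · rintro ⟨w, c⟩ h
    simp only [Finset.mem_product, Finset.mem_filter, Finset.mem_univ, true_and, and_true] at h ⊢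
    exact K.act_rep _ _ h
  · rintro ⟨w, c⟩ h
    simp only [Finset.mem_product, Finset.mem_filter, Finset.mem_univ, true_and, and_true] at h ⊢
    exact K.act_rep _ _ h
  · rintro ⟨w, c⟩ h
    simp only [Finset.mem_product, Finset.mem_filter, Finset.mem_univ, true_and, and_true] at h ⊢
    rw [K.rep_rep _ _ _ h, K.rep_sym _ h, K.sym_rep _ _ h]
  · rintro ⟨w, c⟩ h
    simp only [Finset.mem_product, Finset.mem_filter, Finset.mem_univ, true_and, and_true] at h ⊢
    rw [K.rep_rep _ _ _ h, K.rep_sym _ h, K.sym_rep _ _ h]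
  · rintro ⟨w, c⟩ h
    simp only [Finset.mem_product, Finset.mem_filter, Finset.mem_univ, true_and, and_true] at h ⊢
    rw [K.rep_rep _ _ _ h, K.rep_sym _ h]

/-- density on words -/
noncomputable def fe (K : Code A α β n r C) (ρ : ℤ → A → ℝ) (s : ℤ) (w : Fin n → A) : ENNReal :=
  (Fintype.card C : ENNReal)⁻¹ * ∑ c, ENNReal.ofReal (pw ρ s (K.rep w c) / pw ρ s w)

open Classical in
/-- density factor at `s` -/
noncomputable def fs (K : Code A α β n r C) (ρ : ℤ → A → ℝ) (s : ℤ) (x : ℤ → A) : ENNReal :=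
  if s ∈ Ac K x then fe K ρ s (word n x s) else 1

lemma measurable_fs (K : Code A α β n r C) (ρ : ℤ → A → ℝ) (s : ℤ) : Measurable (fs K ρ s) := by
  classical
  have : fs K ρ s = fun x => if s ∈ Ac K x then fe K ρ s (word n x s) else 1 := rfl
  rw [this]
  refine Measurable.ite (measurableSet_Ac K s) ?_ measurable_const
  exact (measurable_of_finite (fe K ρ s)).comp (measurable_word s)

lemma fs_rp_ne (K : Code A α β n r C) (ρ : ℤ → A → ℝ) {s s' : ℤ} (hne : s' ≠ s) (c : C) (x : ℤ → A) :
    fs K ρ s' (rp K s c x) = fs K ρ s' x := by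
  classical
  unfold fs
  rw [Ac_rp]
  split_ifs with h
  · rw [word_rp_ne K c x h.1 hne]
  · rfl

lemma lintegral_words (μ : Measure (ℤ → A)) (s : ℤ) (g : (ℤ → A) → ENNReal) :
    ∫⁻ x, g x ∂μ = ∑ w : Fin n → A, ∫⁻ x in {x | word n x s = w}, g x ∂μ := by
  classical
  rw [← lintegral_biUnion_finset]
  · have : (⋃ w ∈ (Finset.univ : Finset (Fin n → A)), {x : ℤ → A | word n x s = w}) = univ := by
      ext x; simp
    rw [this, Measure.restrict_univ]
  · intro w _ w' _ hne
    rw [Function.onFun, Set.disjoint_left]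
    intro x hx hx'
    exact hne (hx.symm.trans hx')
  · intro w _
    exact measurable_word s (measurableSet_singleton w)

lemma lintegral_R {μ : Measure (ℤ → A)} {ρ : ℤ → A → ℝ} (hρ : ∀ i, IsProbVec (ρ i))
    (h : IsProductMeasure μ ρ) (hpos : ∀ i a, 0 < ρ i a) [Nonempty C]
    (K : Code A α β n r C) (s : ℤ) {g : (ℤ → A) → ENNReal} (hg : Measurable g) :
    ∫⁻ x, (Fintype.card C : ENNReal)⁻¹ * ∑ c, g (rp K s c x) ∂μ = ∫⁻ x, g x * fs K ρ s x ∂μ := by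
  classical
  set U : Set (ℤ → A) := {x | s ∈ Ac K x} with hU
  have hUm : MeasurableSet U := measurableSet_Ac K s
  have hpw : ∀ w : Fin n → A, 0 < pw ρ s w := fun w => Finset.prod_pos fun t _ => hpos _ _
  rw [← lintegral_add_compl _ hUm, ← lintegral_add_compl (fun x => g x * fs K ρ s x) hUm]
  congr 1
  swap
  · refine setLIntegral_congr_fun hUm.compl fun x hx => ?_
    have hx' : s ∉ Ac K x := hx
    simp only [fs, if_neg hx', rp, mul_one]
    simp only [Finset.sum_const, Finset.card_univ, nsmul_eq_mul]
    rw [← mul_assoc, ENNReal.inv_mul_cancel, one_mul]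
    · simp
    · simp
  set g' : (ℤ → A) → ENNReal := U.indicator g with hg'
  have hg'm : Measurable g' := hg.indicator hUm
  set Φ : (Fin n → A) → ENNReal := fun w => ∫⁻ x in {x | word n x s = w}, g' x ∂μ with hΦ
  have mw : ∀ w : Fin n → A, MeasurableSet {x : ℤ → A | word n x s = w} := fun w =>
    measurable_word s (measurableSet_singleton w)
  have L : ∀ c w, ∫⁻ x in {x | word n x s = w}, U.indicator (fun x => g (rp K s c x)) x ∂μ =
      if K.act w then ENNReal.ofReal (pw ρ s w / pw ρ s (K.rep w c)) * Φ (K.rep w c) else 0 := by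
    intro c w
    split_ifs with hw
    · rw [← swap_lintegral hρ h s (hpw _) (hpw _).le hg'm]
      refine setLIntegral_congr_fun (mw w) fun x hx => ?_
      have hx' : word n x s = w := hx
      by_cases hxU : x ∈ U
      · have e : rp K s c x = ov s (K.rep w c) x := by
          unfold rp; rw [if_pos (show s ∈ Ac K x from hxU), hx']
        have : ov s (K.rep w c) x ∈ U := by
          rw [← e]; show s ∈ Ac K _; rw [Ac_rp]; exact hxU
        rw [indicator_of_mem hxU, e, hg', indicator_of_mem this]
      · have : ov s (K.rep w c) x ∉ U := by
          intro hcon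
          apply hxU
          have hcon' : s ∈ Ac K (ov s (K.rep w c) x) := hcon
          have e : rp K s (K.sym w) (ov s (K.rep w c) x) = x := by
            unfold rp
            rw [if_pos hcon', word_ov, K.rep_rep _ _ _ hw, K.rep_sym _ hw, ov_ov, ← hx', ov_word]
          show s ∈ Ac K x
          rw [← e, Ac_rp]; exact hcon'
        rw [indicator_of_notMem hxU, hg', indicator_of_notMem this]
    · rw [setLIntegral_congr_fun (mw w) (g := fun _ => 0)]
      · simp
      · intro x hx
        have hx' : word n x s = w := hx
        apply indicator_of_notMem
        intro hxU
        apply hw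
        rw [← hx']
        exact (show s ∈ Ac K x from hxU).2
  have Rr : ∀ w, ∫⁻ x in {x | word n x s = w}, U.indicator (fun x => g x * fs K ρ s x) x ∂μ =
      if K.act w then fe K ρ s w * Φ w else 0 := by
    intro w
    split_ifs with hw
    · rw [← lintegral_const_mul _ hg'm]
      refine setLIntegral_congr_fun (mw w) fun x hx => ?_
      have hx' : word n x s = w := hx
      by_cases hxU : x ∈ U
      · have hxU' : s ∈ Ac K x := hxU
        simp only [hg', indicator_of_mem hxU, fs, if_pos hxU', hx']
        rw [mul_comm]
      · simp [hg', hxU]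
    · rw [setLIntegral_congr_fun (mw w) (g := fun _ => 0)]
      · simp
      · intro x hx
        have hx' : word n x s = w := hx
        apply indicator_of_notMem
        intro hxU
        apply hw
        rw [← hx']
        exact (show s ∈ Ac K x from hxU).2
  have mgr : ∀ c, Measurable (fun x => g (rp K s c x)) := fun c => hg.comp (measurable_rp K s c)
  rw [lintegral_const_mul _ (Finset.measurable_sum _ fun c _ => mgr c),
    lintegral_finsetSum _ fun c _ => mgr c]
  have s1 : ∀ c, ∫⁻ x in U, g (rp K s c x) ∂μ = ∑ w with K.act w,
      ENNReal.ofReal (pw ρ s w / pw ρ s (K.rep w c)) * Φ (K.rep w c) := by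
    intro c
    rw [← lintegral_indicator hUm, lintegral_words (n := n) μ s, Finset.sum_filter]
    exact Finset.sum_congr rfl fun w _ => L c w
  have s2 : ∫⁻ x in U, g x * fs K ρ s x ∂μ = ∑ w with K.act w, fe K ρ s w * Φ w := by
    rw [← lintegral_indicator hUm, lintegral_words (n := n) μ s, Finset.sum_filter]
    exact Finset.sum_congr rfl fun w _ => Rr w
  simp only [s1]
  rw [s2, Finset.sum_comm, K.sum_swap (fun w w' => ENNReal.ofReal (pw ρ s w / pw ρ s w') * Φ w'),
    Finset.mul_sum]
  refine Finset.sum_congr rfl fun w _ => ?_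
  unfold fe
  rw [← Finset.sum_mul, mul_assoc]

end dens
end NF


namespace NF

section dens2
variable {A : Type*} [Fintype A] [MeasurableSpace A] [MeasurableSingletonClass A]
  {α β : A} {n r : ℕ} {C : Type*} [Fintype C]

/-- averaging operator -/
noncomputable def Tm (K : Code A α β n r C) (g : (ℤ → A) → ENNReal) :
    (M : ℕ) → (Fin M → ℤ) → (ℤ → A) → ENNReal
  | 0, _, x => g x
  | M + 1, s, x => (Fintype.card C : ENNReal)⁻¹ * ∑ c, Tm K g M (Fin.tail s) (rp K (s 0) c x)

lemma measurable_Tm (K : Code A α β n r C) {g : (ℤ → A) → ENNReal} (hg : Measurable g) (M : ℕ)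
    (s : Fin M → ℤ) : Measurable (Tm K g M s) := by
  induction M with
  | zero => exact hg
  | succ M ih =>
    show Measurable (fun x => (Fintype.card C : ENNReal)⁻¹ * ∑ c, Tm K g M (Fin.tail s) (rp K (s 0) c x))
    exact (Finset.measurable_sum _ fun c _ => (ih _).comp (measurable_rp K _ c)).const_mul _

lemma Tm_eq (K : Code A α β n r C) (g : (ℤ → A) → ENNReal) (M : ℕ) (s : Fin M → ℤ) (x : ℤ → A) :
    Tm K g M s x = ((Fintype.card C : ENNReal)⁻¹) ^ M * ∑ c : Fin M → C, g (PS K M s c x) := by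
  induction M generalizing x with
  | zero => simp [Tm, PS]
  | succ M ih =>
    rw [Tm, pow_succ', mul_assoc]
    congr 1
    rw [← (Fin.consEquiv fun _ => C).sum_comp, Fintype.sum_prod_type]
    rw [Finset.mul_sum]
    refine Finset.sum_congr rfl fun a _ => ?_
    rw [ih]
    congr 1

lemma lintegral_Tm {μ : Measure (ℤ → A)} {ρ : ℤ → A → ℝ} (hρ : ∀ i, IsProbVec (ρ i))
    (h : IsProductMeasure μ ρ) (hpos : ∀ i a, 0 < ρ i a) [Nonempty C]
    (K : Code A α β n r C) {g : (ℤ → A) → ENNReal} (hg : Measurable g) (M : ℕ)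
    (s : Fin M → ℤ) (hs : Function.Injective s) {w : (ℤ → A) → ENNReal} (hw : Measurable w)
    (hwi : ∀ j c x, w (rp K (s j) c x) = w x) :
    ∫⁻ x, Tm K g M s x * w x ∂μ = ∫⁻ x, g x * w x * ∏ j, fs K ρ (s j) x ∂μ := by
  induction M generalizing w with
  | zero => simp [Tm]
  | succ M ih =>
    have e1 : ∀ x, Tm K g (M+1) s x * w x = (Fintype.card C : ENNReal)⁻¹ *
        ∑ c, (fun y => Tm K g M (Fin.tail s) y * w y) (rp K (s 0) c x) := by
      intro x
      rw [Tm, mul_assoc, Finset.sum_mul]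
      simp only [hwi]
    rw [lintegral_congr e1, lintegral_R hρ h hpos K (s 0) (g := fun y => Tm K g M (Fin.tail s) y * w y)
      ((measurable_Tm K hg M _).mul hw)]
    have e2 : ∀ x, Tm K g M (Fin.tail s) x * w x * fs K ρ (s 0) x =
      Tm K g M (Fin.tail s) x * (w * fs K ρ (s 0)) x := fun x => mul_assoc _ _ _
    rw [lintegral_congr e2, ih (Fin.tail s) (fun a b hab => Fin.succ_injective _ (hs hab)) (hw.mul (measurable_fs K ρ (s 0)))]
    · refine lintegral_congr fun x => ?_
      rw [Fin.prod_univ_succ]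
      simp only [Fin.tail, Pi.mul_apply]
      ring
    · intro j c x
      simp only [Pi.mul_apply]
      rw [show Fin.tail s j = s j.succ from rfl, hwi, fs_rp_ne]
      intro hcon
      exact Fin.succ_ne_zero j (hs hcon).symm

lemma Tm_prod_le (K : Code A α β n r C) (u : ℤ → (ℤ → A) → ENNReal) (b : ℤ → ENNReal)
    (hu : ∀ s s' c x, s' ≠ s → u s' (rp K s c x) = u s' x)
    (hb : ∀ s x, (Fintype.card C : ENNReal)⁻¹ * ∑ c, u s (rp K s c x) ≤ b s) (M : ℕ)
    (s : Fin M → ℤ) (hs : Function.Injective s) (w : (ℤ → A) → ENNReal)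
    (hwi : ∀ j c x, w (rp K (s j) c x) = w x) (x : ℤ → A) :
    Tm K (fun y => w y * ∏ j, u (s j) y) M s x ≤ w x * ∏ j, b (s j) := by
  induction M generalizing w x with
  | zero => simp [Tm]
  | succ M ih =>
    have e1 : (fun y => w y * ∏ j, u (s j) y) = fun y => (w y * u (s 0) y) * ∏ j, u (Fin.tail s j) y := by
      ext y
      rw [Fin.prod_univ_succ, mul_assoc]; rfl
    rw [Tm, e1]
    have e2 : ∀ c, Tm K (fun y => (w y * u (s 0) y) * ∏ j, u (Fin.tail s j) y) M (Fin.tail s)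
        (rp K (s 0) c x) ≤ w x * u (s 0) (rp K (s 0) c x) * ∏ j, b (Fin.tail s j) := by
      intro c
      have := ih (Fin.tail s) (fun a b hab => Fin.succ_injective _ (hs hab))
        (fun y => w y * u (s 0) y) (fun j c y => by
          rw [show Fin.tail s j = s j.succ from rfl, hwi, hu]
          intro hcon
          exact Fin.succ_ne_zero j (hs hcon).symm) (rp K (s 0) c x)
      rwa [hwi] at this
    calc _ ≤ (Fintype.card C : ENNReal)⁻¹ * ∑ c, w x * u (s 0) (rp K (s 0) c x) * ∏ j, b (Fin.tail s j) := by
          gcongr with c _; exact e2 c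
      _ = w x * (((Fintype.card C : ENNReal)⁻¹ * ∑ c, u (s 0) (rp K (s 0) c x)) * ∏ j, b (Fin.tail s j)) := by
          rw [← Finset.sum_mul, ← Finset.mul_sum]; ring
      _ ≤ w x * (b (s 0) * ∏ j, b (Fin.tail s j)) := by gcongr; exact hb _ _
      _ = _ := by rw [Fin.prod_univ_succ]; rfl

/-- the mean inequality facts -/
lemma mean_facts [Nonempty C] (a : C → ℝ) {m D : ℝ} (hm : 0 < m) (ha : ∀ c, m ≤ a c)
    (hD : ∀ c c', |a c - a c'| ≤ D) :
    (Fintype.card C : ℝ)⁻¹ * ∑ c, ((Fintype.card C : ℝ)⁻¹ * ∑ c', a c') / a c ≤ 1 + D ^ 2 / m ^ 2 ∧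
    (Fintype.card C : ℝ)⁻¹ * ∑ c, (a c / ((Fintype.card C : ℝ)⁻¹ * ∑ c', a c')) ^ 2 ≤ 1 + D ^ 2 / m ^ 2 := by
  set κ : ℝ := ((Fintype.card C : ℕ) : ℝ) with hκ
  have hκ0 : 0 < κ := by rw [hκ]; exact_mod_cast Fintype.card_pos
  set b := κ⁻¹ * ∑ c', a c' with hb
  have hsum : ∑ c, a c = κ * b := by rw [hb]; field_simp
  have hcard : ∑ _c : C, (1:ℝ) = κ := by simp [hκ]
  have hbm : m ≤ b := by
    have : κ * m ≤ κ * b := by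
      rw [← hsum, ← hcard, Finset.sum_mul]
      exact Finset.sum_le_sum fun c _ => by simpa using ha c
    exact le_of_mul_le_mul_left this hκ0
  have hb0 : 0 < b := hm.trans_le hbm
  have ha0 : ∀ c, 0 < a c := fun c => hm.trans_le (ha c)
  have hDb : ∀ c, (a c - b) ^ 2 ≤ D ^ 2 := by
    intro c
    rw [sq_le_sq]
    refine le_trans ?_ (le_abs_self D)
    have : κ * (a c - b) = ∑ c', (a c - a c') := by
      rw [Finset.sum_sub_distrib, hsum]; simp [hκ]; ring
    have h2 : κ * |a c - b| ≤ κ * D := by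
      rw [← abs_of_pos hκ0, ← abs_mul, this, abs_of_pos hκ0]
      refine (Finset.abs_sum_le_sum_abs _ _).trans ?_
      rw [← hcard, Finset.sum_mul]
      exact Finset.sum_le_sum fun c' _ => by simpa using hD c c'
    exact le_of_mul_le_mul_left h2 hκ0
  have hz : ∑ c, (b - a c) = 0 := by
    rw [Finset.sum_sub_distrib, hsum]; simp [hκ]
  constructor
  · have : ∀ c, b / a c ≤ 1 + D ^ 2 / m ^ 2 + (b - a c) * b⁻¹ := by
      intro c
      have e : b / a c = 1 + (a c - b) ^ 2 / (a c * b) + (b - a c) * b⁻¹ := by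
        have := (ha0 c).ne'
        field_simp
        ring
      rw [e]
      have := div_le_div₀ (sq_nonneg D) (hDb c) (pow_pos hm 2)
        (show m ^ 2 ≤ a c * b by rw [sq]; exact mul_le_mul (ha c) hbm hm.le (ha0 c).le)
      linarith
    calc κ⁻¹ * ∑ c, b / a c ≤ κ⁻¹ * ∑ c, (1 + D ^ 2 / m ^ 2 + (b - a c) * b⁻¹) := by
          gcongr with c _; exact this c
      _ = _ := by
        rw [Finset.sum_add_distrib, ← Finset.sum_mul, hz, zero_mul, add_zero]
        simp [← hκ]; field_simp
  · have : ∀ c, (a c / b) ^ 2 ≤ 1 + D ^ 2 / m ^ 2 + (b - a c) * (-2 * b⁻¹) := by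
      intro c
      have e : (a c / b) ^ 2 = 1 + (a c - b) ^ 2 / b ^ 2 + (b - a c) * (-2 * b⁻¹) := by
        field_simp
        ring
      rw [e]
      have := div_le_div₀ (sq_nonneg D) (hDb c) (pow_pos hm 2) (pow_le_pow_left₀ hm.le hbm 2)
      linarith
    calc κ⁻¹ * ∑ c, (a c / b) ^ 2 ≤ κ⁻¹ * ∑ c, (1 + D ^ 2 / m ^ 2 + (b - a c) * (-2 * b⁻¹)) := by
          gcongr with c _; exact this c
      _ = _ := by
        rw [Finset.sum_add_distrib, ← Finset.sum_mul, hz, zero_mul, add_zero]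
        simp [← hκ]; field_simp

lemma abs_prod_sub_le {ι : Type*} (T : Finset ι) (f g : ι → ℝ) (hf : ∀ i ∈ T, 0 ≤ f i ∧ f i ≤ 1)
    (hg : ∀ i ∈ T, 0 ≤ g i ∧ g i ≤ 1) : |∏ i ∈ T, f i - ∏ i ∈ T, g i| ≤ ∑ i ∈ T, |f i - g i| := by
  classical
  induction T using Finset.induction_on with
  | empty => simp
  | insert i T hi ih =>
    rw [Finset.prod_insert hi, Finset.prod_insert hi, Finset.sum_insert hi]
    have ih' := ih (fun j hj => hf j (Finset.mem_insert_of_mem hj)) (fun j hj => hg j (Finset.mem_insert_of_mem hj))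
    have hP0 : 0 ≤ ∏ j ∈ T, f j := Finset.prod_nonneg fun j hj => (hf j (Finset.mem_insert_of_mem hj)).1
    have hP1 : ∏ j ∈ T, f j ≤ 1 := Finset.prod_le_one (fun j hj => (hf j (Finset.mem_insert_of_mem hj)).1)
      (fun j hj => (hf j (Finset.mem_insert_of_mem hj)).2)
    have hgi := hg i (Finset.mem_insert_self _ _)
    have e : f i * ∏ j ∈ T, f j - g i * ∏ j ∈ T, g j =
        (f i - g i) * ∏ j ∈ T, f j + g i * (∏ j ∈ T, f j - ∏ j ∈ T, g j) := by ring
    rw [e]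
    refine (abs_add_le _ _).trans ?_
    rw [abs_mul, abs_mul, abs_of_nonneg hP0, abs_of_nonneg hgi.1]
    refine add_le_add ?_ ?_
    · exact mul_le_of_le_one_right (abs_nonneg _) hP1
    · exact (mul_le_of_le_one_left (abs_nonneg _) hgi.2).trans ih'

noncomputable def vv (ρ : ℤ → A → ℝ) (n : ℕ) (s : ℤ) : ℝ :=
  ∑ u ∈ Finset.range n, ∑ a, |ρ (s + u) a - ρ (s + u + 1) a|

lemma rho_le_one {q : A → ℝ} (hq : IsProbVec q) (a : A) : q a ≤ 1 := by
  rw [← hq.2]; exact Finset.single_le_sum (fun b _ => hq.1 b) (Finset.mem_univ a)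

lemma diff_le_vv (ρ : ℤ → A → ℝ) (n : ℕ) (s : ℤ) {t : ℕ} (ht : t ≤ n) (a : A) :
    |ρ (s + t) a - ρ s a| ≤ vv ρ n s := by
  have h1 : |ρ (s + t) a - ρ s a| ≤ vv ρ t s := by
    clear ht
    induction t with
    | zero => simp [vv]
    | succ t ih =>
      rw [vv, Finset.sum_range_succ]
      have h2 : |ρ (s + t) a - ρ (s + t + 1) a| ≤ ∑ a, |ρ (s + t) a - ρ (s + t + 1) a| :=
        Finset.single_le_sum (f := fun a => |ρ (s + t) a - ρ (s + t + 1) a|) (fun b _ => abs_nonneg _)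
          (Finset.mem_univ a)
      have h3 : ρ (s + (t+1 : ℕ)) a - ρ s a = (ρ (s + t) a - ρ s a) - (ρ (s + t) a - ρ (s + t + 1) a) := by
        push_cast; rw [← add_assoc]; ring
      rw [h3]
      refine (abs_sub _ _).trans (add_le_add ih h2)
  refine h1.trans ?_
  unfold vv
  exact Finset.sum_le_sum_of_subset_of_nonneg (by simpa using ht)
    (fun _ _ _ => Finset.sum_nonneg fun _ _ => abs_nonneg _)

lemma summable_vv (ρ : ℤ → A → ℝ) (hsum : Summable (fun i : ℤ => ∑ a, (ρ i a - ρ (i+1) a)^2)) (n : ℕ) :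
    Summable (fun s => vv ρ n s ^ 2) := by
  have h1 : Summable (fun s : ℤ => (n * Fintype.card A : ℝ) * ∑ u ∈ Finset.range n,
      ∑ a, (ρ (s + u) a - ρ (s + u + 1) a) ^ 2) := by
    apply Summable.mul_left
    apply summable_sum
    intro u _
    exact hsum.comp_injective (i := fun s : ℤ => s + u) (fun a b h => by simpa using h)
  refine Summable.of_nonneg_of_le (fun s => sq_nonneg _) (fun s => ?_) h1
  unfold vv
  have := sq_sum_le_card_mul_sum_sq (s := Finset.range n)
    (f := fun u : ℕ => ∑ a, |ρ (s + u) a - ρ (s + u + 1) a|)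
  refine this.trans ?_
  rw [Finset.card_range, mul_assoc]
  refine mul_le_mul_of_nonneg_left ?_ (Nat.cast_nonneg _)
  rw [Finset.mul_sum]
  refine Finset.sum_le_sum fun u _ => ?_
  have := sq_sum_le_card_mul_sum_sq (s := Finset.univ) (f := fun a : A => |ρ (s + u) a - ρ (s + u + 1) a|)
  simpa using this

lemma pw_close (K : Code A α β n r C) {ρ : ℤ → A → ℝ} (hρ : ∀ i, IsProbVec (ρ i)) (s : ℤ)
    (w : Fin n → A) (hw : K.act w) (c c' : C) :
    |pw ρ s (K.rep w c) - pw ρ s (K.rep w c')| ≤ 2 * n * vv ρ n s := by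
  have h1 : ∀ w' : Fin n → A, |pw ρ s w' - ∏ t, ρ s (w' t)| ≤ n * vv ρ n s := by
    intro w'
    refine (abs_prod_sub_le _ _ _ (fun t _ => ⟨(hρ _).1 _, rho_le_one (hρ _) _⟩)
      (fun t _ => ⟨(hρ _).1 _, rho_le_one (hρ _) _⟩)).trans ?_
    calc _ ≤ ∑ t : Fin n, vv ρ n s := Finset.sum_le_sum fun t _ => diff_le_vv ρ n s t.2.le _
      _ = _ := by simp
  have h2 := h1 (K.rep w c)
  have h3 := h1 (K.rep w c')
  rw [K.cnt w c hw (ρ s)] at h2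
  rw [K.cnt w c' hw (ρ s)] at h3
  rw [abs_le] at *
  constructor <;> linarith

lemma pw_lower {ρ : ℤ → A → ℝ} {δ : ℝ} (hδ : 0 < δ) (h : ∀ i a, δ < ρ i a) (s : ℤ) (w : Fin n → A) :
    δ ^ n ≤ pw ρ s w := by
  unfold pw
  calc δ ^ n = ∏ t : Fin n, δ := by simp
    _ ≤ _ := Finset.prod_le_prod (fun _ _ => hδ.le) (fun _ _ => (h _ _).le)

end dens2
end NF


namespace NF

section dens3
variable {A : Type*} [Fintype A] [MeasurableSpace A] [MeasurableSingletonClass A]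
  {α β : A} {n r : ℕ} {C : Type*} [Fintype C]

lemma fe_eq [Nonempty C] (K : Code A α β n r C) {ρ : ℤ → A → ℝ} (hpos : ∀ i a, 0 < ρ i a) (s : ℤ)
    (w : Fin n → A) : fe K ρ s w =
      ENNReal.ofReal (((Fintype.card C : ℝ)⁻¹ * ∑ c, pw ρ s (K.rep w c)) / pw ρ s w) := by
  have hpw : ∀ w : Fin n → A, 0 < pw ρ s w := fun w => Finset.prod_pos fun t _ => hpos _ _
  have hκ0 : (0:ℝ) < Fintype.card C := by exact_mod_cast Fintype.card_pos
  unfold fe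
  rw [← ENNReal.ofReal_sum_of_nonneg (fun c _ => (div_pos (hpw _) (hpw _)).le), ← Finset.sum_div, mul_div_assoc,
    ENNReal.ofReal_mul (by positivity), ENNReal.ofReal_inv_of_pos hκ0]
  simp

lemma fs_bounds [Nonempty C] (K : Code A α β n r C) {ρ : ℤ → A → ℝ} (hρ : ∀ i, IsProbVec (ρ i)) {δ : ℝ}
    (hδ : 0 < δ) (hd : ∀ i a, δ < ρ i a) (s : ℤ) (x : ℤ → A) :
    (Fintype.card C : ENNReal)⁻¹ * ∑ c, fs K ρ s (rp K s c x) ≤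
      ENNReal.ofReal (1 + (2 * n * vv ρ n s) ^ 2 / (δ ^ n) ^ 2) ∧
    (Fintype.card C : ENNReal)⁻¹ * ∑ c, ((fs K ρ s (rp K s c x))⁻¹) ^ 2 ≤
      ENNReal.ofReal (1 + (2 * n * vv ρ n s) ^ 2 / (δ ^ n) ^ 2) := by
  classical
  have hpos : ∀ i a, 0 < ρ i a := fun i a => hδ.trans (hd i a)
  have hpw : ∀ w : Fin n → A, 0 < pw ρ s w := fun w => Finset.prod_pos fun t _ => hpos _ _
  have hκ0 : (0:ℝ) < Fintype.card C := by exact_mod_cast Fintype.card_pos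
  have hc1 : (Fintype.card C : ENNReal)⁻¹ * Fintype.card C = 1 := by
    rw [ENNReal.inv_mul_cancel] <;> simp
  by_cases hx : s ∈ Ac K x
  · set w := word n x s with hw
    have hact : K.act w := hx.2
    have e : ∀ c, fs K ρ s (rp K s c x) = ENNReal.ofReal
        (((Fintype.card C : ℝ)⁻¹ * ∑ c', pw ρ s (K.rep w c')) / pw ρ s (K.rep w c)) := by
      intro c
      unfold fs
      rw [Ac_rp, if_pos hx, word_rp_self K c x hx, fe_eq K hpos]
      simp only [K.rep_rep _ _ _ hact, ← hw]
    have key := mean_facts (fun c => pw ρ s (K.rep w c)) (pow_pos hδ n)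
      (fun c => pw_lower hδ hd s _) (fun c c' => pw_close K hρ s w hact c c')
    set b := (Fintype.card C : ℝ)⁻¹ * ∑ c', pw ρ s (K.rep w c') with hb
    have hb0 : 0 < b := mul_pos (inv_pos.2 hκ0) (Finset.sum_pos (fun c _ => hpw _) Finset.univ_nonempty)
    have hcr : (Fintype.card C : ENNReal)⁻¹ = ENNReal.ofReal ((Fintype.card C : ℝ)⁻¹) := by
      rw [ENNReal.ofReal_inv_of_pos hκ0]; simp
    have hin : (0:ℝ) ≤ (Fintype.card C : ℝ)⁻¹ := by positivity
    constructor
    · simp only [e]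
      rw [hcr, ← ENNReal.ofReal_sum_of_nonneg (fun c _ => (div_pos hb0 (hpw _)).le), ← ENNReal.ofReal_mul hin]
      exact ENNReal.ofReal_le_ofReal key.1
    · have e' : ∀ c, ((fs K ρ s (rp K s c x))⁻¹) ^ 2 = ENNReal.ofReal ((pw ρ s (K.rep w c) / b) ^ 2) := by
        intro c
        rw [e, ← ENNReal.ofReal_inv_of_pos (div_pos hb0 (hpw _)), ← ENNReal.ofReal_pow (by
          have := div_pos hb0 (hpw (K.rep w c)); positivity), inv_div]
      simp only [e']
      rw [hcr, ← ENNReal.ofReal_sum_of_nonneg (fun c _ => sq_nonneg _), ← ENNReal.ofReal_mul hin]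
      exact ENNReal.ofReal_le_ofReal key.2
  · have e : ∀ c, fs K ρ s (rp K s c x) = 1 := by
      intro c; unfold fs; rw [Ac_rp, if_neg hx]
    simp only [e, inv_one, one_pow, Finset.sum_const, Finset.card_univ, nsmul_eq_mul, mul_one, hc1]
    have : (1 : ENNReal) ≤ ENNReal.ofReal (1 + (2 * n * vv ρ n s) ^ 2 / (δ ^ n) ^ 2) := by
      rw [ENNReal.one_le_ofReal]
      have : 0 ≤ (2 * n * vv ρ n s) ^ 2 / (δ ^ n) ^ 2 := by positivity
      linarith
    exact ⟨this, this⟩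

lemma prod_exp_le {x : ℤ → ℝ} (hx : ∀ s, 0 ≤ x s) (hs : Summable x) (M : ℕ) (s : Fin M → ℤ)
    (hinj : Function.Injective s) :
    ∏ j, ENNReal.ofReal (1 + x (s j)) ≤ ENNReal.ofReal (Real.exp (∑' i, x i)) := by
  rw [← ENNReal.ofReal_prod_of_nonneg (fun j _ => by have := hx (s j); linarith)]
  apply ENNReal.ofReal_le_ofReal
  calc ∏ j, (1 + x (s j)) ≤ ∏ j, Real.exp (x (s j)) :=
        Finset.prod_le_prod (fun j _ => by have := hx (s j); linarith) (fun j _ => by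
          have := Real.add_one_le_exp (x (s j)); linarith)
    _ = Real.exp (∑ j, x (s j)) := (Real.exp_sum _ _).symm
    _ ≤ _ := by
      apply Real.exp_le_exp.2
      have := hs.sum_le_tsum (Finset.univ.map ⟨s, hinj⟩) (fun i _ => hx i)
      rwa [Finset.sum_map] at this

theorem density {μ : Measure (ℤ → A)} {ρ : ℤ → A → ℝ} (hρ : ∀ i, IsProbVec (ρ i))
    (h : IsProductMeasure μ ρ) {δ : ℝ} (hδ : 0 < δ) (hd : ∀ i a, δ < ρ i a)
    (hsum : Summable (fun i : ℤ => ∑ a, (ρ i a - ρ (i+1) a)^2)) [Nonempty C] (K : Code A α β n r C) :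
    ∃ Kc : ENNReal, Kc ≠ ⊤ ∧ ∀ M (s : Fin M → ℤ), Function.Injective s →
      ∃ W W' : (ℤ → A) → ENNReal, Measurable W ∧ Measurable W' ∧ (∀ x, W' x * W x = 1) ∧
        ∫⁻ x, W x * W x ∂μ ≤ Kc ∧ ∫⁻ x, W' x ∂μ ≤ Kc ∧
        ∀ g : (ℤ → A) → ENNReal, Measurable g → ∫⁻ x, Tm K g M s x ∂μ = ∫⁻ x, g x * W x ∂μ := by
  haveI := IsProbVec.nonempty (hρ 0)
  haveI := isProb_of_product h
  have hpos : ∀ i a, 0 < ρ i a := fun i a => hδ.trans (hd i a)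
  have hκ0 : (0:ℝ) < Fintype.card C := by exact_mod_cast Fintype.card_pos
  set x : ℤ → ℝ := fun s => (2 * n * vv ρ n s) ^ 2 / (δ ^ n) ^ 2 with hx
  have hx0 : ∀ s, 0 ≤ x s := fun s => by positivity
  have hxs : Summable x := by
    have := (summable_vv ρ hsum n).mul_left ((2 * n) ^ 2 / (δ ^ n) ^ 2 : ℝ)
    refine this.congr fun s => ?_
    rw [hx]; ring
  have hfs : ∀ s y, 0 < fs K ρ s y ∧ fs K ρ s y ≠ ⊤ := by
    intro s y
    have hpw : ∀ w : Fin n → A, 0 < pw ρ s w := fun w => Finset.prod_pos fun t _ => hpos _ _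
    unfold fs
    split_ifs
    · rw [fe_eq K hpos]
      refine ⟨ENNReal.ofReal_pos.2 (div_pos (mul_pos (inv_pos.2 hκ0)
        (Finset.sum_pos (fun c _ => hpw _) Finset.univ_nonempty)) (hpw _)), ENNReal.ofReal_ne_top⟩
    · simp
  refine ⟨ENNReal.ofReal (Real.exp (∑' i, x i)), ENNReal.ofReal_ne_top, fun M s hs => ?_⟩
  have mW : Measurable (fun y => ∏ j, fs K ρ (s j) y) :=
    Finset.measurable_prod _ fun j _ => measurable_fs K ρ (s j)
  have mW' : Measurable (fun y => ∏ j, (fs K ρ (s j) y)⁻¹) :=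
    Finset.measurable_prod _ fun j _ => (measurable_fs K ρ (s j)).inv
  have hWW : ∀ y, (∏ j, (fs K ρ (s j) y)⁻¹) * ∏ j, fs K ρ (s j) y = 1 := by
    intro y
    rw [← Finset.prod_mul_distrib]
    exact Finset.prod_eq_one fun j _ => ENNReal.inv_mul_cancel (hfs _ _).1.ne' (hfs _ _).2
  have main : ∀ g : (ℤ → A) → ENNReal, Measurable g →
      ∫⁻ y, Tm K g M s y ∂μ = ∫⁻ y, g y * ∏ j, fs K ρ (s j) y ∂μ := by
    intro g hg
    have := lintegral_Tm hρ h hpos K hg M s hs (w := fun _ => 1) measurable_const (fun _ _ _ => rfl)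
    simpa using this
  have bd : ∀ u : ℤ → (ℤ → A) → ENNReal, (∀ s s' c x, s' ≠ s → u s' (rp K s c x) = u s' x) →
      (∀ s y, (Fintype.card C : ENNReal)⁻¹ * ∑ c, u s (rp K s c y) ≤ ENNReal.ofReal (1 + x s)) →
      ∫⁻ y, Tm K (fun y => ∏ j, u (s j) y) M s y ∂μ ≤ ENNReal.ofReal (Real.exp (∑' i, x i)) := by
    intro u hu hb
    calc _ ≤ ∫⁻ y, ENNReal.ofReal (Real.exp (∑' i, x i)) ∂μ := by
          refine lintegral_mono fun y => ?_
          have := Tm_prod_le K u (fun s => ENNReal.ofReal (1 + x s)) hu hb M s hs (fun _ => 1)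
            (fun _ _ _ => rfl) y
          simp only [one_mul] at this
          exact this.trans (prod_exp_le hx0 hxs M s hs)
      _ = _ := by simp
  refine ⟨_, _, mW, mW', hWW, ?_, ?_, main⟩
  · rw [← main _ mW]
    exact bd (fs K ρ) (fun s s' c y hne => fs_rp_ne K ρ hne c y) fun s y => (fs_bounds K hρ hδ hd s y).1
  · have e : ∀ y, ∏ j, (fs K ρ (s j) y)⁻¹ = (∏ j, ((fs K ρ (s j) y)⁻¹) ^ 2) * ∏ j, fs K ρ (s j) y := by
      intro y
      rw [Finset.prod_pow, sq, mul_assoc, hWW, mul_one]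
    rw [lintegral_congr e, ← main]
    · exact bd (fun s y => ((fs K ρ s y)⁻¹) ^ 2) (fun s s' c y hne => by
        simp only [fs_rp_ne K ρ hne c y]) fun s y => (fs_bounds K hρ hδ hd s y).2
    · exact Finset.measurable_prod _ fun j _ => (measurable_fs K ρ (s j)).inv.pow_const 2

end dens3
end NF


namespace NF

section loccon
variable {A : Type*}

/-- filter of local agreement -/
def agF (x : ℤ → A) : Filter (ℤ → A) := ⨅ m : ℕ, 𝓟 {x' | Ag m x x'}

lemma ev_agF {x : ℤ → A} {P : (ℤ → A) → Prop} :
    (∀ᶠ x' in agF x, P x') ↔ ∃ m, ∀ x', Ag m x x' → P x' := by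
  unfold agF Filter.Eventually
  rw [mem_iInf_of_directed]
  · simp only [mem_principal]; rfl
  · intro a b
    refine ⟨max a b, ?_, ?_⟩
    · simp only [ge_iff_le, le_principal_iff, mem_principal]
      intro x' h; exact Ag.mono (le_max_left _ _) h
    · simp only [ge_iff_le, le_principal_iff, mem_principal]
      intro x' h; exact Ag.mono (le_max_right _ _) h

variable {α β : A} {n r : ℕ}

lemma ev_pt (x : ℤ → A) (i : ℤ) : ∀ᶠ x' in agF x, x' i = x i :=
  ev_agF.2 ⟨i.natAbs, fun x' h => h i (by omega) (by omega)⟩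

lemma ev_word (x : ℤ → A) (s : ℤ) : ∀ᶠ x' in agF x, word n x' s = word n x s := by
  have : ∀ᶠ x' in agF x, ∀ t : Fin n, x' (s + t) = x (s + t) := eventually_all.2 fun t => ev_pt x _
  filter_upwards [this] with x' h
  ext t; exact h t

lemma ev_Zs (x : ℤ → A) (e : ℤ) : ∀ᶠ x' in agF x, (e ∈ Zs α β r x' ↔ e ∈ Zs α β r x) := by
  have : ∀ᶠ x' in agF x, ∀ u : Fin r, x' (e - 1 - r + u) = x (e - 1 - r + u) :=
    eventually_all.2 fun t => ev_pt x _
  filter_upwards [this, ev_pt x (e - 1)] with x' h h'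
  unfold Zs
  simp only [mem_ofPred_eq, h']
  apply and_congr_right; intro _
  apply forall_congr'; intro u
  apply forall_congr'; intro hu
  rw [h ⟨u, hu⟩]

lemma ev_BS (x : ℤ → A) (hz : ∀ i, ∃ z ≤ i, z ∈ Zs α β r x) (k : ℕ) (s : ℤ) :
    ∀ᶠ x' in agF x, (BS (Zs α β r x') k s ↔ BS (Zs α β r x) k s) := by
  obtain ⟨z, hzs, hz⟩ := hz s
  have : ∀ᶠ x' in agF x, ∀ u ∈ Icc z (s + k), (u ∈ Zs α β r x' ↔ u ∈ Zs α β r x) :=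
    (eventually_all_finite (Set.finite_Icc _ _)).2 fun u _ => ev_Zs x u
  filter_upwards [this] with x' h
  constructor
  · intro hb
    refine BS.localize (z := z) (Y := s + k) ((h z ⟨le_rfl, by omega⟩).2 hz)
      (fun u h1 h2 => (h u ⟨h1, h2⟩).symm) hzs le_rfl hb
  · intro hb
    exact BS.localize (z := z) (Y := s + k) hz (fun u h1 h2 => h u ⟨h1, h2⟩) hzs le_rfl hb

lemma ev_st (x : ℤ → A) (hz : ∀ i, ∃ z ≤ i, z ∈ Zs α β r x) (N : ℕ) (i : ℤ) :
    ∀ᶠ x' in agF x, st (Zs α β r x') N i = st (Zs α β r x) N i := by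
  have : ∀ᶠ x' in agF x, ∀ t ∈ Iio N, (BS (Zs α β r x') N (i - (t : ℕ)) ↔ BS (Zs α β r x) N (i - (t : ℕ))) :=
    (eventually_all_finite (Set.finite_Iio _)).2 fun u _ => ev_BS x hz _ _
  filter_upwards [this] with x' h
  exact st_congr h

lemma ev_Dm (x : ℤ → A) (hz : ∀ i, ∃ z ≤ i, z ∈ Zs α β r x) (N : ℕ) (i : ℤ) :
    ∀ᶠ x' in agF x, (i ∈ Dm (Zs α β r x') N ↔ i ∈ Dm (Zs α β r x) N) := by
  filter_upwards [ev_st x hz N i] with x' h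
  unfold Dm
  simp only [mem_ofPred_eq, h]

variable {C : Type*}

lemma ev_Ac (K : Code A α β n r C) (x : ℤ → A) (hz : ∀ i, ∃ z ≤ i, z ∈ Zs α β r x) (i : ℤ) :
    ∀ᶠ x' in agF x, (i ∈ Ac K x' ↔ i ∈ Ac K x) := by
  filter_upwards [ev_BS x hz n i, ev_word (n := n) x i] with x' h h'
  unfold Ac
  simp only [mem_ofPred_eq, h, h']

lemma ev_sg (K : Code A α β n r C) (x : ℤ → A) (i : ℤ) :
    ∀ᶠ x' in agF x, sg K x' i = sg K x i := by
  filter_upwards [ev_word (n := n) x i] with x' h'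
  unfold sg
  rw [h']

lemma ev_mt {J : ℕ} {x : ℤ → A} {D S : (ℤ → A) → Set ℤ}
    (hD : ∀ i, ∀ᶠ x' in agF x, (i ∈ D x' ↔ i ∈ D x)) (hS : ∀ i, ∀ᶠ x' in agF x, (i ∈ S x' ↔ i ∈ S x))
    {i : ℤ} {j : ℕ} (h : hh J (D x) (S x) i j ≤ 0) :
    ∀ᶠ x' in agF x, Mex J (D x') (S x') i ∧ ∀ t : Fin J, mt J (D x') (S x') i t = mt J (D x) (S x) i t := by
  have h1 : ∀ᶠ x' in agF x, ∀ u ∈ Iic j, (i + (u : ℕ) ∈ D x' ↔ i + (u : ℕ) ∈ D x) :=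
    (eventually_all_finite (Set.finite_Iic _)).2 fun u _ => hD _
  have h2 : ∀ᶠ x' in agF x, ∀ u ∈ Iic j, (i + (u : ℕ) ∈ S x' ↔ i + (u : ℕ) ∈ S x) :=
    (eventually_all_finite (Set.finite_Iic _)).2 fun u _ => hS _
  filter_upwards [h1, h2] with x' h1 h2
  refine ⟨⟨j, ?_⟩, fun t => mt_congr h h1 h2 t.2⟩
  rw [hh_congr h1 h2]; exact h

variable {C1 C2 B : Type*} {N J : ℕ}

/-- good points -/
def X0 (J N : ℕ) (good : C1 → Prop) (K : Code A α β n r (C1 × C2)) : Set (ℤ → A) :=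
  {x | ∀ i, (∃ z ≤ i, z ∈ Zs α β r x) ∧ (∃ j, hh 1 (Dm (Zs α β r x) N) (Ac K x) i j ≤ 0 ∧
    hh J (Bd (Ac K x) good (sg K x)) (Ac K x) i j ≤ 0)}

lemma loc_const (hN : 0 < N) (good : C1 → Prop) (G : C1 → (Fin J → C2) → (Fin N → B))
    (K : Code A α β n r (C1 × C2)) {x : ℤ → A} (hx : x ∈ X0 J N good K) (I : Finset ℤ) :
    ∃ m, ∀ x', Ag m x x' → Det J N good (Zs α β r x') (Ac K x') (sg K x') (↑(win m) : Set ℤ) I ∧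
      ∀ i ∈ I, ph hN good G K x' i = ph hN good G K x i := by
  have hz : ∀ i, ∃ z ≤ i, z ∈ Zs α β r x := fun i => (hx i).1
  have main : ∀ i : ℤ, ∃ T : Finset ℤ, ∀ᶠ x' in agF x,
      Det J N good (Zs α β r x') (Ac K x') (sg K x') (↑T : Set ℤ) {i} ∧
      ph hN good G K x' i = ph hN good G K x i := by
    intro i
    set Z := Zs α β r x with hZ
    set y := mt 1 (Dm Z N) (Ac K x) (st Z N i) 0 with hy
    set f : Fin J → ℤ := fun t => mt J (Bd (Ac K x) good (sg K x)) (Ac K x) y t with hf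
    classical
    refine ⟨insert y (Finset.univ.image f), ?_⟩
    obtain ⟨j1, h1, -⟩ := (hx (st Z N i)).2
    obtain ⟨j2, -, h2⟩ := (hx y).2
    have e1 := ev_mt (D := fun x => Dm (Zs α β r x) N) (S := fun x => Ac K x)
      (fun i => ev_Dm x hz N i) (fun i => ev_Ac K x hz i) h1
    have e2 := ev_mt (D := fun x => Bd (Ac K x) good (sg K x)) (S := fun x => Ac K x)
      (fun i => by
        filter_upwards [ev_Ac K x hz i, ev_sg K x i] with x' h h'
        unfold Bd
        simp only [mem_ofPred_eq, h, h']) (fun i => ev_Ac K x hz i) h2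
    have e3 : ∀ᶠ x' in agF x, ∀ t, sg K x' (f t) = sg K x (f t) := eventually_all.2 fun t => ev_sg K x _
    filter_upwards [ev_st x hz N i, e1, e2, ev_sg K x y, e3] with x' h1 h2 h3 h4 h5
    have e : mt 1 (Dm (Zs α β r x') N) (Ac K x') (st (Zs α β r x') N i) 0 = y := by
      rw [h1]; exact h2.2 0
    constructor
    · intro i' hi'
      obtain rfl : i' = i := by simpa using hi'
      rw [e]
      refine ⟨by rw [h1]; exact h2.1, by simp, fun _ => ⟨h3.1, fun t => ?_⟩⟩
      rw [h3.2 t]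
      simp [hf]
    · unfold ph out
      have e6 : (⟨(i - st (Zs α β r x') N i).toNat % N, Nat.mod_lt _ hN⟩ : Fin N) =
          ⟨(i - st Z N i).toNat % N, Nat.mod_lt _ hN⟩ := by
        apply Fin.ext; simp only [h1, hZ]
      rw [e6, e, ← hZ, ← hy, h4]
      congr 2
      ext t : 1
      rw [h3.2 t]
      rw [show mt J (Bd (Ac K x) good (sg K x)) (Ac K x) y t = f t from rfl, h5]
  choose T hT using main
  classical
  have h1 : ∀ᶠ x' in agF x, ∀ i ∈ I, Det J N good (Zs α β r x') (Ac K x') (sg K x') (↑(T i) : Set ℤ) {i} ∧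
      ph hN good G K x' i = ph hN good G K x i :=
    (eventually_all_finset I).2 fun i _ => hT i
  obtain ⟨m1, hm1⟩ := ev_agF.1 h1
  have : ∃ m2, ∀ i ∈ I, T i ⊆ win m2 := by
    refine ⟨I.sup fun i => (T i).sup Int.natAbs, fun i hi k hk => ?_⟩
    have a1 : k.natAbs ≤ (T i).sup Int.natAbs := Finset.le_sup (f := Int.natAbs) hk
    have a2 : (T i).sup Int.natAbs ≤ I.sup fun i => (T i).sup Int.natAbs :=
      Finset.le_sup (f := fun i => (T i).sup Int.natAbs) hi
    rw [mem_win]; omega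
  obtain ⟨m2, hm2⟩ := this
  refine ⟨max m1 m2, fun x' hx' => ⟨fun i hi => ?_, fun i hi => (hm1 x' (hx'.mono (le_max_left _ _)) i hi).2⟩⟩
  have hsub : (↑(T i) : Set ℤ) ⊆ ↑(win (max m1 m2)) := by
    intro k hk
    have := hm2 i hi hk
    rw [mem_win] at this
    simp only [Finset.mem_coe, mem_win]; omega
  obtain ⟨a, b, c⟩ := (hm1 x' (hx'.mono (le_max_left _ _)) i hi).1 i (by simp)
  exact ⟨a, hsub b, fun hb => ⟨(c hb).1, fun t => hsub ((c hb).2 t)⟩⟩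

end loccon
end NF


namespace NF

section equivc
variable {A : Type*} [Fintype A] [MeasurableSpace A] [MeasurableSingletonClass A]
  {α β : A} {n r : ℕ} {C1 C2 B : Type*} [Fintype C1] [Fintype C2] [Nonempty C1] [Nonempty C2]
  [Fintype B] [MeasurableSpace B] [MeasurableSingletonClass B] {N J : ℕ}

/-- the determined part of a preimage -/
def Um (hN : 0 < N) (good : C1 → Prop) (G : C1 → (Fin J → C2) → (Fin N → B))
    (K : Code A α β n r (C1 × C2)) (I : Finset ℤ) (F : Set (ℤ → B)) (m : ℕ) : Set (ℤ → A) :=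
  {x | ∀ x', Ag m x x' → Det J N good (Zs α β r x') (Ac K x') (sg K x') (↑(win m) : Set ℤ) I ∧
    ph hN good G K x' ∈ F}

lemma Ag.trans' {A : Type*} {m : ℕ} {x y z : ℤ → A} (h : Ag m x y) (h' : Ag m y z) : Ag m x z :=
  fun i h1 h2 => (h' i h1 h2).trans (h i h1 h2)

lemma Loc_Um (hN : 0 < N) (good : C1 → Prop) (G : C1 → (Fin J → C2) → (Fin N → B))
    (K : Code A α β n r (C1 × C2)) (I : Finset ℤ) (F : Set (ℤ → B)) (m : ℕ) :
    Loc m (Um hN good G K I F m) :=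
  fun _ _ hxy hx x' hx' => hx x' (hxy.trans' hx')

lemma Um_mono (hN : 0 < N) (good : C1 → Prop) (G : C1 → (Fin J → C2) → (Fin N → B))
    (K : Code A α β n r (C1 × C2)) (I : Finset ℤ) (F : Set (ℤ → B)) :
    Monotone (Um hN good G K I F) := by
  intro m m' hm x hx x' hx'
  obtain ⟨h1, h2⟩ := hx x' (hx'.mono hm)
  refine ⟨fun i hi => ?_, h2⟩
  have hsub : (↑(win m) : Set ℤ) ⊆ ↑(win m') := by
    intro k hk
    simp only [Finset.mem_coe, mem_win] at *; omega
  obtain ⟨a, b, c⟩ := h1 i hi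
  exact ⟨a, hsub b, fun hb => ⟨(c hb).1, fun t => hsub ((c hb).2 t)⟩⟩

lemma sum_cyl_le {ν : Measure (ℤ → B)} {k : ℕ} {F : Set (ℤ → B)} (hF : Loc k F)
    (ext : (win k → B) → ℤ → B) (hext : ∀ w i (hi : i ∈ win k), ext w i = w ⟨i, hi⟩)
    (P : Finset (win k → B)) (hP : ∀ w ∈ P, ext w ∈ F) :
    ∑ w ∈ P, ν (_root_.cylinder (win k) (ext w)) ≤ ν F := by
  rw [← measure_biUnion_finset]
  · apply measure_mono
    intro x hx
    simp only [mem_iUnion] at hx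
    obtain ⟨w, hw, hx⟩ := hx
    exact hF (ext w) x (fun i h1 h2 => hx i (mem_win.2 ⟨h1, h2⟩)) (hP w hw)
  · intro w _ w' _ hne
    rw [Function.onFun, Set.disjoint_left]
    intro x hx hx'
    apply hne
    ext i
    rw [← hext w i i.2, ← hext w' i i.2, ← hx i i.2, hx' i i.2]
  · intro w _
    exact measurable_cylinder _ _

lemma Tm_Um_le (hN : 0 < N) (good : C1 → Prop) (G : C1 → (Fin J → C2) → (Fin N → B))
    {q : B → ℝ} (hq : IsProbVec q) {ν : Measure (ℤ → B)} (hν : IsProductMeasure ν (fun _ => q))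
    (hG : ∀ w, ∀ D : DecidablePred fun p : C1 × (Fin J → C2) => G p.1 p.2 = w,
      av (fun p : C1 × (Fin J → C2) => if G p.1 p.2 = w then (1 : ℝ) else 0) = ∏ t, q (w t))
    (hgood : ∀ c, good c → ∀ e e', G c e = G c e')
    (K : Code A α β n r (C1 × C2)) {k : ℕ} {F : Set (ℤ → B)} (hF : Loc k F) (m : ℕ) {M : ℕ}
    (s : Fin M → ℤ) (hs : Function.Injective s) (hr : range s = ↑(win m)) (x : ℤ → A) :
    Tm K ((Um hN good G K (win k) F m).indicator 1) M s x ≤ ν F := by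
  classical
  haveI := IsProbVec.nonempty hq
  let ext : (win k → B) → ℤ → B := fun w i => if hi : i ∈ win k then w ⟨i, hi⟩ else Classical.arbitrary B
  have hext : ∀ w i (hi : i ∈ win k), ext w i = w ⟨i, hi⟩ := fun w i hi => by simp only [ext, dif_pos hi]
  let P : Finset (win k → B) := Finset.univ.filter fun w => ext w ∈ F
  have hlaw : ∀ w, _ := fun w : win k → B => law hN good G hq (fun w => hG w _) hgood (Zs α β r x) (Ac K x) s
    (fun c => sg K (PS K M s c x)) (fun c j hj => sg_PS K M s hs c x j hj)
    (fun c c' y hy hyr => by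
      have : ∀ j, y ≠ s j := fun j hj => hyr ⟨j, hj.symm⟩
      unfold sg
      rw [word_PS_ne K M s c x hy this, word_PS_ne K M s c' x hy this]) (win k) (ext w)
  set f : (win k → B) → (Fin M → C1 × C2) → ℝ := fun w c =>
    if Det J N good (Zs α β r x) (Ac K x) (sg K (PS K M s c x)) (range s) (win k) ∧
      ∀ i ∈ win k, out hN good G (Zs α β r x) (Ac K x) (sg K (PS K M s c x)) i = ext w i then (1:ℝ) else 0 with hf
  have hf0 : ∀ w c, 0 ≤ f w c := fun w c => by rw [hf]; dsimp only; split_ifs <;> norm_num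
  have h1 : ∀ c, (Um hN good G K (win k) F m).indicator (1 : (ℤ → A) → ENNReal) (PS K M s c x) ≤
      ∑ w ∈ P, ENNReal.ofReal (f w c) := by
    intro c
    by_cases hU : PS K M s c x ∈ Um hN good G K (win k) F m
    · rw [indicator_of_mem hU]
      obtain ⟨h1, h2⟩ := hU _ (Ag.refl _ _)
      rw [Zs_PS, Ac_PS] at h1
      set w : win k → B := fun i => ph hN good G K (PS K M s c x) i with hw
      have hwF : w ∈ P := by
        simp only [P, Finset.mem_filter, Finset.mem_univ, true_and]
        refine hF _ _ (fun i hi1 hi2 => ?_) h2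
        rw [hext w i (mem_win.2 ⟨hi1, hi2⟩)]
      have : f w c = 1 := by
        rw [hf]; dsimp only
        rw [if_pos]
        refine ⟨by rw [hr]; exact h1, fun i hi => ?_⟩
        rw [hext w i hi, hw]
        unfold ph
        rw [Zs_PS, Ac_PS]
      calc _ = ENNReal.ofReal (f w c) := by rw [this]; simp
        _ ≤ _ := Finset.single_le_sum (f := fun w => ENNReal.ofReal (f w c)) (fun _ _ => zero_le) hwF
    · rw [indicator_of_notMem hU]; exact zero_le
  have hκ0 : (0:ℝ) < Fintype.card (C1 × C2) := by exact_mod_cast Fintype.card_pos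
  have h2 : ∀ w, ((Fintype.card (C1 × C2) : ENNReal)⁻¹) ^ M * ∑ c, ENNReal.ofReal (f w c) ≤
      ν (_root_.cylinder (win k) (ext w)) := by
    intro w
    rw [hν, ← ENNReal.ofReal_prod_of_nonneg (fun _ _ => hq.1 _)]
    have : ((Fintype.card (C1 × C2) : ENNReal)⁻¹) ^ M * ∑ c, ENNReal.ofReal (f w c) = ENNReal.ofReal (av (f w)) := by
      unfold av
      rw [← ENNReal.ofReal_sum_of_nonneg (fun c _ => hf0 w c), ENNReal.ofReal_div_of_pos
        (by exact_mod_cast Fintype.card_pos), mul_comm, div_eq_mul_inv]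
      congr 1
      rw [Fintype.card_fun, Fintype.card_fin, ← ENNReal.inv_pow]
      push_cast
      rw [ENNReal.ofReal_pow hκ0.le]
      simp
    rw [this]
    refine ENNReal.ofReal_le_ofReal ?_
    convert hlaw w using 4
  rw [Tm_eq]
  calc _ ≤ ((Fintype.card (C1 × C2) : ENNReal)⁻¹) ^ M * ∑ c, ∑ w ∈ P, ENNReal.ofReal (f w c) := by
        gcongr with c _; exact h1 c
    _ = ∑ w ∈ P, ((Fintype.card (C1 × C2) : ENNReal)⁻¹) ^ M * ∑ c, ENNReal.ofReal (f w c) := by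
        rw [Finset.sum_comm, Finset.mul_sum]
    _ ≤ ∑ w ∈ P, ν (_root_.cylinder (win k) (ext w)) := Finset.sum_le_sum fun w _ => h2 w
    _ ≤ ν F := sum_cyl_le hF ext hext P fun w hw => (Finset.mem_filter.1 hw).2

end equivc
end NF


namespace NF

section equivd
variable {A : Type*} [Fintype A] [MeasurableSpace A] [MeasurableSingletonClass A]
  {α β : A} {n r : ℕ} {C1 C2 B : Type*} [Fintype C1] [Fintype C2] [Nonempty C1] [Nonempty C2]
  [Fintype B] [MeasurableSpace B] [MeasurableSingletonClass B] {N J : ℕ}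

lemma enum_win (m : ℕ) : ∃ (M : ℕ) (s : Fin M → ℤ), Function.Injective s ∧ range s = ↑(win m) := by
  refine ⟨(win m).card, fun j => ((win m).equivFin.symm j : ℤ), ?_, ?_⟩
  · intro a b h
    exact (win m).equivFin.symm.injective (Subtype.ext h)
  · ext i
    constructor
    · rintro ⟨j, rfl⟩; exact ((win m).equivFin.symm j).2
    · intro hi
      exact ⟨(win m).equivFin ⟨i, hi⟩, by simp⟩

lemma Um_bounds {μ : Measure (ℤ → A)} {ρ : ℤ → A → ℝ} (hρ : ∀ i, IsProbVec (ρ i))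
    (h : IsProductMeasure μ ρ) {δ : ℝ} (hδ : 0 < δ) (hd : ∀ i a, δ < ρ i a)
    (hsum : Summable (fun i : ℤ => ∑ a, (ρ i a - ρ (i+1) a)^2))
    (hN : 0 < N) (good : C1 → Prop) (G : C1 → (Fin J → C2) → (Fin N → B))
    {q : B → ℝ} (hq : IsProbVec q) {ν : Measure (ℤ → B)} (hν : IsProductMeasure ν (fun _ => q))
    (hG : ∀ w, ∀ D : DecidablePred fun p : C1 × (Fin J → C2) => G p.1 p.2 = w,
      av (fun p : C1 × (Fin J → C2) => if G p.1 p.2 = w then (1 : ℝ) else 0) = ∏ t, q (w t))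
    (hgood : ∀ c, good c → ∀ e e', G c e = G c e')
    (K : Code A α β n r (C1 × C2)) :
    ∃ Kc : ENNReal, Kc ≠ ⊤ ∧ ∀ (t : NNReal), 0 < t → ∀ k (F : Set (ℤ → B)), Loc k F → ∀ m,
      μ (Um hN good G K (win k) F m) ≤ t * ν F + Kc / t ∧
      ν F ≤ t * μ ((Um hN good G K (win k) Fᶜ m)ᶜ) + Kc / t := by
  haveI := IsProbVec.nonempty (hρ 0)
  haveI := isProb_of_product h
  haveI := IsProbVec.nonempty hq
  haveI := isProb_of_product hν
  obtain ⟨Kc, hKc, hW⟩ := density hρ h hδ hd hsum K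
  refine ⟨Kc, hKc, fun t ht k F hF m => ?_⟩
  obtain ⟨M, s, hs, hr⟩ := enum_win m
  obtain ⟨W, W', mW, mW', hWW, hW2, hW1, hT⟩ := hW M s hs
  have ht0 : (t : ENNReal) ≠ 0 := by simpa using ht.ne'
  have htt : (t : ENNReal) ≠ ⊤ := ENNReal.coe_ne_top
  have key : ∀ F : Set (ℤ → B), Loc k F → ∫⁻ x in Um hN good G K (win k) F m, W x ∂μ ≤ ν F := by
    intro F hF
    have mU := (Loc_Um hN good G K (win k) F m).measurableSet
    have e : ∫⁻ x in Um hN good G K (win k) F m, W x ∂μ =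
        ∫⁻ x, (Um hN good G K (win k) F m).indicator 1 x * W x ∂μ := by
      rw [← lintegral_indicator mU]
      refine lintegral_congr fun x => ?_
      by_cases hx : x ∈ Um hN good G K (win k) F m <;> simp [hx]
    rw [e, ← hT _ (measurable_one.indicator mU)]
    calc _ ≤ ∫⁻ _, ν F ∂μ := lintegral_mono fun x => Tm_Um_le hN good G hq hν hG hgood K hF m s hs hr x
      _ = ν F := by simp
  constructor
  · have mU := (Loc_Um hN good G K (win k) F m).measurableSet
    have pt : ∀ x, (1 : ENNReal) ≤ t * W x + W' x / t := by
      intro x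
      rcases le_total 1 (t * W x) with h1 | h1
      · exact h1.trans le_self_add
      · have : (1:ENNReal) ≤ W' x / t := by
          rw [ENNReal.le_div_iff_mul_le (Or.inl ht0) (Or.inl htt), one_mul]
          calc (t:ENNReal) = t * (W' x * W x) := by rw [hWW, mul_one]
            _ = W' x * (t * W x) := by ring
            _ ≤ W' x * 1 := by gcongr
            _ = W' x := mul_one _
        exact this.trans le_add_self
    calc μ (Um hN good G K (win k) F m) = ∫⁻ x in Um hN good G K (win k) F m, 1 ∂μ := by simp
      _ ≤ ∫⁻ x in Um hN good G K (win k) F m, (t * W x + W' x / t) ∂μ := lintegral_mono fun x => pt x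
      _ = t * ∫⁻ x in Um hN good G K (win k) F m, W x ∂μ + (∫⁻ x in Um hN good G K (win k) F m, W' x ∂μ) / t := by
        rw [lintegral_add_left (mW.const_mul _), lintegral_const_mul _ mW]
        simp only [div_eq_mul_inv]
        rw [lintegral_mul_const _ mW']
      _ ≤ t * ν F + Kc / t := by
        gcongr
        · exact key F hF
        · exact (setLIntegral_le_lintegral _ _).trans hW1
  · set V := Um hN good G K (win k) Fᶜ m with hV
    have mV : MeasurableSet V := (Loc_Um hN good G K (win k) Fᶜ m).measurableSet
    have pt : ∀ x, W x ≤ t + W x * W x / t := by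
      intro x
      rcases le_total (W x) t with h1 | h1
      · exact h1.trans le_self_add
      · refine le_trans ?_ le_add_self
        rw [ENNReal.le_div_iff_mul_le (Or.inl ht0) (Or.inl htt)]
        gcongr
    have h1 : ∫⁻ x in Vᶜ, W x ∂μ ≤ t * μ Vᶜ + Kc / t := by
      calc _ ≤ ∫⁻ x in Vᶜ, (t + W x * W x / t) ∂μ := lintegral_mono fun x => pt x
        _ = t * μ Vᶜ + (∫⁻ x in Vᶜ, W x * W x ∂μ) / t := by
          rw [lintegral_add_left measurable_const]
          simp only [div_eq_mul_inv]
          rw [lintegral_mul_const _ (show Measurable fun x => W x * W x from mW.mul mW)]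
          simp
        _ ≤ _ := by
          gcongr
          exact (setLIntegral_le_lintegral _ _).trans hW2
    have h2 : ∫⁻ x, W x ∂μ = 1 := by
      have := hT (fun _ => 1) measurable_const
      simp only [one_mul] at this
      rw [← this]
      have e : ∀ x, Tm K (fun _ => 1) M s x = 1 := by
        intro x
        rw [Tm_eq]
        simp only [Finset.sum_const, Finset.card_univ, Fintype.card_fun, Fintype.card_fin, nsmul_eq_mul, mul_one]
        rw [Nat.cast_pow, ← mul_pow, ENNReal.inv_mul_cancel, one_pow]
        · exact Nat.cast_ne_zero.2 Fintype.card_ne_zero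
        · exact ENNReal.natCast_ne_top _
      simp [e]
    have h3 : ν F + ν Fᶜ = 1 := by
      rw [measure_add_measure_compl hF.measurableSet]; simp
    have h4 : ∫⁻ x in V, W x ∂μ + ∫⁻ x in Vᶜ, W x ∂μ = 1 := by
      rw [lintegral_add_compl _ mV, h2]
    have h5 : ν F + ν Fᶜ ≤ ∫⁻ x in Vᶜ, W x ∂μ + ν Fᶜ := by
      rw [h3, ← h4, add_comm]
      gcongr
      exact key _ hF.compl
    exact ((ENNReal.add_le_add_iff_right (measure_ne_top _ _)).1 h5).trans h1

theorem factor_of_code {μ : Measure (ℤ → A)} {ρ : ℤ → A → ℝ} (hρ : ∀ i, IsProbVec (ρ i))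
    (h : IsProductMeasure μ ρ) {δ : ℝ} (hδ : 0 < δ) (hd : ∀ i a, δ < ρ i a)
    (hsum : Summable (fun i : ℤ => ∑ a, (ρ i a - ρ (i+1) a)^2))
    (hns : MeasEquiv (μ.map shift) μ)
    (hN : 0 < N) (good : C1 → Prop) (G : C1 → (Fin J → C2) → (Fin N → B))
    {q : B → ℝ} (hq : IsProbVec q) (hq0 : ∀ b, 0 < q b)
    (hG : ∀ w, ∀ D : DecidablePred fun p : C1 × (Fin J → C2) => G p.1 p.2 = w,
      av (fun p : C1 × (Fin J → C2) => if G p.1 p.2 = w then (1 : ℝ) else 0) = ∏ t, q (w t))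
    (hgood : ∀ c, good c → ∀ e e', G c e = G c e')
    (K : Code A α β n r (C1 × C2)) (hX0 : ∀ᵐ x ∂μ, x ∈ X0 J N good K) :
    ∃ (ν : Measure (ℤ → B)) (φ : (ℤ → A) → (ℤ → B)),
        IsProductMeasure ν (fun _ => q) ∧ Measurable φ ∧
        (∀ᵐ x ∂μ, φ (shift x) = shift (φ x)) ∧
        MeasEquiv (μ.map φ) ν ∧ IsFinitary μ φ := by
  classical
  haveI := IsProbVec.nonempty (hρ 0)
  haveI := isProb_of_product h
  haveI := IsProbVec.nonempty hq
  set ν : Measure (ℤ → B) := Measure.infinitePi (fun _ => marg q) with hνd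
  have hν : IsProductMeasure ν (fun _ => q) := infinitePi_isProduct (fun _ => hq)
  haveI := isProb_of_product hν
  set f := ph hN good G K with hf
  set Y : ℤ → ℕ → Set (ℤ → A) := fun i m => {x | ∀ x', Ag m x x' → f x' i = f x i} with hY
  have lY : ∀ i m, Loc m (Y i m) := by
    intro i m x y hxy hx x' hx'
    rw [hx x' (hxy.trans' hx'), hx y hxy]
  set X1 : Set (ℤ → A) := ⋂ i, ⋃ m, Y i m with hX1
  have mX1 : MeasurableSet X1 := MeasurableSet.iInter fun i => MeasurableSet.iUnion fun m => (lY i m).measurableSet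
  have sX : X0 J N good K ⊆ X1 := by
    intro x hx
    simp only [hX1, mem_iInter, mem_iUnion]
    intro i
    obtain ⟨m, hm⟩ := loc_const hN good G K hx {i}
    exact ⟨m, fun x' hx' => (hm x' hx').2 i (by simp)⟩
  have aX1 : ∀ᵐ x ∂μ, x ∈ X1 := hX0.mono fun x hx => sX hx
  set b0 := Classical.arbitrary B
  set φ : (ℤ → A) → (ℤ → B) := fun x => if x ∈ X1 then f x else fun _ => b0 with hφ
  have φX : ∀ x ∈ X1, φ x = f x := fun x hx => by simp only [hφ, if_pos hx]
  have φX' : ∀ x, x ∉ X1 → φ x = fun _ => b0 := fun x hx => by simp only [hφ, if_neg hx]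
  -- open sets
  set O : ℤ → B → ℕ → Set (ℤ → A) := fun i b m => {x | ∀ x', Ag m x x' → f x' i = b} with hO
  have lO : ∀ i b m, Loc m (O i b m) := fun i b m x y hxy hx x' hx' => hx x' (hxy.trans' hx')
  have hOX : ∀ x ∈ X1, ∀ i b, (φ x i = b ↔ ∃ m, x ∈ O i b m) := by
    intro x hx i b
    rw [φX x hx]
    constructor
    · intro hb
      simp only [hX1, mem_iInter, mem_iUnion] at hx
      obtain ⟨m, hm⟩ := hx i
      exact ⟨m, fun x' hx' => (hm x' hx').trans hb⟩
    · rintro ⟨m, hm⟩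
      exact hm x (Ag.refl _ _)
  have mφ : Measurable φ := by
    refine measurable_pi_lambda _ fun i => measurable_to_countable' fun b => ?_
    have : (fun x => φ x i) ⁻¹' {b} = (X1 ∩ ⋃ m, O i b m) ∪ (X1ᶜ ∩ {_x | b0 = b}) := by
      ext x
      by_cases hx : x ∈ X1
      · simp [hx, hOX x hx i b]
      · simp [hx, φX' x hx]
    rw [this]
    exact (mX1.inter (MeasurableSet.iUnion fun m => (lO i b m).measurableSet)).union
      (mX1.compl.inter (MeasurableSet.const _))
  haveI : IsProbabilityMeasure (μ.map φ) := Measure.isProbabilityMeasure_map mφ.aemeasurable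
  obtain ⟨Kc, hKc, hU⟩ := Um_bounds hρ h hδ hd hsum hN good G hq hν hG hgood K
  have sU : ∀ k (F : Set (ℤ → B)), Loc k F → ∀ x ∈ X0 J N good K, φ x ∈ F →
      x ∈ ⋃ m, Um hN good G K (win k) F m := by
    intro k F hF x hx hxF
    rw [φX x (sX hx)] at hxF
    obtain ⟨m, hm⟩ := loc_const hN good G K hx (win k)
    refine mem_iUnion.2 ⟨m, fun x' hx' => ⟨(hm x' hx').1, ?_⟩⟩
    exact hF (f x) _ (fun i h1 h2 => (hm x' hx').2 i (mem_win.2 ⟨h1, h2⟩)) hxF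
  have hequiv : MeasEquiv (μ.map φ) ν := by
    constructor
    · refine loc_ne_top_approx hKc fun t ht k F hF => ?_
      rw [Measure.map_apply mφ hF.measurableSet]
      calc μ (φ ⁻¹' F) ≤ μ (⋃ m, Um hN good G K (win k) F m) := by
            apply measure_mono_ae
            filter_upwards [hX0] with x hx hxF
            exact sU k F hF x hx hxF
        _ = ⨆ m, μ (Um hN good G K (win k) F m) := (Um_mono hN good G K (win k) F).measure_iUnion
        _ ≤ _ := iSup_le fun m => (hU t ht k F hF m).1
    · refine loc_ne_top_approx hKc fun t ht k F hF => ?_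
      rw [Measure.map_apply mφ hF.measurableSet]
      set V := fun m => Um hN good G K (win k) Fᶜ m with hV
      have lim : Tendsto (fun m => μ (V m)ᶜ) atTop (𝓝 (μ (⋂ m, (V m)ᶜ))) := by
        apply tendsto_measure_iInter_atTop
        · intro m; exact (Loc_Um hN good G K (win k) Fᶜ m).measurableSet.compl.nullMeasurableSet
        · intro m m' hm; exact compl_subset_compl.2 (Um_mono hN good G K (win k) Fᶜ hm)
        · exact ⟨0, measure_ne_top _ _⟩
      have lim2 : Tendsto (fun m => t * μ (V m)ᶜ + Kc / t) atTop (𝓝 (t * μ (⋂ m, (V m)ᶜ) + Kc / t)) :=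
        (ENNReal.Tendsto.const_mul lim (Or.inr ENNReal.coe_ne_top)).add tendsto_const_nhds
      have h1 := ge_of_tendsto' lim2 (fun m => (hU t ht k F hF m).2)
      refine h1.trans ?_
      have : μ (⋂ m, (V m)ᶜ) ≤ μ (φ ⁻¹' F) := by
        apply measure_mono_ae
        filter_upwards [hX0] with x hx hxV
        by_contra hcon
        have := sU k Fᶜ hF.compl x hx hcon
        rw [mem_iUnion] at this
        obtain ⟨m, hm⟩ := this
        exact (mem_iInter.1 hxV m) hm
      gcongr
  refine ⟨ν, φ, hν, mφ, ?_, hequiv, ?_⟩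
  · have h2 : ∀ᵐ x ∂μ, shift x ∈ X1 := by
      have : (μ.map shift) X1ᶜ = 0 := hns.1 (ae_iff.1 aX1)
      rw [Measure.map_apply measurable_shift mX1.compl] at this
      exact ae_iff.2 this
    filter_upwards [aX1, h2] with x h1 h2
    rw [φX _ h1, φX _ h2, hf, ph_shift]
  · intro b
    have hpos : μ {x | φ x 0 = b} ≠ 0 := by
      intro h0
      have mb : MeasurableSet {y : ℤ → B | y 0 = b} := (measurable_pi_apply (X := fun _ : ℤ => B) 0) (measurableSet_singleton b)
      have h1 : (μ.map φ) {y : ℤ → B | y 0 = b} = 0 := by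
        rw [Measure.map_apply mφ mb]; exact h0
      have h2 := hequiv.2 h1
      have h3 : {y : ℤ → B | y 0 = b} = _root_.cylinder {0} (fun _ => b) := by
        ext y; simp [_root_.cylinder]
      rw [h3, hν] at h2
      simp at h2
      exact absurd (hq0 b) (not_lt.2 h2)
    let ext : (Σ m : ℕ, (win m → A)) → ℤ → A := fun w i =>
      if hi : i ∈ win w.1 then w.2 ⟨i, hi⟩ else Classical.arbitrary A
    let S : Set (Σ m : ℕ, (win m → A)) := {w | _root_.cylinder (win w.1) (ext w) ⊆ {x | f x 0 = b}}
    have hSx : ∀ x m, x ∈ O 0 b m → ∃ w ∈ S, x ∈ _root_.cylinder (win w.1) (ext w) := by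
      intro x m hx
      have he : ∀ i ∈ win m, ext ⟨m, fun i => x i⟩ i = x i := fun i hi => by
        simp only [ext, dif_pos hi]
      refine ⟨⟨m, fun i => x i⟩, ?_, fun i hi => (he i hi).symm⟩
      intro x' hx'
      refine hx x' fun i h1 h2 => ?_
      rw [hx' i (mem_win.2 ⟨h1, h2⟩), he i (mem_win.2 ⟨h1, h2⟩)]
    have hne : S.Nonempty := by
      have : ∃ x ∈ X1, φ x 0 = b := by
        by_contra hcon
        push Not at hcon
        apply hpos
        have : ∀ᵐ x ∂μ, ¬ φ x 0 = b := aX1.mono hcon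
        simpa [ae_iff] using this
      obtain ⟨x, hx, hb⟩ := this
      obtain ⟨m, hm⟩ := (hOX x hx 0 b).1 hb
      obtain ⟨w, hw, -⟩ := hSx x m hm
      exact ⟨w, hw⟩
    obtain ⟨e, he⟩ := S.to_countable.exists_eq_range hne
    refine ⟨fun k => win (e k).1, fun k => ext (e k), ?_⟩
    have h0 : μ X1ᶜ = 0 := ae_iff.1 aX1
    refine measure_mono_null ?_ h0
    intro x hx hx1
    have hiff : x ∈ {x | φ x 0 = b} ↔ x ∈ ⋃ k, _root_.cylinder (win (e k).1) (ext (e k)) := by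
      constructor
      · intro hb
        obtain ⟨m, hm⟩ := (hOX x hx1 0 b).1 hb
        obtain ⟨w, hw, hxw⟩ := hSx x m hm
        rw [he] at hw
        obtain ⟨k, rfl⟩ := hw
        exact mem_iUnion.2 ⟨k, hxw⟩
      · intro hb
        obtain ⟨k, hk⟩ := mem_iUnion.1 hb
        have : e k ∈ S := by rw [he]; exact ⟨k, rfl⟩
        show φ x 0 = b
        rw [φX x hx1]
        exact this hk
    rcases hx with hx | hx
    · exact hx.2 (hiff.1 hx.1)
    · exact hx.2 (hiff.2 hx.1)

end equivd
end NF


namespace NF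

section cheb
open ProbabilityTheory

lemma cheb {Ω : Type*} [MeasurableSpace Ω] {μ : Measure Ω} [IsProbabilityMeasure μ]
    {g : ℕ → Ω → ℝ} (hm : ∀ t, Measurable (g t)) {b : ℝ} (h0 : ∀ t x, 0 ≤ g t x) (hb : ∀ t x, g t x ≤ b)
    {K : ℕ} (hI : ∀ t t', t + K < t' → IndepFun (g t) (g t') μ)
    {a a' : ℝ} (ha : ∀ᶠ t in atTop, ∫ x, g t x ∂μ ≤ a) (haa : a < a') (c : ℝ) :
    ∀ᵐ x ∂μ, ∃ T : ℕ, ∑ t ∈ Finset.range T, g t x ≤ a' * T - c := by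
  obtain ⟨T0, hT0⟩ := eventually_atTop.1 ha
  have hintg : ∀ t, Integrable (g t) μ := fun t =>
    Integrable.of_bound (hm t).aestronglyMeasurable b
      (Eventually.of_forall fun x => by rw [Real.norm_eq_abs, abs_of_nonneg (h0 t x)]; exact hb t x)
  have hb0 : 0 ≤ b := by
    obtain ⟨x⟩ : Nonempty Ω := nonempty_of_isProbabilityMeasure μ
    exact (h0 0 x).trans (hb 0 x)
  set m : ℕ → ℝ := fun t => ∫ x, g t x ∂μ with hmdef
  have m0 : ∀ t, 0 ≤ m t := fun t => integral_nonneg (h0 t)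
  have mb : ∀ t, m t ≤ b := fun t => by
    have := integral_mono (hintg t) (integrable_const b) (fun x => hb t x)
    simpa using this
  set f : ℕ → Ω → ℝ := fun t x => g t x - m t with hf
  have fm : ∀ t, Measurable (f t) := fun t => (hm t).sub_const _
  have fb : ∀ t x, |f t x| ≤ b := fun t x => by
    rw [abs_le]; constructor <;> simp only [hf] <;> linarith [h0 t x, hb t x, m0 t, mb t]
  have ffi : ∀ t t', Integrable (fun x => f t x * f t' x) μ := fun t t' =>
    Integrable.of_bound ((fm t).mul (fm t')).aestronglyMeasurable (b*b)
      (Eventually.of_forall fun x => by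
        rw [Real.norm_eq_abs, abs_mul]
        exact mul_le_mul (fb t x) (fb t' x) (abs_nonneg _) hb0)
  have ffb : ∀ t t', ∫ x, f t x * f t' x ∂μ ≤ b * b := fun t t' => by
    have := integral_mono (ffi t t') (integrable_const (b*b)) (fun x => (le_abs_self _).trans (by
        rw [abs_mul]
        exact mul_le_mul (fb t x) (fb t' x) (abs_nonneg _) hb0))
    simpa using this
  have f0 : ∀ t, ∫ x, f t x ∂μ = 0 := fun t => by
    simp only [hf]
    rw [integral_sub (hintg t) (integrable_const _)]
    simp [hmdef]
  have ff0 : ∀ t t', t + K < t' → ∫ x, f t x * f t' x ∂μ = 0 := fun t t' h => by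
    have hi : IndepFun (f t) (f t') μ :=
      (hI t t' h).comp (measurable_id.sub_const (m t)) (measurable_id.sub_const (m t'))
    have := hi.integral_mul_eq_mul_integral (fm t).aestronglyMeasurable (fm t').aestronglyMeasurable
    simp only [Pi.mul_apply] at this
    rw [this, f0, zero_mul]
  have var : ∀ T : ℕ, ∫ x, (∑ t ∈ Finset.range T, f t x)^2 ∂μ ≤ T * ((2*K+1) * (b*b)) := by
    intro T
    have e : ∀ x, (∑ t ∈ Finset.range T, f t x)^2 = ∑ t ∈ Finset.range T, ∑ t' ∈ Finset.range T, f t x * f t' x := by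
      intro x; rw [sq, Finset.sum_mul_sum]
    simp only [e]
    rw [integral_finset_sum _ fun t _ => integrable_finset_sum _ fun t' _ => ffi t t']
    have h1 : ∀ t ∈ Finset.range T, ∫ x, ∑ t' ∈ Finset.range T, f t x * f t' x ∂μ ≤ (2*K+1) * (b*b) := by
      intro t _
      rw [integral_finset_sum _ fun t' _ => ffi t t']
      calc ∑ t' ∈ Finset.range T, ∫ x, f t x * f t' x ∂μ
          ≤ ∑ t' ∈ Finset.range T, if t' ∈ Finset.Icc (t - K) (t + K) then b*b else 0 := by
            refine Finset.sum_le_sum fun t' _ => ?_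
            split_ifs with h
            · exact ffb t t'
            · rw [Finset.mem_Icc] at h
              rcases lt_or_ge (t+K) t' with h2 | h2
              · exact (ff0 t t' h2).le
              · have : t' + K < t := by omega
                have := ff0 t' t this
                simp only [mul_comm (f t' _)] at this
                exact this.le
        _ ≤ ∑ t' ∈ Finset.Icc (t-K) (t+K), b*b := by
            rw [← Finset.sum_filter]
            refine Finset.sum_le_sum_of_subset_of_nonneg ?_ fun _ _ _ => by positivity
            intro t' ht'
            exact (Finset.mem_filter.1 ht').2
        _ ≤ _ := by
            rw [Finset.sum_const, nsmul_eq_mul]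
            gcongr
            rw [Nat.card_Icc]
            have : t + K + 1 - (t - K) ≤ 2*K+1 := by omega
            exact_mod_cast this
    calc _ ≤ ∑ t ∈ Finset.range T, ((2*K+1) * (b*b)) := Finset.sum_le_sum h1
      _ = _ := by simp
  -- the bad event
  set E : Set Ω := {x | ¬ ∃ T : ℕ, ∑ t ∈ Finset.range T, g t x ≤ a' * T - c} with hE
  have mE : MeasurableSet E := by
    have : E = (⋃ T : ℕ, {x | ∑ t ∈ Finset.range T, g t x ≤ a' * T - c})ᶜ := by
      ext x; simp [hE]
    rw [this]
    refine (MeasurableSet.iUnion fun T => ?_).compl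
    exact measurableSet_le (Finset.measurable_sum _ fun t _ => hm t) measurable_const
  rw [ae_iff]
  change μ E = 0
  set η := (a' - a)/2 with hη
  have ηp : 0 < η := by rw [hη]; linarith
  have msum : ∀ T, ∑ t ∈ Finset.range T, m t ≤ a * T + T0 * (b + |a|) := by
    intro T
    calc ∑ t ∈ Finset.range T, m t ≤ ∑ t ∈ Finset.range T, (a + if t ∈ Finset.range T0 then b + |a| else 0) := by
          refine Finset.sum_le_sum fun t _ => ?_
          split_ifs with h
          · linarith [mb t, neg_abs_le a]
          · rw [Finset.mem_range, not_lt] at h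
            linarith [hT0 t h]
      _ ≤ _ := by
          rw [Finset.sum_add_distrib, ← Finset.sum_filter]
          have : ∑ t ∈ Finset.range T with t ∈ Finset.range T0, (b + |a|) ≤ ∑ t ∈ Finset.range T0, (b+|a|) := by
            refine Finset.sum_le_sum_of_subset_of_nonneg ?_ fun _ _ _ => by positivity
            intro t' ht'
            exact (Finset.mem_filter.1 ht').2
          simp only [Finset.sum_const, Finset.card_range, nsmul_eq_mul] at this ⊢
          linarith [mul_comm a T]
  have hbound : ∀ᶠ T : ℕ in atTop, μ.real E ≤ ((2*K+1) * (b*b)) / η^2 / T := by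
    filter_upwards [tendsto_natCast_atTop_atTop.eventually_ge_atTop ((|c| + T0 * (b + |a|))/η), eventually_gt_atTop 0] with T hT hTp
    have hTp' : (0:ℝ) < T := by exact_mod_cast hTp
    rw [div_le_iff₀ ηp] at hT
    have hx : ∀ x ∈ E, (η * T)^2 ≤ (∑ t ∈ Finset.range T, f t x)^2 := by
      intro x hx
      have : a' * T - c < ∑ t ∈ Finset.range T, g t x := by
        by_contra hcon
        exact hx ⟨T, not_lt.1 hcon⟩
      have e : ∑ t ∈ Finset.range T, f t x = ∑ t ∈ Finset.range T, g t x - ∑ t ∈ Finset.range T, m t := by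
        simp only [hf, Finset.sum_sub_distrib]
      have h2 : η * T ≤ ∑ t ∈ Finset.range T, f t x := by
        rw [e]
        have := msum T
        have e2 : a' = a + 2 * η := by rw [hη]; ring
        rw [e2] at *
        nlinarith [le_abs_self c]
      exact pow_le_pow_left₀ (by positivity) h2 2
    have i2 : Integrable (fun x => (∑ t ∈ Finset.range T, f t x)^2) μ := by
      have e : ∀ x, (∑ t ∈ Finset.range T, f t x)^2 = ∑ t ∈ Finset.range T, ∑ t' ∈ Finset.range T, f t x * f t' x := by
        intro x; rw [sq, Finset.sum_mul_sum]
      simp only [e]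
      exact integrable_finset_sum _ fun t _ => integrable_finset_sum _ fun t' _ => ffi t t'
    have h3 : (η * T)^2 * μ.real E ≤ T * ((2*K+1) * (b*b)) := by
      refine le_trans ?_ (var T)
      calc (η * T)^2 * μ.real E = ∫ x in E, (η*T)^2 ∂μ := by simp [mul_comm]
        _ ≤ ∫ x in E, (∑ t ∈ Finset.range T, f t x)^2 ∂μ :=
            setIntegral_mono_on (integrable_const _) i2.integrableOn mE hx
        _ ≤ _ := setIntegral_le_integral i2 (Eventually.of_forall fun x => sq_nonneg _)
    rw [le_div_iff₀ hTp', le_div_iff₀ (by positivity)]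
    have : (η * T)^2 * μ.real E = T * (μ.real E * T * η^2) := by ring
    rw [this] at h3
    exact le_of_mul_le_mul_left h3 hTp'
  have hl : Tendsto (fun T : ℕ => ((2*K+1) * (b*b)) / η^2 / (T:ℝ)) atTop (𝓝 0) :=
    tendsto_const_div_atTop_nhds_zero_nat _
  have := ge_of_tendsto hl hbound
  have h4 : μ.real E = 0 := le_antisymm this measureReal_nonneg
  exact (measureReal_eq_zero_iff).1 h4

end cheb
end NF


namespace NF

section term
open ProbabilityTheory
variable {A : Type*} [Fintype A] [MeasurableSpace A] [MeasurableSingletonClass A]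
  {α β : A} {n r : ℕ}

lemma indep_of_dep {μ : Measure (ℤ → A)} {ρ : ℤ → A → ℝ} (hρ : ∀ i, IsProbVec (ρ i))
    (h : IsProductMeasure μ ρ) (S T : Finset ℤ) (hST : Disjoint S T) {f g : (ℤ → A) → ℝ}
    (hf : ∀ x x', (∀ i ∈ S, x i = x' i) → f x = f x')
    (hg : ∀ x x', (∀ i ∈ T, x i = x' i) → g x = g x') : IndepFun f g μ := by
  classical
  haveI := IsProbVec.nonempty (hρ 0)
  haveI : ∀ i, IsProbabilityMeasure (marg (ρ i)) := fun i => marg_prob (hρ i)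
  rw [product_eq_infinitePi hρ h]
  have h1 := (iIndepFun_infinitePi (P := fun i : ℤ => marg (ρ i)) (X := fun i (a : A) => a)
    (fun i => measurable_id)).indepFun_finset S T hST (fun i => measurable_pi_apply i)
  let ex : (R : Finset ℤ) → (R → A) → ℤ → A := fun R w i =>
    if hi : i ∈ R then w ⟨i, hi⟩ else Classical.arbitrary A
  have h2 := h1.comp (φ := fun w => f (ex S w)) (ψ := fun w => g (ex T w))
    (measurable_of_finite _) (measurable_of_finite _)
  have e1 : f = (fun w => f (ex S w)) ∘ (fun a (i : S) => a i) := by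
    funext x
    exact hf _ _ fun i hi => by simp [ex, hi]
  have e2 : g = (fun w => g (ex T w)) ∘ (fun a (i : T) => a i) := by
    funext x
    exact hg _ _ fun i hi => by simp [ex, hi]
  rw [e1, e2]
  exact h2

noncomputable def EP (p : A → ℝ) (F : (Fin n → A) → ℝ) : ℝ := ∑ w, F w * ∏ t, p (w t)

lemma measure_word {μ : Measure (ℤ → A)} {ρ : ℤ → A → ℝ} (hρ : ∀ i, IsProbVec (ρ i))
    (h : IsProductMeasure μ ρ) (k : ℤ) (w : Fin n → A) :
    μ.real {x | word n x k = w} = pw ρ k w := by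
  classical
  haveI := IsProbVec.nonempty (hρ 0)
  have inj : Function.Injective (fun t : Fin n => k + (t : ℤ)) := fun t t' h => by
    ext; simpa using h
  have e : {x | word n x k = w} = _root_.cylinder (Finset.univ.image (fun t : Fin n => k + (t : ℤ)))
      (ov k w (fun _ => Classical.arbitrary A)) := by
    ext x
    simp only [_root_.cylinder, mem_ofPred_eq, Finset.mem_image, Finset.mem_univ, true_and, forall_exists_index,
      forall_apply_eq_imp_iff, ov_of]
    constructor
    · rintro rfl t; rfl
    · intro h; funext t; exact h t
  rw [Measure.real, e, h, Finset.prod_image fun a _ b _ hab => inj hab, ENNReal.toReal_prod]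
  unfold pw
  refine Finset.prod_congr rfl fun t _ => ?_
  rw [ov_of, ENNReal.toReal_ofReal ((hρ _).1 _)]

lemma integral_word {μ : Measure (ℤ → A)} {ρ : ℤ → A → ℝ} (hρ : ∀ i, IsProbVec (ρ i))
    (h : IsProductMeasure μ ρ) (k : ℤ) (F : (Fin n → A) → ℝ) :
    ∫ x, F (word n x k) ∂μ = ∑ w, F w * pw ρ k w := by
  classical
  haveI := IsProbVec.nonempty (hρ 0)
  haveI := isProb_of_product h
  have mw : ∀ w : Fin n → A, MeasurableSet {x : ℤ → A | word n x k = w} := fun w =>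
    measurable_word k (measurableSet_singleton w)
  have e : ∀ x, F (word n x k) = ∑ w, {x | word n x k = w}.indicator (fun _ => F w) x := by
    intro x
    rw [Finset.sum_eq_single (word n x k)]
    · simp
    · intro w _ hw
      simp [hw.symm]
    · simp
  simp only [e]
  rw [integral_finset_sum _ fun w _ => (integrable_const _).indicator (mw w)]
  refine Finset.sum_congr rfl fun w _ => ?_
  rw [integral_indicator_const _ (mw w), measure_word hρ h, smul_eq_mul, mul_comm]

lemma lim_word {μ : Measure (ℤ → A)} {ρ : ℤ → A → ℝ} (hρ : ∀ i, IsProbVec (ρ i))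
    (h : IsProductMeasure μ ρ) {p : A → ℝ} (hlim : ∀ a, Tendsto (fun i : ℤ => ρ i a) cofinite (𝓝 (p a)))
    (F : (Fin n → A) → ℝ) (s : ℕ → ℤ) (hs : Function.Injective s) :
    Tendsto (fun t => ∫ x, F (word n x (s t)) ∂μ) atTop (𝓝 (EP p F)) := by
  simp only [integral_word hρ h]
  unfold EP pw
  refine tendsto_finset_sum _ fun w _ => Tendsto.const_mul _ (tendsto_finset_prod _ fun t _ => ?_)
  refine (hlim (w t)).comp ?_
  rw [← Nat.cofinite_eq_atTop]
  exact Function.Injective.tendsto_cofinite (fun a b hab => hs (by simpa using hab))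

end term
end NF


namespace NF

section term2
open ProbabilityTheory
variable {A : Type*} [Fintype A] [MeasurableSpace A] [MeasurableSingletonClass A]
  {α β : A} {n r : ℕ} {C1 C2 : Type*}

open Classical in
/-- indicator of a set of words -/
noncomputable def iw (P : (Fin n → A) → Prop) (w : Fin n → A) : ℝ := if P w then 1 else 0

lemma iw_nonneg (P : (Fin n → A) → Prop) (w : Fin n → A) : 0 ≤ iw P w := by unfold iw; split_ifs <;> norm_num
lemma iw_le_one (P : (Fin n → A) → Prop) (w : Fin n → A) : iw P w ≤ 1 := by unfold iw; split_ifs <;> norm_num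

/-- marker word -/
def mkw (α β : A) (r : ℕ) : Fin (r+1) → A := fun t => if t.1 < r then α else β

lemma Zs_word (x : ℤ → A) (e : ℤ) : e ∈ Zs α β r x ↔ word (r+1) x (e - 1 - r) = mkw α β r := by
  unfold Zs word mkw
  constructor
  · rintro ⟨h1, h2⟩
    funext t
    split_ifs with ht
    · exact h2 t ht
    · have : (t : ℕ) = r := by have := t.2; omega
      rw [this, ← h1]; congr 1; ring
  · intro h
    constructor
    · have := congrFun h ⟨r, by omega⟩
      simp only [lt_irrefl, if_false] at this
      rw [← this]; congr 1; ring
    · intro u hu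
      have := congrFun h ⟨u, by omega⟩
      simpa [hu] using this

lemma EP_mk (p : A → ℝ) : EP p (iw (fun w => w = mkw α β r)) = p α ^ r * p β := by
  classical
  unfold EP
  rw [Finset.sum_eq_single (mkw α β r)]
  · rw [Fin.prod_univ_castSucc]
    simp [iw, mkw]
  · intro w _ hw; simp [iw, hw]
  · simp

lemma ii_Zs (x : ℤ → A) (e : ℤ) :
    ii (Zs α β r x) e = iw (fun w => w = mkw α β r) (word (r+1) x (e - 1 - r)) := by
  classical
  unfold ii iw
  simp only [Zs_word]
  congr

lemma word_dep {x x' : ℤ → A} {k : ℤ} (h : ∀ i, k ≤ i → i < k + n → x i = x' i) :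
    word n x k = word n x' k := by
  funext t
  exact h _ (by omega) (by have := t.2; omega)

lemma int_word {μ : Measure (ℤ → A)} [IsProbabilityMeasure μ] (F : (Fin n → A) → ℝ) (k : ℤ) :
    Integrable (fun x => F (word n x k)) μ := by
  classical
  refine Integrable.of_bound ((measurable_of_finite F).comp (measurable_word k)).aestronglyMeasurable
    (∑ w, |F w|) (Eventually.of_forall fun x => ?_)
  rw [Real.norm_eq_abs]
  exact Finset.single_le_sum (f := fun w => |F w|) (fun w _ => abs_nonneg _) (Finset.mem_univ _)

lemma ae_left {μ : Measure (ℤ → A)} {ρ : ℤ → A → ℝ} (hρ : ∀ i, IsProbVec (ρ i))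
    (h : IsProductMeasure μ ρ) {p : A → ℝ} (hlim : ∀ a, Tendsto (fun i : ℤ => ρ i a) cofinite (𝓝 (p a)))
    (hα : 0 < p α) (hβ : 0 < p β) (i : ℤ) : ∀ᵐ x ∂μ, ∃ z ≤ i, z ∈ Zs α β r x := by
  haveI := IsProbVec.nonempty (hρ 0)
  haveI := isProb_of_product h
  have inj : Function.Injective (fun t : ℕ => i - (t:ℤ) - 1 - r) := fun a b hab => by
    simp only at hab; omega
  have hl := lim_word hρ h hlim (iw (fun w => w = mkw α β r)) _ inj
  rw [EP_mk] at hl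
  have hpos : 0 < p α ^ r * p β := by positivity
  have := cheb (μ := μ) (g := fun t x => 1 - iw (fun w => w = mkw α β r) (word (r+1) x (i - (t:ℤ) - 1 - r)))
    (fun t => measurable_const.sub ((measurable_of_finite (iw (fun w => w = mkw α β r))).comp (measurable_word _))) (b := 1)
    (fun t x => by linarith [iw_le_one (fun w => w = mkw α β r) (word (r+1) x (i - (t:ℤ) - 1 - r))])
    (fun t x => by linarith [iw_nonneg (fun w => w = mkw α β r) (word (r+1) x (i - (t:ℤ) - 1 - r))])
    (K := r + 1) (fun t t' htt => by
      refine indep_of_dep hρ h (Finset.Ico (i - (t:ℤ) - 1 - r) (i - t)) (Finset.Ico (i - (t':ℤ) - 1 - r) (i - t')) ?_ ?_ ?_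
      · rw [Finset.disjoint_left]
        intro u hu hu'
        rw [Finset.mem_Ico] at hu hu'
        omega
      · intro x x' hx
        rw [word_dep (x := x) (x' := x') fun u h1 h2 => hx u (Finset.mem_Ico.2 ⟨h1, by push_cast at h2; omega⟩)]
      · intro x x' hx
        rw [word_dep (x := x) (x' := x') fun u h1 h2 => hx u (Finset.mem_Ico.2 ⟨h1, by push_cast at h2; omega⟩)])
    (a := 1 - p α ^ r * p β / 2) (a' := 1) (by
      filter_upwards [hl.eventually_const_le (show p α ^ r * p β / 2 < p α ^ r * p β by linarith)] with t ht
      rw [integral_sub (integrable_const _) (int_word _ _)]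
      simp
      linarith) (by linarith) 1
  filter_upwards [this] with x hx
  obtain ⟨T, hT⟩ := hx
  by_contra hcon
  push Not at hcon
  have : ∀ t ∈ Finset.range T, 1 - iw (fun w => w = mkw α β r) (word (r+1) x (i - (t:ℤ) - 1 - r)) = 1 := by
    intro t _
    rw [← ii_Zs, ii_of_notMem (hcon _ (by omega))]; simp
  rw [Finset.sum_congr rfl this] at hT
  simp at hT
  linarith

lemma ae_X0 {N J : ℕ} {μ : Measure (ℤ → A)} {ρ : ℤ → A → ℝ} (hρ : ∀ i, IsProbVec (ρ i))
    (h : IsProductMeasure μ ρ) {p : A → ℝ} (hlim : ∀ a, Tendsto (fun i : ℤ => ρ i a) cofinite (𝓝 (p a)))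
    (hα : 0 < p α) (hβ : 0 < p β) (hn : 0 < n) (hnN : n ≤ N) (good : C1 → Prop)
    (K : Code A α β n r (C1 × C2))
    (hE : J * EP p (iw fun w => K.act w ∧ ¬ good (K.sym w).1) + EP p (iw fun w => ¬ K.act w)
      + 2 * (N * (p α ^ r * p β)) < 1 / (n : ℝ) - 1 / N) :
    ∀ᵐ x ∂μ, x ∈ X0 J N good K := by
  haveI := IsProbVec.nonempty (hρ 0)
  haveI := isProb_of_product h
  suffices H : ∀ i : ℤ, ∀ᵐ x ∂μ, (∃ z ≤ i, z ∈ Zs α β r x) ∧ (∃ j, hh 1 (Dm (Zs α β r x) N) (Ac K x) i j ≤ 0 ∧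
    hh J (Bd (Ac K x) good (sg K x)) (Ac K x) i j ≤ 0) from ae_all_iff.2 H
  intro i
  let Ba : (ℤ → A) → Set ℤ := fun x => {s | K.act (word n x s) ∧ ¬ good (K.sym (word n x s)).1}
  let Ina : (ℤ → A) → Set ℤ := fun x => {s | ¬ K.act (word n x s)}
  set F1 : (Fin n → A) → ℝ := iw fun w => K.act w ∧ ¬ good (K.sym w).1 with hF1
  set F2 : (Fin n → A) → ℝ := iw fun w => ¬ K.act w with hF2
  set F3 : (Fin (r+1) → A) → ℝ := iw fun w => w = mkw α β r with hF3
  set g : ℕ → (ℤ → A) → ℝ := fun t x => J * F1 (word n x (i+t)) + F2 (word n x (i+t)) +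
    2 * ∑ u ∈ Finset.range N, F3 (word (r+1) x (i + t + 1 + u - 1 - r)) with hg
  have g1 : ∀ t x, g t x = J * ii (Ba x) (i+t) + ii (Ina x) (i+t) + 2 * near (Zs α β r x) N (i+t) := by
    intro t x
    simp only [hg, near, ii_Zs]
    rfl
  have mg : ∀ t, Measurable (g t) := by
    intro t
    refine Measurable.add (Measurable.add (measurable_const.mul ((measurable_of_finite F1).comp (measurable_word _)))
      ((measurable_of_finite F2).comp (measurable_word _))) (measurable_const.mul ?_)
    exact Finset.measurable_sum _ fun u _ => (measurable_of_finite F3).comp (measurable_word _)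
  have hl : Tendsto (fun t => ∫ x, g t x ∂μ) atTop (𝓝 (J * EP p F1 + EP p F2 + 2 * ∑ u ∈ Finset.range N, EP p F3)) := by
    have e : ∀ t, ∫ x, g t x ∂μ = J * ∫ x, F1 (word n x (i+t)) ∂μ + ∫ x, F2 (word n x (i+t)) ∂μ +
        2 * ∑ u ∈ Finset.range N, ∫ x, F3 (word (r+1) x (i + t + 1 + u - 1 - r)) ∂μ := by
      intro t
      simp only [hg]
      rw [integral_add, integral_add, integral_const_mul, integral_const_mul, integral_finset_sum]
      · exact fun u _ => int_word _ _
      · exact (int_word _ _).const_mul _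
      · exact int_word _ _
      · exact ((int_word _ _).const_mul _).add (int_word _ _)
      · exact (integrable_finset_sum _ fun u _ => int_word _ _).const_mul _
    simp only [e]
    refine Tendsto.add (Tendsto.add (Tendsto.const_mul _ ?_) ?_) (Tendsto.const_mul _ (tendsto_finset_sum _ fun u _ => ?_))
    · exact lim_word hρ h hlim F1 (fun t : ℕ => i + (t:ℤ)) (fun a b hab => by simpa using hab)
    · exact lim_word hρ h hlim F2 (fun t : ℕ => i + (t:ℤ)) (fun a b hab => by simpa using hab)
    · exact lim_word hρ h hlim F3 (fun t : ℕ => i + (t:ℤ) + 1 + u - 1 - r) (fun a b hab => by simpa using hab)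
  have e3 : J * EP p F1 + EP p F2 + 2 * ∑ u ∈ Finset.range N, EP p F3 < 1 / (n : ℝ) - 1 / N := by
    rw [hF3, EP_mk]
    simpa using hE
  obtain ⟨a, ha1, ha2⟩ := exists_between e3
  have hc := cheb mg (b := J + 1 + 2 * N) (fun t x => by
      rw [g1]
      have := ii_nonneg (Ba x) (i+t); have := ii_nonneg (Ina x) (i+t); have := near_nonneg (Zs α β r x) N (i+t)
      positivity) (fun t x => by
      rw [g1]
      have h1 := ii_le_one (Ba x) (i+t); have h2 := ii_le_one (Ina x) (i+t)
      have h3 : near (Zs α β r x) N (i+t) ≤ N := by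
        unfold near
        calc _ ≤ ∑ u ∈ Finset.range N, (1:ℝ) := Finset.sum_le_sum fun u _ => ii_le_one _ _
          _ = N := by simp
      have h4 : (J:ℝ) * ii (Ba x) (i+t) ≤ J * 1 := by gcongr
      linarith) (K := r + n + N + 1) (fun t t' htt => by
      have hd : ∀ (t : ℕ) x x', (∀ v ∈ Finset.Ico (i + (t:ℤ) - r) (i + t + n + N), x v = x' v) → g t x = g t x' := by
        intro t x x' hx
        have hx' : ∀ v, i + (t:ℤ) - r ≤ v → v < i + t + n + N → x v = x' v := fun v h1 h2 =>
          hx v (Finset.mem_Ico.2 ⟨h1, h2⟩)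
        simp only [hg]
        rw [word_dep (x := x) (x' := x') (n := n) fun u h1 h2 => hx' u (by omega) (by omega)]
        congr 2
        refine Finset.sum_congr rfl fun u hu => ?_
        rw [Finset.mem_range] at hu
        rw [word_dep (x := x) (x' := x') fun v h1 h2 => hx' v (by omega) (by push_cast at h2; omega)]
      refine indep_of_dep hρ h _ _ ?_ (hd t) (hd t')
      rw [Finset.disjoint_left]
      intro u hu hu'
      rw [Finset.mem_Ico] at hu hu'
      omega) (hl.eventually_le_const ha1) ha2 (n + 1)
  filter_upwards [ae_left (r := r) hρ h hlim hα hβ i, hc] with x hx1 hx2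
  refine ⟨hx1, ?_⟩
  obtain ⟨z, hzi, hz⟩ := hx1
  obtain ⟨T, hT⟩ := hx2
  rcases T with _ | j
  · simp at hT
    have : (0:ℝ) ≤ n := by positivity
    linarith
  · simp only [g1] at hT
    refine ⟨j, height_bound hn hnN hz hzi (Ina x) (Ba x) _ _ ?_ ?_ j hT⟩
    · ext s; simp [Ac, Ina]
    · intro s hs
      exact ⟨hs.1.2, hs.2⟩

end term2
end NF


namespace NF

section chern

lemma chern {S : Type*} [Fintype S] {p u : S → ℝ} (hp : ∑ a, p a = 1) (hu : ∀ a, 0 < u a)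
    (hneg : ∑ a, p a * Real.log (u a) < 0) : ∃ s : ℝ, 0 < s ∧ s < 1 ∧ ∑ a, p a * u a ^ s < 1 := by
  have hd : HasDerivAt (fun s : ℝ => ∑ a, p a * u a ^ s) (∑ a, p a * Real.log (u a)) 0 := by
    have : ∀ a, HasDerivAt (fun s : ℝ => p a * u a ^ s) (p a * Real.log (u a)) 0 := by
      intro a
      have h := ((Real.hasStrictDerivAt_const_rpow (hu a) 0).hasDerivAt).const_mul (p a)
      simpa using h
    exact HasDerivAt.fun_sum (u := Finset.univ) fun a (_ : a ∈ Finset.univ) => this a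
  have h0 : ∑ a, p a * u a ^ (0:ℝ) = 1 := by simpa using hp
  have := hd.tendsto_slope_zero_right
  have h1 := this.eventually_lt_const hneg
  have h2 : ∀ᶠ s : ℝ in 𝓝[>] 0, s < 1 := eventually_nhdsWithin_of_eventually_nhds (eventually_lt_nhds one_pos)
  obtain ⟨s, ⟨hs1, hs2⟩, hs3⟩ := ((h1.and h2).and self_mem_nhdsWithin).exists
  have hs3 : 0 < s := hs3
  refine ⟨s, hs3, hs2, ?_⟩
  simp only [zero_add, h0, smul_eq_mul] at hs1
  have := (inv_mul_lt_iff₀ hs3).1 hs1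
  linarith

lemma sum_prod_pow {S : Type*} [Fintype S] (f : S → ℝ) (n : ℕ) :
    ∑ w : Fin n → S, ∏ t, f (w t) = (∑ a, f a) ^ n := by
  classical
  rw [← Fintype.piFinset_univ, ← Finset.prod_univ_sum]
  simp

/-- probability of large words -/
lemma large_words {S : Type*} [Fintype S] {p : S → ℝ} (hp0 : ∀ a, 0 < p a) (n : ℕ) {τ s c : ℝ} (hc : 0 < c)
    (hs : 0 < s) (hτ : τ = (c ^ n)⁻¹) :
    ∑ w : Fin n → S, (if τ < ∏ t, p (w t) then ∏ t, p (w t) else 0) ≤ (∑ a, p a * (p a * c) ^ s) ^ n := by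
  rw [← sum_prod_pow]
  refine Finset.sum_le_sum fun w _ => ?_
  rw [Finset.prod_mul_distrib]
  have h0 : 0 < ∏ t, p (w t) := Finset.prod_pos fun t _ => hp0 _
  split_ifs with h
  · refine le_mul_of_one_le_right h0.le ?_
    rw [Real.finset_prod_rpow _ _ (fun t _ => by have := hp0 (w t); positivity)]
    refine Real.one_le_rpow ?_ hs.le
    rw [Finset.prod_mul_distrib]
    simp only [Finset.prod_const, Finset.card_univ, Fintype.card_fin]
    rw [hτ] at h
    exact ((inv_lt_iff_one_lt_mul₀ (by positivity)).1 h).le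
  · have : 0 ≤ ∏ i, (p (w i) * c)^s := Finset.prod_nonneg fun t _ => by have := hp0 (w t); positivity
    positivity

lemma min_words {S : Type*} [Fintype S] {q : S → ℝ} (hq0 : ∀ a, 0 < q a) (n : ℕ) {τ s c : ℝ} (hc : 0 < c)
    (hs : 0 < s) (hs1 : s < 1) (hτ0 : 0 < τ) (hτ : τ ≤ (c ^ n)⁻¹) :
    ∑ w : Fin n → S, min (∏ t, q (w t)) τ ≤ (∑ a, q a * ((q a * c)⁻¹) ^ s) ^ n := by
  rw [← sum_prod_pow]
  refine Finset.sum_le_sum fun w _ => ?_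
  rw [Finset.prod_mul_distrib]
  have h0 : 0 < ∏ t, q (w t) := Finset.prod_pos fun t _ => hq0 _
  rw [Real.finset_prod_rpow _ _ (fun t _ => by have := hq0 (w t); positivity)]
  rw [Finset.prod_inv_distrib, Finset.prod_mul_distrib]
  simp only [Finset.prod_const, Finset.card_univ, Fintype.card_fin]
  set a := ∏ t, q (w t) with ha
  set z := (a * c^n)⁻¹ with hz
  have hz0 : 0 < z := by positivity
  have hτz : τ ≤ a * z := by
    rw [hz, mul_inv, ← mul_assoc, mul_inv_cancel₀ h0.ne', one_mul]; exact hτ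
  rcases le_total 1 z with h | h
  · exact (min_le_left _ _).trans (le_mul_of_one_le_right h0.le (Real.one_le_rpow h hs.le))
  · refine (min_le_right _ _).trans (hτz.trans ?_)
    gcongr
    calc z = z ^ (1:ℝ) := (Real.rpow_one z).symm
      _ ≤ z ^ s := Real.rpow_le_rpow_of_exponent_ge hz0 h hs1.le

lemma sum_run {S : Type*} [Fintype S] {p : S → ℝ} (hp0 : ∀ a, 0 ≤ p a) (hp : ∑ a, p a = 1) {n r : ℕ} (α : S)
    (I : Finset (Fin n)) (hI : I.card = r) :
    ∑ w : Fin n → S, (open Classical in if ∀ t ∈ I, w t = α then ∏ t, p (w t) else 0) = p α ^ r := by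
  classical
  have e : ∀ w : Fin n → S, (if ∀ t ∈ I, w t = α then ∏ t, p (w t) else 0) =
      ∏ t, (if t ∈ I → w t = α then p (w t) else 0) := by
    intro w
    split_ifs with h
    · refine Finset.prod_congr rfl fun t _ => ?_
      rw [if_pos (h t)]
    · push Not at h
      obtain ⟨t, ht, h⟩ := h
      symm
      apply Finset.prod_eq_zero (Finset.mem_univ t)
      rw [if_neg]
      exact fun h' => h (h' ht)
  calc _ = ∑ w : Fin n → S, ∏ t, (if t ∈ I → w t = α then p (w t) else 0) := by
        refine Finset.sum_congr rfl fun w _ => ?_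
        rw [← e w]
    _ = ∏ t : Fin n, ∑ a, (if t ∈ I → a = α then p a else 0) := by
        rw [Finset.prod_univ_sum, Fintype.piFinset_univ]
    _ = ∏ t : Fin n, (if t ∈ I then p α else 1) := by
        refine Finset.prod_congr rfl fun t _ => ?_
        by_cases ht : t ∈ I
        · simp [ht]
        · simp [ht, hp]
    _ = _ := by
        rw [Finset.prod_ite_mem, Finset.univ_inter]; simp [hI]

end chern
end NF


namespace NF

section codex

lemma abstract_code {W Kk C : Type*} [Fintype W] [Fintype Kk] [Fintype C] [Nonempty C]
    (P : W → Prop) (key : W → Kk) :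
    ∃ (act : W → Prop) (rep : W → C → W) (sym : W → C),
      (∀ w, act w → P w) ∧ (∀ w c, act w → act (rep w c)) ∧ (∀ w c, act w → sym (rep w c) = c) ∧
      (∀ w, act w → rep w (sym w) = w) ∧ (∀ w c c', act w → rep (rep w c) c' = rep w c') ∧
      (∀ w c, act w → key (rep w c) = key w) ∧
      Nat.card {w // P w ∧ ¬ act w} ≤ Fintype.card Kk * Fintype.card C := by
  classical
  set κ := Fintype.card C with hκ
  have hκ0 : 0 < κ := Fintype.card_pos
  let S : Kk → Type _ := fun k => {w : W // P w ∧ key w = k}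
  have emb : ∀ k, Nonempty ((Fin (Fintype.card (S k) / κ) × C) ↪ S k) := by
    intro k
    apply Function.Embedding.nonempty_of_card_le
    rw [Fintype.card_prod, Fintype.card_fin]
    exact Nat.div_mul_le_self _ _
  let em := fun k => (emb k).some
  let D := Σ k, Fin (Fintype.card (S k) / κ)
  let f : D × C → W := fun d => (em d.1.1 (d.1.2, d.2)).1
  have fP : ∀ d, P (f d) := fun d => (em d.1.1 (d.1.2, d.2)).2.1
  have fk : ∀ d, key (f d) = d.1.1 := fun d => (em d.1.1 (d.1.2, d.2)).2.2
  have fi : Function.Injective f := by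
    rintro ⟨⟨k, i⟩, c⟩ ⟨⟨k', i'⟩, c'⟩ h
    have h1 : k = k' := by
      have h2 := fk ((⟨k, i⟩ : D), c)
      have h3 := fk ((⟨k', i'⟩ : D), c')
      rw [h, h3] at h2
      exact h2.symm
    subst h1
    have := (em k).injective (Subtype.ext h)
    simp only [Prod.mk.injEq] at this
    obtain ⟨rfl, rfl⟩ := this
    rfl
  have c0 : C := Classical.arbitrary C
  let inv : (w : W) → (∃ d, f d = w) → D × C := fun w h => h.choose
  have hinv : ∀ w h, f (inv w h) = w := fun w h => h.choose_spec
  have hinv' : ∀ d h, inv (f d) h = d := fun d h => fi (hinv _ h)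
  refine ⟨fun w => ∃ d, f d = w, fun w c => if h : ∃ d, f d = w then f ((inv w h).1, c) else w,
    fun w => if h : ∃ d, f d = w then (inv w h).2 else c0, ?_, ?_, ?_, ?_, ?_, ?_, ?_⟩
  · rintro w ⟨d, rfl⟩; exact fP d
  · intro w c h
    simp only [dif_pos h]
    exact ⟨_, rfl⟩
  · intro w c h
    simp only [dif_pos h]
    rw [dif_pos ⟨_, rfl⟩, hinv']
  · intro w h
    simp only [dif_pos h]
    exact hinv w h
  · intro w c c' h
    simp only [dif_pos h]
    rw [dif_pos ⟨_, rfl⟩, hinv']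
  · intro w c h
    simp only [dif_pos h]
    rw [fk]
    conv_rhs => rw [← hinv w h, fk]
  · -- leftover count
    change Nat.card {w // P w ∧ ¬ ∃ d, f d = w} ≤ _
    rw [Nat.card_eq_fintype_card]
    have hP : Fintype.card {w // P w} = ∑ k, Fintype.card (S k) := by
      rw [← Fintype.card_sigma]
      refine Fintype.card_congr ⟨fun w => ⟨key w.1, w.1, w.2, rfl⟩, fun s => ⟨s.2.1, s.2.2.1⟩, fun w => rfl, ?_⟩
      rintro ⟨k, w, hw, rfl⟩; rfl
    have hD : Fintype.card (D × C) = ∑ k, Fintype.card (S k) / κ * κ := by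
      rw [Fintype.card_prod, Fintype.card_sigma, Finset.sum_mul]
      simp [hκ]
    have hR : Fintype.card {w // ∃ d, f d = w} = Fintype.card (D × C) := by
      rw [Fintype.card_congr (Equiv.ofInjective f fi)]
      exact Fintype.card_congr (Equiv.refl _)
    have hsplit : Fintype.card {w // P w ∧ ¬ ∃ d, f d = w} + Fintype.card {w // ∃ d, f d = w} = Fintype.card {w // P w} := by
      rw [Fintype.card_subtype, Fintype.card_subtype, Fintype.card_subtype, ← Finset.card_union_of_disjoint]
      · congr 1
        ext w
        simp only [Finset.mem_union, Finset.mem_filter, Finset.mem_univ, true_and]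
        constructor
        · rintro (h | ⟨d, rfl⟩)
          · exact h.1
          · exact fP d
        · intro h
          by_cases h2 : ∃ d, f d = w
          · exact Or.inr h2
          · exact Or.inl ⟨h, h2⟩
      · rw [Finset.disjoint_left]
        intro w h1 h2
        simp only [Finset.mem_filter, Finset.mem_univ, true_and] at h1 h2
        exact h1.2 h2
    rw [hR, hP, hD] at hsplit
    have h3 : ∑ k, Fintype.card (S k) ≤ ∑ k, (Fintype.card (S k) / κ * κ) + Fintype.card Kk * κ := by
      have : Fintype.card Kk * κ = ∑ k : Kk, κ := by simp
      rw [this, ← Finset.sum_add_distrib]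
      refine Finset.sum_le_sum fun k _ => ?_
      have h1 := Nat.div_add_mod (Fintype.card (S k)) κ
      have h2 := Nat.mod_lt (Fintype.card (S k)) hκ0
      rw [mul_comm] at h1
      omega
    omega

variable {A : Type*} [Fintype A] {α β : A} {n r : ℕ} {C : Type*} [Fintype C] [Nonempty C]

/-- a word avoids the marker -/
def avd (α β : A) (n r : ℕ) (w : Fin n → A) : Prop :=
  ∀ (e : ℕ) (h : e + r < n), w ⟨e + r, h⟩ = β → ¬ ∀ u (hu : u < r), w ⟨e + u, by omega⟩ = α

lemma exists_code (α β : A) (n r : ℕ) (C : Type*) [Fintype C] [Nonempty C] :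
    ∃ K : Code A α β n r C, Nat.card {w // avd α β n r w ∧ ¬ K.act w} ≤
      Fintype.card A ^ (2 * r) * (n + 1) ^ Fintype.card A * Fintype.card C := by
  classical
  rcases isEmpty_or_nonempty A with hA | hA
  · exact hA.elim α
  let Bi := {i : Fin n // i.1 < r ∨ n ≤ i.1 + r}
  let key : (Fin n → A) → (Bi → A) × (A → Fin (n+1)) := fun w =>
    (fun i => w i.1, fun a => ⟨(Finset.univ.filter fun i => w i = a).card,
      Nat.lt_succ_of_le ((Finset.card_le_univ _).trans (by simp))⟩)
  obtain ⟨act, rep, sym, h1, h2, h3, h4, h5, h6, h7⟩ := abstract_code (C := C) (avd α β n r) key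
  refine ⟨⟨act, rep, sym, h2, h3, h4, h5, h1, ?_, ?_⟩, h7.trans ?_⟩
  · intro w c hw i hi
    exact congrFun (congrArg Prod.fst (h6 w c hw)) ⟨i, hi⟩
  · intro w c hw f
    have hk := congrArg Prod.snd (h6 w c hw)
    have e : ∀ v : Fin n → A, ∏ i, f (v i) = ∏ a, f a ^ ((key v).2 a).1 := by
      intro v
      rw [← Finset.prod_fiberwise_of_maps_to (s := Finset.univ) (t := Finset.univ) (g := v) (fun i _ => Finset.mem_univ _)]
      refine Finset.prod_congr rfl fun a _ => ?_
      rw [Finset.prod_congr rfl (g := fun _ => f a), Finset.prod_const]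
      intro i hi
      rw [(Finset.mem_filter.1 hi).2]
    rw [e, e, hk]
  · gcongr
    rw [Fintype.card_prod, Fintype.card_fun, Fintype.card_fun, Fintype.card_fin]
    gcongr
    · exact Fintype.card_pos
    · rw [Fintype.card_subtype]
      calc (Finset.univ.filter fun i : Fin n => i.1 < r ∨ n ≤ i.1 + r).card
          ≤ (((Finset.range r) ∪ (Finset.Ico (n - r) n))).card := by
            rw [← Finset.card_map Fin.valEmbedding]
            apply Finset.card_le_card
            intro i hi
            simp only [Finset.mem_map, Finset.mem_filter, Finset.mem_univ, true_and, Fin.valEmbedding_apply] at hi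
            obtain ⟨j, hj, rfl⟩ := hi
            simp only [Finset.mem_union, Finset.mem_range, Finset.mem_Ico]
            have := j.2
            omega
        _ ≤ _ := (Finset.card_union_le _ _).trans (by simp; omega)

end codex
end NF


namespace NF

section bounds
variable {A : Type*} [Fintype A] {α β : A} {n r : ℕ}

lemma EP_notavd {p : A → ℝ} (hp0 : ∀ a, 0 ≤ p a) (hp : ∑ a, p a = 1) :
    EP p (iw fun w => ¬ avd α β n r w) ≤ n * p α ^ r := by
  classical
  have key : ∀ w : Fin n → A, iw (fun w => ¬ avd α β n r w) w * ∏ t, p (w t) ≤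
      ∑ e ∈ Finset.range n, if h : e + r < n then
        (if ∀ t ∈ (Finset.univ.filter fun i : Fin n => e ≤ i.1 ∧ i.1 < e + r), w t = α then ∏ t, p (w t) else 0) else 0 := by
    intro w
    have h0 : 0 ≤ ∏ t, p (w t) := Finset.prod_nonneg fun t _ => hp0 _
    unfold iw
    split_ifs with h
    · unfold avd at h
      push Not at h
      obtain ⟨e, he, -, hu⟩ := h
      rw [one_mul]
      refine le_trans ?_ (Finset.single_le_sum (fun e _ => ?_) (Finset.mem_range.2 (show e < n by omega)))
      · rw [dif_pos he, if_pos]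
        intro t ht
        simp only [Finset.mem_filter, Finset.mem_univ, true_and] at ht
        have := hu (t.1 - e) (by omega)
        rw [← this]
        congr 1
        ext; simp; omega
      · split_ifs <;> simp [h0]
    · rw [zero_mul]
      refine Finset.sum_nonneg fun e _ => ?_
      split_ifs <;> simp [h0]
  unfold EP
  refine (Finset.sum_le_sum fun w _ => key w).trans ?_
  rw [Finset.sum_comm]
  calc _ ≤ ∑ e ∈ Finset.range n, p α ^ r := by
        refine Finset.sum_le_sum fun e _ => ?_
        by_cases h : e + r < n
        · simp only [dif_pos h]
          rw [← sum_run hp0 hp α (Finset.univ.filter fun i : Fin n => e ≤ i.1 ∧ i.1 < e + r) (r := r) ?_]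
          · rw [← Finset.card_map Fin.valEmbedding]
            have : (Finset.univ.filter fun i : Fin n => e ≤ i.1 ∧ i.1 < e + r).map Fin.valEmbedding = Finset.Ico e (e + r) := by
              ext i
              simp only [Finset.mem_map, Finset.mem_filter, Finset.mem_univ, true_and, Fin.valEmbedding_apply, Finset.mem_Ico]
              constructor
              · rintro ⟨j, hj, rfl⟩; exact hj
              · intro hi; exact ⟨⟨i, by omega⟩, hi, rfl⟩
            rw [this]; simp
        · simp only [dif_neg h]
          simp only [Finset.sum_const_zero]
          exact pow_nonneg (hp0 _) _
    _ = _ := by simp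

lemma EP_inact {p : A → ℝ} (hp0 : ∀ a, 0 < p a) (hp : ∑ a, p a = 1) {C : Type*} {M : ℕ} (K : Code A α β n r C)
    (hK : Nat.card {w // avd α β n r w ∧ ¬ K.act w} ≤ M) {c s : ℝ} (hc : 0 < c) (hs : 0 < s) :
    EP p (iw fun w => ¬ K.act w) ≤ n * p α ^ r + (∑ a, p a * (p a * c) ^ s) ^ n + M * (c ^ n)⁻¹ := by
  classical
  have hX : (∑ w : Fin n → A, if avd α β n r w ∧ ¬ K.act w then (c^n)⁻¹ else 0) ≤ M * (c ^ n)⁻¹ := by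
    rw [← Finset.sum_filter, Finset.sum_const, nsmul_eq_mul]
    gcongr
    rw [Nat.card_eq_fintype_card, Fintype.card_subtype] at hK
    exact hK
  refine le_trans ?_ (add_le_add (add_le_add (EP_notavd (β := β) (n := n) (r := r) (α := α) (fun a => (hp0 a).le) hp)
    (large_words hp0 n hc hs rfl)) hX)
  · unfold EP
    rw [← Finset.sum_add_distrib, ← Finset.sum_add_distrib]
    refine Finset.sum_le_sum fun w _ => ?_
    have h0 : 0 < ∏ t, p (w t) := Finset.prod_pos fun t _ => hp0 _
    have hc' : 0 < (c^n)⁻¹ := by positivity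
    unfold iw
    by_cases h1 : K.act w <;> by_cases h2 : avd α β n r w <;> by_cases h3 : (c^n)⁻¹ < ∏ t, p (w t) <;>
      simp only [h1, h2, h3, not_true, not_false_iff, if_true, if_false, and_true, and_false, true_and, false_and] <;> linarith

lemma EP_bad [MeasurableSpace A] [MeasurableSingletonClass A] {p : A → ℝ} (hp0 : ∀ a, 0 < p a) (hp : ∑ a, p a = 1) {C1 C2 : Type*} [Fintype C1] [Fintype C2]
    [Nonempty C1] [Nonempty C2]
    (K : Code A α β n r (C1 × C2)) (good : C1 → Prop) :
    EP p (iw fun w => K.act w ∧ ¬ good (K.sym w).1) ≤ (Nat.card {c // ¬ good c} : ℝ) / Fintype.card C1 := by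
  classical
  have hsw := K.sum_swap (fun w w' => (if ¬ good (K.sym w).1 then ∏ t, p (w t) else 0))
  have hl : ∑ w with K.act w, ∑ c : C1 × C2, (if ¬ good (K.sym w).1 then ∏ t, p (w t) else 0) =
      (Fintype.card C1 * Fintype.card C2 : ℝ) * EP p (iw fun w => K.act w ∧ ¬ good (K.sym w).1) := by
    simp only [Finset.sum_const, Finset.card_univ, nsmul_eq_mul, ← Finset.mul_sum, Fintype.card_prod]
    push_cast
    congr 1
    rw [Finset.sum_filter]
    unfold EP iw
    refine Finset.sum_congr rfl fun w _ => ?_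
    by_cases h1 : K.act w <;> by_cases h2 : good (K.sym w).1 <;> simp [h1, h2]
  have hr : ∑ w with K.act w, ∑ c : C1 × C2, (if ¬ good (K.sym (K.rep w c)).1 then ∏ t, p (K.rep w c t) else 0) ≤
      (Nat.card {c // ¬ good c} : ℝ) * Fintype.card C2 := by
    have h1 : ∀ w ∈ Finset.univ.filter (fun w => K.act w), ∑ c : C1 × C2, (if ¬ good (K.sym (K.rep w c)).1 then ∏ t, p (K.rep w c t) else 0) =
        ((Nat.card {c // ¬ good c} : ℝ) * Fintype.card C2) * ∏ t, p (w t) := by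
      intro w hw
      have hw := (Finset.mem_filter.1 hw).2
      have : ∀ c : C1 × C2, (if ¬ good (K.sym (K.rep w c)).1 then ∏ t, p (K.rep w c t) else 0) = if ¬ good c.1 then ∏ t, p (w t) else 0 := by
        intro c
        rw [K.sym_rep _ _ hw, K.cnt _ _ hw p]
      rw [Finset.sum_congr rfl fun c _ => this c, Fintype.sum_prod_type]
      rw [Finset.sum_congr rfl (g := fun c : C1 => (Fintype.card C2 : ℝ) * (if ¬ good c then ∏ t, p (w t) else 0))
        (fun c _ => by by_cases hc : good c <;> simp [hc])]
      rw [← Finset.mul_sum, ← Finset.sum_filter, Finset.sum_const, nsmul_eq_mul, Nat.card_eq_fintype_card, Fintype.card_subtype]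
      ring
    rw [Finset.sum_congr rfl h1, ← Finset.mul_sum]
    have h2 : ∑ w with K.act w, ∏ t, p (w t) ≤ 1 := by
      calc _ ≤ ∑ w : Fin n → A, ∏ t, p (w t) :=
            Finset.sum_le_sum_of_subset_of_nonneg (Finset.filter_subset _ _) fun w _ _ => Finset.prod_nonneg fun t _ => (hp0 _).le
        _ = 1 := by rw [sum_prod_pow, hp, one_pow]
    exact mul_le_of_le_one_right (by positivity) h2
  have h3 : (0:ℝ) < Fintype.card C1 := by exact_mod_cast Fintype.card_pos
  have h4 : (0:ℝ) < Fintype.card C2 := by exact_mod_cast Fintype.card_pos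
  rw [le_div_iff₀ h3]
  have h5 : (Fintype.card C1 * Fintype.card C2 : ℝ) * EP p (iw fun w => K.act w ∧ ¬ good (K.sym w).1) ≤
      (Nat.card {c // ¬ good c} : ℝ) * Fintype.card C2 := by
    rw [← hl]
    refine le_trans (le_of_eq ?_) hr
    convert hsw
  refine le_of_mul_le_mul_right ?_ h4
  linarith [h5]

end bounds

section target

lemma exists_target {B : Type} [Fintype B] {q : B → ℝ} (hq : IsProbVec q)
    {l : ℕ} (a : B → ℕ) (ha : ∀ b, q b * 2 ^ l = a b) (N e : ℕ) :
    ∃ (C1 : Type) (_ : Fintype C1) (good : C1 → Prop) (G : C1 → (Fin (l * N) → Bool) → (Fin N → B)),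
      Fintype.card C1 = 2 ^ e ∧
      (∀ w, ∀ D : DecidablePred fun p : C1 × (Fin (l * N) → Bool) => G p.1 p.2 = w,
        av (fun p : C1 × (Fin (l * N) → Bool) => if G p.1 p.2 = w then (1 : ℝ) else 0) = ∏ t, q (w t)) ∧
      (∀ c, good c → ∀ e e', G c e = G c e') ∧
      (Nat.card {c // ¬ good c} : ℝ) / Fintype.card C1 ≤ ∑ w : Fin N → B, min (∏ t, q (w t)) ((2:ℝ)^e)⁻¹ := by
  classical
  set J := l * N with hJ
  set k : (Fin N → B) → ℕ := fun w => (∏ t, a (w t)) * 2 ^ e with hk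
  have kq : ∀ w, (k w : ℝ) = (∏ t, q (w t)) * 2 ^ (e + J) := by
    intro w
    simp only [hk, Nat.cast_mul, Nat.cast_prod, ← ha, Finset.prod_mul_distrib]
    simp only [Finset.prod_const, Finset.card_univ, Fintype.card_fin, hJ]
    push_cast
    ring
  have ksum : ∑ w, k w = 2 ^ (e + J) := by
    have : ((∑ w, k w : ℕ) : ℝ) = (2 ^ (e + J) : ℕ) := by
      push_cast
      simp only [kq]
      rw [← Finset.sum_mul, sum_prod_pow, hq.2]; simp
    exact_mod_cast this
  set g : (Fin N → B) → ℕ := fun w => k w / 2 ^ J with hg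
  set rr : (Fin N → B) → ℕ := fun w => k w % 2 ^ J with hrr
  have gr : ∀ w, g w * 2 ^ J + rr w = k w := fun w => by
    have := Nat.div_add_mod (k w) (2^J); rw [mul_comm] at this; exact this
  have gsum : (∑ w, g w) * 2 ^ J + ∑ w, rr w = 2 ^ e * 2 ^ J := by
    rw [Finset.sum_mul, ← Finset.sum_add_distrib, Finset.sum_congr rfl fun w _ => gr w, ksum, pow_add]
  have h2J : 0 < 2 ^ J := by positivity
  have gle : ∑ w, g w ≤ 2 ^ e := by
    by_contra hcon
    push Not at hcon
    have := (Nat.mul_lt_mul_right h2J).2 hcon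
    omega
  obtain ⟨b, hb⟩ := Nat.exists_eq_add_of_le gle
  have bsum : b * 2 ^ J = ∑ w, rr w := by
    rw [hb, add_mul] at gsum; omega
  have hE : Nonempty (Fin b × (Fin J → Bool) ≃ Σ w, Fin (rr w)) := by
    rw [← Fintype.card_eq]
    rw [Fintype.card_sigma, Fintype.card_prod]
    simp [bsum]
  obtain ⟨E⟩ := hE
  have hcard : Fintype.card ((Σ w, Fin (g w)) ⊕ Fin b) = 2 ^ e := by
    rw [Fintype.card_sum, Fintype.card_sigma]; simp [hb]
  refine ⟨(Σ w, Fin (g w)) ⊕ Fin b, inferInstance, fun c => c.isLeft = true,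
    fun c ee => Sum.elim (fun s => s.1) (fun i => (E (i, ee)).1) c, hcard, ?_, ?_, ?_⟩
  · intro w D
    unfold av
    rw [Fintype.card_prod, hcard, Fintype.sum_prod_type, Fintype.sum_sum_type]
    simp only [Sum.elim_inl, Sum.elim_inr]
    have e1 : ∑ s : Σ w, Fin (g w), ∑ y : Fin J → Bool, (if s.1 = w then (1:ℝ) else 0) = g w * 2 ^ J := by
      rw [Fintype.sum_sigma]
      simp
    have e2 : ∑ i : Fin b, ∑ y : Fin J → Bool, (if (E (i, y)).1 = w then (1:ℝ) else 0) = rr w := by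
      rw [← Fintype.sum_prod_type', E.sum_comp (fun s => if s.1 = w then (1:ℝ) else 0), Fintype.sum_sigma, Finset.sum_eq_single w]
      · simp
      · intro w' _ h; simp [h]
      · simp
    have e1' := e1
    have e2' := e2
    rw [div_eq_iff (by positivity)]
    have : (g w : ℝ) * 2 ^ J + rr w = k w := by exact_mod_cast gr w
    rw [kq] at this
    simp only [Fintype.card_fun, Fintype.card_bool, Fintype.card_fin]
    push_cast
    rw [pow_add] at this
    rw [← this]
    congr 1
    · rw [← e1]; refine Finset.sum_congr rfl fun s _ => Finset.sum_congr rfl fun y _ => ?_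
      congr
    · rw [← e2]; refine Finset.sum_congr rfl fun s _ => Finset.sum_congr rfl fun y _ => ?_
      congr
  · rintro (c | c) hc e e'
    · rfl
    · simp at hc
  · have hbad : Nat.card {c : (Σ w, Fin (g w)) ⊕ Fin b // ¬ c.isLeft = true} = b := by
      refine Eq.trans (Nat.card_congr (β := Fin b) ⟨fun c => match c with | ⟨Sum.inr i, _⟩ => i | ⟨Sum.inl i, h⟩ => absurd rfl h, fun i => ⟨Sum.inr i, by simp⟩, ?_, ?_⟩) (by simp)
      · rintro ⟨c | c, hc⟩
        · exact absurd rfl hc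
        · rfl
      · intro i; rfl
    rw [hbad, hcard]
    have hb2 : (b : ℝ) * 2 ^ J = ∑ w, (rr w : ℝ) := by exact_mod_cast bsum
    have : (b : ℝ) / (2^e : ℕ) = ∑ w, (rr w : ℝ) / (2^e * 2^J) := by
      rw [← Finset.sum_div, ← hb2]; push_cast; field_simp
    rw [this]
    refine Finset.sum_le_sum fun w _ => le_min ?_ ?_
    · rw [div_le_iff₀ (by positivity), ← pow_add, ← kq]
      exact_mod_cast Nat.mod_le _ _
    · rw [div_le_iff₀ (by positivity), ← mul_assoc, inv_mul_cancel₀ (by positivity), one_mul]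
      exact_mod_cast (Nat.mod_lt _ h2J).le

end target
end NF


namespace NF

/-- mixture of uniform and a point mass -/
noncomputable def qf (k : ℕ) (θ : ℝ) (b : Fin (2^k)) : ℝ :=
  θ / 2^k + (1-θ) * (if b.1 = 0 then 1 else 0)

lemma qf_sum (k : ℕ) (θ : ℝ) : ∑ b, qf k θ b = 1 := by
  unfold qf
  rw [Finset.sum_add_distrib, ← Finset.mul_sum]
  have : ∑ b : Fin (2^k), (if b.1 = 0 then (1:ℝ) else 0) = 1 := by
    rw [Finset.sum_eq_single ⟨0, by positivity⟩]
    · simp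
    · intro b _ hb
      rw [if_neg]
      intro h; exact hb (Fin.ext h)
    · simp
  rw [this]
  simp
  field_simp
  ring

lemma entropy_cont (k : ℕ) : Continuous fun θ => entropy (qf k θ) := by
  have : (fun θ => entropy (qf k θ)) = fun θ => (∑ b, Real.negMulLog (qf k θ b)) / Real.log 2 := by
    funext θ
    unfold entropy
    rw [Finset.sum_div, ← Finset.sum_neg_distrib]
    refine Finset.sum_congr rfl fun b _ => ?_
    unfold Real.negMulLog Real.logb
    ring
  rw [this]
  refine Continuous.div_const (continuous_finset_sum _ fun b _ => Real.continuous_negMulLog.comp ?_) _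
  unfold qf
  fun_prop

lemma entropy_zero (k : ℕ) : entropy (qf k 0) = 0 := by
  unfold entropy
  rw [neg_eq_zero]
  refine Finset.sum_eq_zero fun b _ => ?_
  unfold qf
  split_ifs <;> simp

lemma entropy_one (k : ℕ) : entropy (qf k 1) = k := by
  unfold entropy qf
  simp [Real.logb_inv, Real.logb_pow]

lemma dyadic_dense {U : Set ℝ} (hU : IsOpen U) {x : ℝ} (hx : x ∈ U) (hx0 : 0 < x) :
    ∃ (j c : ℕ), (c : ℝ) / 2^j ∈ U := by
  have hl : Tendsto (fun j : ℕ => ((⌊x * 2^j⌋₊ : ℕ) : ℝ) / 2^j) atTop (𝓝 x) := by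
    have h1 := (tendsto_nat_floor_mul_div_atTop hx0.le).comp
      (tendsto_pow_atTop_atTop_of_one_lt (one_lt_two : (1:ℝ) < 2))
    exact h1
  obtain ⟨j, hj⟩ := (hl.eventually (hU.mem_nhds hx)).exists
  exact ⟨j, _, hj⟩

lemma exists_q {H ε : ℝ} (hH : 0 < H) (hε : 0 < ε) :
    ∃ (m : ℕ) (q : Fin m → ℝ) (l : ℕ) (a : Fin m → ℕ), IsProbVec q ∧ (∀ b, 0 < q b) ∧
      (∀ b, q b * 2^l = a b) ∧ H - ε < entropy q ∧ entropy q < H := by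
  obtain ⟨k, hk⟩ := exists_nat_ge H
  set v0 := max (H - ε) 0 with hv0
  have hv : v0 < H := max_lt (by linarith) hH
  set v := (v0 + H)/2 with hvd
  have v0p : 0 ≤ v0 := le_max_right _ _
  have hmem : v ∈ Ioo (entropy (qf k 0)) (entropy (qf k 1)) := by
    rw [entropy_zero, entropy_one]
    constructor <;> linarith
  obtain ⟨x, hx, hxv⟩ := intermediate_value_Ioo (zero_le_one) (entropy_cont k).continuousOn hmem
  have hU : IsOpen (Ioo (0:ℝ) 1 ∩ (fun θ => entropy (qf k θ)) ⁻¹' Ioo v0 H) :=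
    isOpen_Ioo.inter (isOpen_Ioo.preimage (entropy_cont k))
  have hxv' : entropy (qf k x) = v := hxv
  obtain ⟨j, c, hθ, h1, h2⟩ := dyadic_dense hU (x := x) ⟨hx, by
    show entropy (qf k x) ∈ Ioo v0 H
    rw [hxv']
    constructor <;> linarith⟩ hx.1
  set θ := (c:ℝ)/2^j with hθd
  have hpos : ∀ b, 0 < qf k θ b := by
    intro b
    unfold qf
    have := hθ.1
    have h3 : 0 < 1 - θ := by linarith [hθ.2]
    have : 0 < θ/2^k := by positivity
    have : 0 ≤ (1-θ) * (if b.1 = 0 then 1 else 0) := mul_nonneg h3.le (by split_ifs <;> norm_num)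
    linarith
  have hc : c ≤ 2^j := by
    have := hθ.2
    rw [hθd, div_lt_one (by positivity)] at this
    exact_mod_cast this.le
  refine ⟨2^k, qf k θ, j + k, fun b => c + 2^k * (2^j - c) * (if b.1 = 0 then 1 else 0),
    ⟨fun b => (hpos b).le, qf_sum k θ⟩, hpos, ?_, ?_, h2⟩
  · intro b
    unfold qf
    push_cast [hc]
    rw [hθd, pow_add]
    field_simp
  · exact lt_of_le_of_lt (le_max_left _ _) h1

end NF


namespace NF

lemma asym {θp θq ζ x y : ℝ} (hθp : 0 ≤ θp) (hθp1 : θp < 1) (hθq : 0 ≤ θq) (hθq1 : θq < 1)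
    (hζ : 0 ≤ ζ) (hζ1 : ζ < 1) (hx : 0 ≤ x) (hx1 : x < 1) (l n0 a : ℕ) (hn0 : 0 < n0) :
    ∃ t : ℕ, 0 < t ∧ (l * ((n0+1)*t)) * θq^((n0+1)*t) + (n0 * t * x^t + θp^(n0*t) + 2 * (n0*t+1)^a * ζ^t)
      + 2 * ((n0+1)*t * (x^t * y)) < 1/((n0:ℝ)*t) - 1/((n0+1)*t) := by
  have T : ∀ (k : ℕ) {z : ℝ}, 0 ≤ z → z < 1 → Tendsto (fun t : ℕ => (t:ℝ)^k * z^t) atTop (𝓝 0) := by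
    intro k z h0 h1
    exact tendsto_pow_const_mul_const_pow_of_abs_lt_one k (by rwa [abs_of_nonneg h0])
  have h1 := (T 2 (pow_nonneg hθq (n0+1)) (pow_lt_one₀ hθq hθq1 (by omega))).const_mul ((l:ℝ) * (n0+1))
  have h2 := (T 2 hx hx1).const_mul (n0:ℝ)
  have h3 := (T 1 (pow_nonneg hθp n0) (pow_lt_one₀ hθp hθp1 (by omega)))
  have h4 := (T (a+1) hζ hζ1).const_mul (2 * ((n0:ℝ)+1)^a)
  have h5 := (T 2 hx hx1).const_mul (2*((n0:ℝ)+1)*y)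
  have hs := ((h1.add ((h2.add h3).add h4)).add h5)
  have hR : (0:ℝ) < 1/(n0*(n0+1)) := by positivity
  have hev := hs.eventually_lt_const (u := 1/((n0:ℝ)*(n0+1))) (by simpa using hR)
  obtain ⟨t, ht, ht0⟩ := (hev.and (eventually_gt_atTop 0)).exists
  refine ⟨t, ht0, ?_⟩
  have tp : (0:ℝ) < t := by exact_mod_cast ht0
  have t1 : (1:ℝ) ≤ t := by exact_mod_cast ht0
  have n0p : (0:ℝ) < n0 := by exact_mod_cast hn0
  have hr : 1/((n0:ℝ)*t) - 1/((n0+1)*t) = (1/((n0:ℝ)*(n0+1)))/t := by field_simp; ring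
  rw [hr, lt_div_iff₀ tp]
  refine lt_of_le_of_lt ?_ ht
  have hb : ((n0:ℝ)*t+1)^a ≤ ((n0+1)*t)^a := by
    gcongr
    linarith
  have hb' : 2 * ((n0:ℝ)*t+1)^a * ζ^t * t ≤ 2 * ((n0+1)*t)^a * ζ^t * t := by gcongr
  have e4 : 2 * (((n0:ℝ)+1)*t)^a * ζ^t * t = 2 * ((n0:ℝ)+1)^a * (t^(a+1) * ζ^t) := by
    rw [mul_pow, pow_succ]; ring
  rw [pow_mul θq, pow_mul θp]
  rw [e4] at hb'
  nlinarith [hb']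

lemma sum_log {S : Type*} [Fintype S] {p : S → ℝ} (hp : ∑ a, p a = 1) (h0 : ∀ a, 0 < p a) (d : ℝ) :
    ∑ a, p a * Real.log (p a * 2^d) = Real.log 2 * (d - entropy p) := by
  have : ∀ a, p a * Real.log (p a * 2^d) = Real.log 2 * (d * p a + p a * Real.logb 2 (p a)) := by
    intro a
    rw [Real.log_mul (h0 a).ne' (by positivity), Real.log_rpow (by norm_num), Real.logb]
    have : Real.log 2 ≠ 0 := (Real.log_pos one_lt_two).ne'
    field_simp
    ring
  simp only [this]
  rw [← Finset.mul_sum, Finset.sum_add_distrib, ← Finset.mul_sum, hp]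
  unfold entropy
  ring

theorem main_pos {A : Type*} [Fintype A] [MeasurableSpace A] [MeasurableSingletonClass A]
    {ρ : ℤ → A → ℝ} (hρ : ∀ i, IsProbVec (ρ i))
    {μ : Measure (ℤ → A)} (hprod : IsProductMeasure μ ρ)
    (hns : MeasEquiv (μ.map shift) μ)
    {δ : ℝ} (hδ : 0 < δ) (hd : ∀ (i : ℤ) (a : A), δ < ρ i a)
    {p : A → ℝ} (hp : IsProbVec p)
    (hlim : ∀ a, Tendsto (fun i : ℤ => ρ i a) cofinite (𝓝 (p a)))
    {m : ℕ} {q : Fin m → ℝ} (hq : IsProbVec q) (hq0 : ∀ b, 0 < q b) {l : ℕ} (a : Fin m → ℕ)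
    (ha : ∀ b, q b * 2^l = a b) (hH : entropy q < entropy p) (hH0 : 0 ≤ entropy q) :
    ∃ (ν : Measure (ℤ → Fin m)) (φ : (ℤ → A) → (ℤ → Fin m)),
        IsProductMeasure ν (fun _ => q) ∧ Measurable φ ∧
        (∀ᵐ x ∂μ, φ (shift x) = shift (φ x)) ∧
        MeasEquiv (μ.map φ) ν ∧ IsFinitary μ φ := by
  classical
  haveI := IsProbVec.nonempty (hρ 0)
  have hp0 : ∀ a, 0 < p a := fun a => lt_of_lt_of_le hδ
    (ge_of_tendsto (hlim a) (Eventually.of_forall fun i => (hd i a).le))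
  -- two letters
  have hA : ∃ α β : A, α ≠ β := by
    by_contra hcon
    push Not at hcon
    have : ∀ x, p x = 1 := by
      intro x
      rw [← hp.2, Finset.sum_eq_single x (fun b _ hb => (hb (hcon b x)).elim) (by simp)]
    have : entropy p = 0 := by unfold entropy; simp [this]
    linarith
  obtain ⟨α, β, hab⟩ := hA
  have hα1 : p α < 1 := by
    have : p α + p β ≤ ∑ a, p a := by
      rw [← Finset.sum_pair hab]
      exact Finset.sum_le_sum_of_subset_of_nonneg (Finset.subset_univ _) fun i _ _ => (hp0 i).le
    rw [hp.2] at this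
    linarith [hp0 β]
  -- exponents
  obtain ⟨c0, hc1, hc2⟩ := exists_between hH
  obtain ⟨d, hd1, hd2⟩ := exists_between hc2
  have l2 : 0 < Real.log 2 := Real.log_pos one_lt_two
  obtain ⟨s, hs0, -, hs⟩ := chern (p := p) (u := fun a => p a * 2^d) hp.2
    (fun a => by have := hp0 a; positivity) (by rw [sum_log hp.2 hp0]; nlinarith)
  obtain ⟨s', hs0', hs1', hs'⟩ := chern (p := q) (u := fun a => (q a * 2^c0)⁻¹) hq.2
    (fun a => by have := hq0 a; positivity) (by
      simp only [Real.log_inv, mul_neg, Finset.sum_neg_distrib]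
      rw [sum_log hq.2 hq0]; nlinarith)
  have c0p : 0 < c0 := lt_of_le_of_lt hH0 hc1
  set LA := Real.logb 2 (Fintype.card A) with hLA
  have cA : (0:ℝ) < Fintype.card A := by exact_mod_cast Fintype.card_pos
  obtain ⟨n0, hn0⟩ := exists_nat_gt ((c0 + 1 + 2 * LA) / (d - c0))
  obtain ⟨n0, hn0p, hn0⟩ : ∃ n0 : ℕ, 0 < n0 ∧ (c0 + 1 + 2*LA) / (d-c0) < n0 :=
    ⟨n0 + 1, by omega, by push_cast; linarith⟩
  rw [div_lt_iff₀ (by linarith)] at hn0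
  set e0 := ⌈(n0+1) * c0⌉₊ with he0
  have he1 : (n0+1) * c0 ≤ e0 := Nat.le_ceil _
  have he2 : (e0:ℝ) < (n0+1)*c0 + 1 := Nat.ceil_lt_add_one (by positivity)
  set ζ : ℝ := (Fintype.card A)^2 * 2^e0 * (((2:ℝ)^d)^n0)⁻¹ with hζ
  have hζ1 : ζ < 1 := by
    rw [hζ, ← div_eq_mul_inv, div_lt_one (by positivity)]
    have e1 : (Fintype.card A : ℝ) = 2^LA := by
      rw [hLA, Real.rpow_logb (by norm_num) (by norm_num) cA]
    rw [e1, ← Real.rpow_natCast, ← Real.rpow_natCast, ← Real.rpow_natCast, ← Real.rpow_mul (by norm_num), ← Real.rpow_mul (by norm_num),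
      ← Real.rpow_add (by norm_num)]
    apply Real.rpow_lt_rpow_of_exponent_lt (by norm_num)
    push_cast
    nlinarith
  obtain ⟨t, ht, hE⟩ := asym (θp := ∑ a, p a * (p a * 2^d)^s) (θq := ∑ a, q a * ((q a * 2^c0)⁻¹)^s') (ζ := ζ)
    (x := p α) (y := p β)
    (Finset.sum_nonneg fun a _ => by have := hp0 a; positivity) hs
    (Finset.sum_nonneg fun a _ => by have := hq0 a; positivity) hs'
    (by positivity) hζ1 (hp0 α).le hα1 l n0 (Fintype.card A) hn0p
  obtain ⟨C1, _, good, G, hcard, hG, hgood, hbad⟩ := exists_target hq a ha ((n0+1)*t) (e0*t)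
  haveI : Nonempty C1 := Fintype.card_pos_iff.1 (by rw [hcard]; positivity)
  obtain ⟨K, hK⟩ := exists_code α β (n0*t) t (C1 × Bool)
  have hsum := summable_diff hρ hprod hns
  refine factor_of_code hρ hprod hδ hd hsum hns (N := (n0+1)*t) (by positivity) good G hq hq0 hG hgood K ?_
  refine ae_X0 hρ hprod hlim (hp0 α) (hp0 β) (by positivity) (by nlinarith) good K ?_
  have b1 := EP_inact hp0 hp.2 K hK (c := 2^d) (s := s) (by positivity) hs0
  have b2 := (EP_bad hp0 hp.2 K good).trans (hbad.trans (min_words hq0 ((n0+1)*t) (c := 2^c0) (s := s')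
    (by positivity) hs0' hs1' (by positivity) (by
      apply inv_anti₀ (by positivity)
      rw [← Real.rpow_natCast, ← Real.rpow_natCast, ← Real.rpow_mul (by norm_num)]
      apply Real.rpow_le_rpow_of_exponent_le (by norm_num)
      push_cast
      have : (0:ℝ) ≤ t := by positivity
      nlinarith)))
  have e3 : ((Fintype.card A ^ (2 * t) * (n0*t + 1) ^ Fintype.card A * Fintype.card (C1 × Bool) : ℕ):ℝ) *
      (((2:ℝ)^d)^(n0*t))⁻¹ = 2 * (n0*t+1)^(Fintype.card A) * ζ^t := by
    rw [Fintype.card_prod, hcard, Fintype.card_bool, hζ]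
    push_cast
    rw [pow_mul (Fintype.card A : ℝ), pow_mul (2:ℝ), pow_mul ((2:ℝ)^d), mul_pow, mul_pow, inv_pow]
    ring
  rw [e3] at b1
  push_cast at b1 ⊢
  refine lt_of_le_of_lt ?_ hE
  have b2' := mul_le_mul_of_nonneg_left b2 (a := (l:ℝ) * ((n0+1)*t)) (by positivity)
  linarith

end NF


/-- Near optimal entropy finitary Sinai factors: a nonsingular Bernoulli shift satisfying
the Doeblin condition with limiting marginal `p` has, for every `ε > 0`, a finitary iid
factor of entropy greater than `H(p) - ε`. -/
theorem near_optimal_finitary_factors {A : Type*} [Fintype A]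
    [MeasurableSpace A] [MeasurableSingletonClass A]
    (ρ : ℤ → A → ℝ) (hρ : ∀ i, IsProbVec (ρ i))
    (μ : Measure (ℤ → A)) (hprod : IsProductMeasure μ ρ)
    (hns : MeasEquiv (μ.map shift) μ)
    (hdoeblin : ∃ δ > 0, ∀ (i : ℤ) (a : A), δ < ρ i a)
    (p : A → ℝ) (hp : IsProbVec p)
    (hlim : ∀ a, Tendsto (fun i : ℤ => ρ i a) cofinite (𝓝 (p a)))
    (ε : ℝ) (hε : 0 < ε) :
    ∃ (m : ℕ) (q : Fin m → ℝ), IsProbVec q ∧ entropy p - ε < entropy q ∧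
      ∃ (ν : Measure (ℤ → Fin m)) (φ : (ℤ → A) → (ℤ → Fin m)),
        IsProductMeasure ν (fun _ => q) ∧ Measurable φ ∧
        (∀ᵐ x ∂μ, φ (shift x) = shift (φ x)) ∧
        MeasEquiv (μ.map φ) ν ∧ IsFinitary μ φ := by
  haveI := NF.IsProbVec.nonempty (hρ 0)
  haveI := NF.isProb_of_product hprod
  rcases lt_or_ge (entropy p - ε) 0 with h0 | h0
  · refine ⟨1, fun _ => 1, ⟨fun _ => zero_le_one, by simp⟩, by simpa [entropy] using h0,
      μ.map (fun _ _ => 0), fun _ _ => 0, ?_, measurable_const, ?_, ⟨?_, ?_⟩, ?_⟩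
    · intro s y
      have : _root_.cylinder s y = univ := by
        ext x
        simp only [_root_.cylinder, mem_ofPred_eq, mem_univ, iff_true]
        intro i _
        exact Subsingleton.elim _ _
      rw [this, Measure.map_apply measurable_const MeasurableSet.univ]
      simp
    · exact Eventually.of_forall fun x => rfl
    · exact Measure.AbsolutelyContinuous.rfl
    · exact Measure.AbsolutelyContinuous.rfl
    · intro b
      refine ⟨fun _ => ∅, fun _ _ => Classical.arbitrary A, ?_⟩
      have e1 : {x : ℤ → A | (fun (_ : ℤ → A) (_ : ℤ) => (0 : Fin 1)) x 0 = b} = univ := by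
        ext x
        simp only [mem_ofPred_eq, mem_univ, iff_true]
        exact Subsingleton.elim _ _
      have e2 : (⋃ n : ℕ, _root_.cylinder ((fun _ => ∅ : ℕ → Finset ℤ) n)
          ((fun _ _ => Classical.arbitrary A : ℕ → ℤ → A) n)) = univ := by
        ext x
        simp [_root_.cylinder]
      rw [e1, e2]
      simp
  · obtain ⟨δ, hδ, hd⟩ := hdoeblin
    obtain ⟨m, q, l, a, hq, hq0, ha, h1, h2⟩ := NF.exists_q (H := entropy p) (ε := ε) (by linarith) hε
    exact ⟨m, q, hq, h1, NF.main_pos hρ hprod hns hδ hd hp hlim hq hq0 a ha h2 (by linarith)⟩
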